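/- Let Ω = ℝ^d. Assume F = G + τH is convex, G satisfies Assumption (A-ii), and τ > τ_c where τ_c = inf{τ' ≥ 0 : G + τ'H is convex}. Let (μ_t)_{t≥0} be a Wasserstein gradient flow of F starting from μ₀ ∈ P₂(ℝ^d). Assume there exist isotropic centered Gaussian measures γ₁ = N(0, σ₁²I) and γ₂ = N(0, σ₂²I) with σ₁ < σ₂, and m, M > 0, such that for all t ≥ 0 the density of μ_t satisfies m·γ₁ ≤ μ_t ≤ M·γ₂ pointwise. Then for every κ with 0 < κ < σ₁²/(σ₂² − σ₁²), there exists C > 0 depending only on τ, σ₁, σ₂, m, M, κ and L, such that for all t ≥ 0, F(μ_t) − inf F ≤ ( (F(μ₀) − inf F)^{−1/κ} + C(τ − τ_c)^{1+1/κ} t )^{−κ}. -/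

import Mathlib

open MeasureTheory ProbabilityTheory Real Set
open scoped ENNReal NNReal RealInnerProductSpace

noncomputable section
attribute [local instance] Classical.propDecidable

abbrev Ed (d : ℕ) := EuclideanSpace ℝ (Fin d)

def negEnt {d : ℕ} (μ : Measure (Ed d)) : EReal :=
  if μ ≪ (volume : Measure (Ed d)) ∧
      Integrable (fun x => ((μ.rnDeriv volume x).toReal) * Real.log ((μ.rnDeriv volume x).toReal)) volume
  then ((∫ x, ((μ.rnDeriv volume x).toReal) * Real.log ((μ.rnDeriv volume x).toReal) : ℝ) : EReal)
  else ⊤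

def IsP2 {d : ℕ} (μ : Measure (Ed d)) : Prop :=
  IsProbabilityMeasure μ ∧ Integrable (fun x => ‖x‖ ^ 2) μ

def mix {d : ℕ} (t : ℝ) (μ ν : Measure (Ed d)) : Measure (Ed d) :=
  ENNReal.ofReal (1 - t) • μ + ENNReal.ofReal t • ν

def ConvexFun {d : ℕ} (F : Measure (Ed d) → EReal) : Prop :=
  ∀ ⦃μ ν : Measure (Ed d)⦄, IsP2 μ → IsP2 ν → ∀ ⦃t : ℝ⦄, 0 ≤ t → t ≤ 1 →
    F (mix t μ ν) ≤ ((1 - t : ℝ) : EReal) * F μ + ((t : ℝ) : EReal) * F ν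

def obj {d : ℕ} (G : Measure (Ed d) → ℝ) (τ : ℝ) (μ : Measure (Ed d)) : EReal :=
  (G μ : EReal) + (τ : EReal) * negEnt μ

def tauC {d : ℕ} (G : Measure (Ed d) → ℝ) : ℝ :=
  sInf {τ' : ℝ | 0 ≤ τ' ∧ ConvexFun (obj G τ')}

def IsFirstVariation {d : ℕ} (G : Measure (Ed d) → ℝ) (μ : Measure (Ed d)) (g : Ed d → ℝ) : Prop :=
  ∀ ν : Measure (Ed d), IsP2 ν →
    HasDerivWithinAt (fun t : ℝ => G (mix t μ ν)) ((∫ x, g x ∂ν) - ∫ x, g x ∂μ) (Set.Ici (0:ℝ)) 0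

def AssumptionAii {d : ℕ} (G : Measure (Ed d) → ℝ) (G' : Measure (Ed d) → Ed d → ℝ)
    (α L : ℝ) : Prop :=
  ∀ μ : Measure (Ed d), IsP2 μ → IsFirstVariation G μ (G' μ) ∧ ContDiff ℝ 1 (G' μ) ∧
    ∃ V : Ed d → ℝ, (∀ x, G' μ x = α / 2 * ‖x‖ ^ 2 + V x) ∧ ∀ x, ‖gradient V x‖ ≤ L

def lap {d : ℕ} (f : Ed d → ℝ) (x : Ed d) : ℝ :=
  ∑ i : Fin d, iteratedFDeriv ℝ 2 f x ![EuclideanSpace.single i 1, EuclideanSpace.single i 1]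

structure IsWGF {d : ℕ} (G : Measure (Ed d) → ℝ) (G' : Measure (Ed d) → Ed d → ℝ) (τ : ℝ)
    (μ : ℝ → Measure (Ed d)) (ρ : ℝ → Ed d → ℝ) : Prop where
  isP2 : ∀ t : ℝ, 0 ≤ t → IsP2 (μ t)
  density_eq : ∀ t : ℝ, 0 < t → μ t = volume.withDensity (fun x => ENNReal.ofReal (ρ t x))
  density_pos : ∀ t : ℝ, 0 < t → ∀ x, 0 < ρ t x
  pde : ∀ φ : Ed d → ℝ, ContDiff ℝ (⊤ : ℕ∞) φ → HasCompactSupport φ →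
    ∀ t₁ t₂ : ℝ, 0 ≤ t₁ → t₁ ≤ t₂ →
      (∫ x, φ x ∂(μ t₂)) - (∫ x, φ x ∂(μ t₁))
        = ∫ s in t₁..t₂,
            ∫ x, (- ⟪gradient φ x, gradient (G' (μ s)) x⟫ + τ * lap φ x) ∂(μ s)
  finite : ∀ t : ℝ, 0 ≤ t → obj G τ (μ t) ≠ ⊤ ∧ obj G τ (μ t) ≠ ⊥
  dissipation : ∀ t₁ t₂ : ℝ, 0 ≤ t₁ → t₁ < t₂ →
    (obj G τ (μ t₂)).toReal - (obj G τ (μ t₁)).toReal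
      = - ∫ s in t₁..t₂,
            ∫ x, ‖gradient (G' (μ s)) x
                  + τ • gradient (fun y => Real.log (ρ s y)) x‖ ^ 2 ∂(μ s)

def infObj {d : ℕ} (G : Measure (Ed d) → ℝ) (τ : ℝ) : EReal :=
  ⨅ ν : {ν : Measure (Ed d) // IsP2 ν}, obj G τ ν.1

def gap {d : ℕ} (G : Measure (Ed d) → ℝ) (τ : ℝ) (μ : ℝ → Measure (Ed d)) (t : ℝ) : ℝ :=
  (obj G τ (μ t) - infObj G τ).toReal

def IsSubgaussian {d : ℕ} (M₀ : ℝ) (μ : Measure (Ed d)) : Prop :=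
  ∫ x, Real.exp (‖x‖ ^ 2 / M₀ ^ 2) ∂μ ≤ 2

/-- The centered isotropic Gaussian density on `ℝ^d` with standard deviation `σ`. -/
def gaussDen (d : ℕ) (σ : ℝ) (x : Ed d) : ℝ :=
  (2 * π * σ ^ 2) ^ (-(d : ℝ) / 2) * Real.exp (-‖x‖ ^ 2 / (2 * σ ^ 2))

namespace WGF

open Filter Topology

section

variable {d : ℕ}

/-- partial derivative -/
def pd (i : Fin d) (f : Ed d → ℝ) (x : Ed d) : ℝ := fderiv ℝ f x (EuclideanSpace.single i 1)

/-- measure with density -/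
def mu (ρ : Ed d → ℝ) : Measure (Ed d) := volume.withDensity (fun x => ENNReal.ofReal (ρ x))

def GB {ι : Type*} (g : ι → Ed d → ℝ) : Prop :=
  ∃ K a : ℝ, 0 ≤ K ∧ 0 < a ∧ ∀ i x, |g i x| ≤ K * exp (-a * ‖x‖ ^ 2)

def PB {ι : Type*} (g : ι → Ed d → ℝ) : Prop :=
  ∃ (K : ℝ) (k : ℕ), 0 ≤ K ∧ ∀ i x, |g i x| ≤ K * (1 + ‖x‖ ^ 2) ^ k

lemma integrable_gauss {a : ℝ} (ha : 0 < a) : Integrable (fun x : Ed d => exp (-a * ‖x‖ ^ 2)) := by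
  have h := GaussianFourier.integrable_cexp_neg_mul_sq_norm_add (V := Ed d) (b := (a : ℂ)) (by simpa using ha) 0 0
  have h2 := h.norm
  refine h2.congr (ae_of_all _ fun x => ?_)
  simp [Complex.norm_exp]
  left
  norm_cast

lemma GB.integrable {ι : Type*} {g : ι → Ed d → ℝ} (h : GB g) (i : ι)
    (hm : AEStronglyMeasurable (g i) volume) : Integrable (g i) := by
  obtain ⟨K, a, hK, ha, h⟩ := h
  refine Integrable.mono' ((integrable_gauss ha).const_mul K) hm (ae_of_all _ fun x => ?_)
  simpa using h i x

lemma GB.comp {ι κ : Type*} {g : ι → Ed d → ℝ} (h : GB g) (u : κ → ι) : GB (fun k => g (u k)) := by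
  obtain ⟨K, a, hK, ha, h⟩ := h
  exact ⟨K, a, hK, ha, fun i x => h _ x⟩

lemma PB.comp {ι κ : Type*} {g : ι → Ed d → ℝ} (h : PB g) (u : κ → ι) : PB (fun k => g (u k)) := by
  obtain ⟨K, k, hK, h⟩ := h
  exact ⟨K, k, hK, fun i x => h _ x⟩

lemma GB.mono {ι : Type*} {g f : ι → Ed d → ℝ} (h : GB g) (hf : ∀ i x, |f i x| ≤ |g i x|) : GB f := by
  obtain ⟨K, a, hK, ha, h⟩ := h
  exact ⟨K, a, hK, ha, fun i x => (hf i x).trans (h _ x)⟩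

lemma PB.mono {ι : Type*} {g f : ι → Ed d → ℝ} (h : PB g) (hf : ∀ i x, |f i x| ≤ |g i x|) : PB f := by
  obtain ⟨K, a, hK, h⟩ := h
  exact ⟨K, a, hK, fun i x => (hf i x).trans (h _ x)⟩

lemma GB.add {ι : Type*} {g f : ι → Ed d → ℝ} (h : GB g) (hf : GB f) : GB (fun i x => g i x + f i x) := by
  obtain ⟨K, a, hK, ha, h⟩ := h
  obtain ⟨K', a', hK', ha', h'⟩ := hf
  refine ⟨K + K', min a a', by positivity, by positivity, fun i x => ?_⟩
  have e1 : exp (-a * ‖x‖^2) ≤ exp (-(min a a') * ‖x‖^2) := by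
    apply exp_le_exp.2; nlinarith [min_le_left a a', sq_nonneg ‖x‖]
  have e2 : exp (-a' * ‖x‖^2) ≤ exp (-(min a a') * ‖x‖^2) := by
    apply exp_le_exp.2; nlinarith [min_le_right a a', sq_nonneg ‖x‖]
  calc _ ≤ |g i x| + |f i x| := abs_add_le _ _
    _ ≤ K * exp (-a * ‖x‖^2) + K' * exp (-a' * ‖x‖^2) := add_le_add (h i x) (h' i x)
    _ ≤ _ := by rw [add_mul]; gcongr

lemma GB.neg {ι : Type*} {g : ι → Ed d → ℝ} (h : GB g) : GB (fun i x => - g i x) :=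
  h.mono (fun i x => by simp)

lemma GB.sub {ι : Type*} {g f : ι → Ed d → ℝ} (h : GB g) (hf : GB f) : GB (fun i x => g i x - f i x) := by
  simpa [sub_eq_add_neg] using h.add hf.neg

lemma PB.add {ι : Type*} {g f : ι → Ed d → ℝ} (h : PB g) (hf : PB f) : PB (fun i x => g i x + f i x) := by
  obtain ⟨K, a, hK, h⟩ := h
  obtain ⟨K', a', hK', h'⟩ := hf
  refine ⟨K + K', max a a', by positivity, fun i x => ?_⟩
  have h1 : 1 ≤ 1 + ‖x‖^2 := by nlinarith [sq_nonneg ‖x‖]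
  calc _ ≤ |g i x| + |f i x| := abs_add_le _ _
    _ ≤ K * (1 + ‖x‖^2)^a + K' * (1 + ‖x‖^2)^a' := add_le_add (h i x) (h' i x)
    _ ≤ _ := by
      rw [add_mul]
      gcongr
      · exact le_max_left _ _
      · exact le_max_right _ _

lemma PB.neg {ι : Type*} {g : ι → Ed d → ℝ} (h : PB g) : PB (fun i x => - g i x) :=
  h.mono (fun i x => by simp)

lemma PB.sub {ι : Type*} {g f : ι → Ed d → ℝ} (h : PB g) (hf : PB f) : PB (fun i x => g i x - f i x) := by
  simpa [sub_eq_add_neg] using h.add hf.neg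

lemma PB.mul {ι : Type*} {g f : ι → Ed d → ℝ} (h : PB g) (hf : PB f) : PB (fun i x => g i x * f i x) := by
  obtain ⟨K, a, hK, h⟩ := h
  obtain ⟨K', a', hK', h'⟩ := hf
  refine ⟨K * K', a + a', by positivity, fun i x => ?_⟩
  rw [abs_mul, pow_add, mul_mul_mul_comm]
  gcongr
  · exact h i x
  · exact h' i x

lemma PB.const {ι : Type*} (c : ℝ) : PB (fun (_ : ι) (_ : Ed d) => c) :=
  ⟨|c|, 0, abs_nonneg _, fun i x => by simp⟩

lemma PB.const_mul {ι : Type*} {g : ι → Ed d → ℝ} (h : PB g) (c : ℝ) : PB (fun i x => c * g i x) :=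
  (PB.const c).mul h

lemma PB.sq {ι : Type*} {g : ι → Ed d → ℝ} (h : PB g) : PB (fun i x => g i x ^ 2) := by
  simpa [pow_two] using h.mul h

lemma PB.quad {ι : Type*} : PB (fun (_ : ι) (x : Ed d) => 1 + ‖x‖ ^ 2) :=
  ⟨1, 1, by simp, fun i x => by rw [abs_of_nonneg (by positivity)]; simp⟩

lemma PB.normsq {ι : Type*} : PB (fun (_ : ι) (x : Ed d) => ‖x‖ ^ 2) :=
  PB.quad.mono fun i x => by
    rw [abs_of_nonneg (by positivity), abs_of_nonneg (by positivity)]; linarith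

lemma PB.norm {ι : Type*} : PB (fun (_ : ι) (x : Ed d) => ‖x‖) :=
  PB.quad.mono fun i x => by
    rw [abs_of_nonneg (by positivity), abs_of_nonneg (by positivity)]; nlinarith [sq_nonneg (‖x‖ - 1)]

lemma poly_exp_bound (k : ℕ) {a : ℝ} (ha : 0 < a) :
    ∃ C, 0 ≤ C ∧ ∀ s : ℝ, 0 ≤ s → (1 + s) ^ k * exp (-a * s) ≤ C * exp (-(a/2) * s) := by
  refine ⟨(Nat.factorial k) * (2 / a) ^ k * exp (a/2), by positivity, fun s hs => ?_⟩
  have h := Real.pow_div_factorial_le_exp (a/2 * (1+s)) (by positivity) k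
  rw [div_le_iff₀ (by positivity), mul_pow] at h
  have h2 : (1 + s)^k ≤ (Nat.factorial k) * (2 / a) ^ k * exp (a/2 * (1+s)) := by
    calc (1+s)^k = (2/a)^k * ((a/2)^k * (1+s)^k) := by
          rw [← mul_assoc, ← mul_pow]; field_simp; simp
      _ ≤ (2/a)^k * (exp (a/2 * (1+s)) * (Nat.factorial k)) := by gcongr
      _ = _ := by ring
  calc _ ≤ ((Nat.factorial k) * (2 / a) ^ k * exp (a/2 * (1+s))) * exp (-a * s) := by gcongr
    _ = _ := by
      rw [mul_assoc, mul_assoc, mul_assoc, mul_assoc, ← exp_add, ← exp_add]; ring_nf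

lemma PB.mul_GB {ι : Type*} {g f : ι → Ed d → ℝ} (h : PB g) (hf : GB f) : GB (fun i x => g i x * f i x) := by
  obtain ⟨K, k, hK, h⟩ := h
  obtain ⟨K', a, hK', ha, h'⟩ := hf
  obtain ⟨C, hC, hb⟩ := poly_exp_bound k ha
  refine ⟨K * K' * C, a / 2, by positivity, by positivity, fun i x => ?_⟩
  rw [abs_mul]
  calc _ ≤ (K * (1 + ‖x‖^2)^k) * (K' * exp (-a * ‖x‖^2)) := by
        gcongr
        · exact h i x
        · exact h' i x
    _ = K * K' * ((1 + ‖x‖^2)^k * exp (-a * ‖x‖^2)) := by ring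
    _ ≤ K * K' * (C * exp (-(a/2) * ‖x‖^2)) := by
      exact mul_le_mul_of_nonneg_left (hb _ (sq_nonneg _)) (by positivity)
    _ = _ := by ring

lemma GB.const_mul {ι : Type*} {g : ι → Ed d → ℝ} (h : GB g) (c : ℝ) : GB (fun i x => c * g i x) :=
  (PB.const c).mul_GB h

lemma GB.abs {ι : Type*} {g : ι → Ed d → ℝ} (h : GB g) : GB (fun i x => |g i x|) :=
  h.mono (by simp)

lemma PB.abs {ι : Type*} {g : ι → Ed d → ℝ} (h : PB g) : PB (fun i x => |g i x|) :=
  h.mono (by simp)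

lemma GB.PB {ι : Type*} {g : ι → Ed d → ℝ} (h : GB g) : PB g := by
  obtain ⟨K, a, hK, ha, h⟩ := h
  refine ⟨K, 0, hK, fun i x => (h i x).trans ?_⟩
  have : exp (-a * ‖x‖^2) ≤ 1 := exp_le_one_iff.2 (by nlinarith [sq_nonneg ‖x‖])
  nlinarith

lemma GB.mul {ι : Type*} {g f : ι → Ed d → ℝ} (h : GB g) (hf : GB f) : GB (fun i x => g i x * f i x) :=
  h.PB.mul_GB hf

lemma GB.sum {ι κ : Type*} (s : Finset κ) {g : κ → ι → Ed d → ℝ} (h : ∀ k ∈ s, GB (g k)) :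
    GB (fun i x => ∑ k ∈ s, g k i x) := by
  classical
  induction s using Finset.induction_on with
  | empty => exact ⟨0, 1, le_rfl, one_pos, by simp⟩
  | insert k s hk ih =>
    simp only [Finset.sum_insert hk]
    exact (h k (by simp)).add (ih fun j hj => h j (by simp [hj]))

lemma GB.gauss {ι : Type*} {a : ℝ} (ha : 0 < a) : GB (fun (_ : ι) (x : Ed d) => exp (-a * ‖x‖ ^ 2)) :=
  ⟨1, a, by simp, ha, fun i x => by simp⟩

/-- uniform integral bound -/
lemma GB.integral_le {ι : Type*} {g : ι → Ed d → ℝ} (h : GB g) :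
    ∃ C, 0 ≤ C ∧ ∀ i, ∫ x, |g i x| ≤ C := by
  obtain ⟨K, a, hK, ha, h⟩ := h
  refine ⟨∫ x : Ed d, K * exp (-a * ‖x‖^2), integral_nonneg fun x => by positivity, fun i => ?_⟩
  exact integral_mono_of_nonneg (ae_of_all _ fun x => abs_nonneg _) ((integrable_gauss ha).const_mul K)
    (ae_of_all _ fun x => h i x)

lemma GB.abs_integral_le {ι : Type*} {g : ι → Ed d → ℝ} (h : GB g) :
    ∃ C, 0 ≤ C ∧ ∀ i, |∫ x, g i x| ≤ C := by
  obtain ⟨C, hC, h⟩ := h.integral_le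
  exact ⟨C, hC, fun i => abs_integral_le_integral_abs.trans (h i)⟩

lemma GB.tendsto {ι : Type*} {l : Filter ι} [l.IsCountablyGenerated] {g : ι → Ed d → ℝ} (h : GB g) {f : Ed d → ℝ}
    (hm : ∀ᶠ i in l, AEStronglyMeasurable (g i) volume)
    (ht : ∀ᵐ x, Tendsto (fun i => g i x) l (𝓝 (f x))) :
    Tendsto (fun i => ∫ x, g i x) l (𝓝 (∫ x, f x)) := by
  obtain ⟨K, a, hK, ha, h⟩ := h
  refine tendsto_integral_filter_of_dominated_convergence (fun x => K * exp (-a * ‖x‖^2)) hm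
    (Eventually.of_forall fun i => ae_of_all _ fun x => by simpa using h i x) ((integrable_gauss ha).const_mul K) ht

end

section

variable {d : ℕ}

structure Dens (k : Ed d → ℝ) : Prop where
  meas : Measurable k
  nonneg : ∀ x, 0 ≤ k x
  integ : Integrable k
  int1 : ∫ x, k x = 1
  sec : Integrable (fun x => ‖x‖ ^ 2 * k x)
  ent : Integrable (fun x => k x * log (k x))

structure Nice (c₀ a₁ C₀ a₂ : ℝ) (ρ : Ed d → ℝ) : Prop where
  c₀pos : 0 < c₀
  a₁pos : 0 < a₁
  C₀pos : 0 < C₀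
  a₂pos : 0 < a₂
  meas : Measurable ρ
  int1 : ∫ x, ρ x = 1
  lb : ∀ x, c₀ * exp (-a₁ * ‖x‖ ^ 2) ≤ ρ x
  ub : ∀ x, ρ x ≤ C₀ * exp (-a₂ * ‖x‖ ^ 2)

lemma lintegral_mu {ρ : Ed d → ℝ} (hm : Measurable ρ) (f : Ed d → ℝ≥0∞) (hf : Measurable f) :
    ∫⁻ x, f x ∂(mu ρ) = ∫⁻ x, ENNReal.ofReal (ρ x) * f x := by
  rw [mu, lintegral_withDensity_eq_lintegral_mul _ (by fun_prop) hf]; rfl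

lemma integral_mu {ρ : Ed d → ℝ} (hm : Measurable ρ) (h0 : ∀ x, 0 ≤ ρ x) (f : Ed d → ℝ) :
    ∫ x, f x ∂(mu ρ) = ∫ x, f x * ρ x := by
  rw [mu, integral_withDensity_eq_integral_toReal_smul (by fun_prop) (ae_of_all _ fun x => by simp)]
  refine integral_congr_ae (ae_of_all _ fun x => ?_)
  simp [ENNReal.toReal_ofReal (h0 x), mul_comm]

lemma integrable_mu {ρ : Ed d → ℝ} (hm : Measurable ρ) (h0 : ∀ x, 0 ≤ ρ x) (f : Ed d → ℝ) :
    Integrable f (mu ρ) ↔ Integrable (fun x => f x * ρ x) := by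
  rw [mu, integrable_withDensity_iff (by fun_prop) (ae_of_all _ fun x => by simp)]
  simp [ENNReal.toReal_ofReal (h0 _)]

lemma Dens.isProb {k : Ed d → ℝ} (h : Dens k) : IsProbabilityMeasure (mu k) := by
  constructor
  rw [mu, withDensity_apply _ MeasurableSet.univ, Measure.restrict_univ,
    ← ofReal_integral_eq_lintegral_ofReal h.integ (ae_of_all _ h.nonneg), h.int1]; simp

lemma Dens.isP2 {k : Ed d → ℝ} (h : Dens k) : IsP2 (mu k) :=
  ⟨h.isProb, (integrable_mu h.meas h.nonneg _).2 h.sec⟩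

lemma rnDeriv_mu {k : Ed d → ℝ} (hm : Measurable k) (h0 : ∀ x, 0 ≤ k x) :
    (fun x => ((mu k).rnDeriv volume x).toReal) =ᵐ[volume] k := by
  filter_upwards [Measure.rnDeriv_withDensity (volume : Measure (Ed d)) (f := fun x => ENNReal.ofReal (k x)) (by fun_prop)] with x hx
  rw [mu, hx, ENNReal.toReal_ofReal (h0 x)]

def Ent (k : Ed d → ℝ) : ℝ := ∫ x, k x * log (k x)

lemma negEnt_mu {k : Ed d → ℝ} (h : Dens k) : negEnt (mu k) = ((Ent k : ℝ) : EReal) := by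
  have e := rnDeriv_mu h.meas h.nonneg
  have e2 : (fun x => (((mu k).rnDeriv volume x).toReal) * Real.log (((mu k).rnDeriv volume x).toReal))
    =ᵐ[volume] fun x => k x * log (k x) := by
    filter_upwards [e] with x hx; rw [hx]
  rw [negEnt, if_pos ⟨withDensity_absolutelyContinuous _ _, (integrable_congr e2).2 h.ent⟩,
    integral_congr_ae e2]; rfl

def Fr (G : Measure (Ed d) → ℝ) (τ : ℝ) (k : Ed d → ℝ) : ℝ := G (mu k) + τ * Ent k

lemma obj_mu {k : Ed d → ℝ} (h : Dens k) (G : Measure (Ed d) → ℝ) (τ : ℝ) :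
    obj G τ (mu k) = ((Fr G τ k : ℝ) : EReal) := by
  rw [obj, negEnt_mu h, Fr, EReal.coe_add, EReal.coe_mul]

lemma exists_dens {ν : Measure (Ed d)} (h : IsP2 ν) (hn : negEnt ν ≠ ⊤) : ∃ k, Dens k ∧ ν = mu k := by
  have := h.1
  rw [negEnt] at hn
  have hh := (ite_ne_right_iff.1 hn).1
  have e : ν = mu (fun x => (ν.rnDeriv volume x).toReal) := by
    conv_lhs => rw [← Measure.withDensity_rnDeriv_eq _ _ hh.1]
    rw [mu]
    refine withDensity_congr_ae ?_
    filter_upwards [Measure.rnDeriv_lt_top ν volume] with x hx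
    rw [ENNReal.ofReal_toReal hx.ne]
  have m1 : Measurable (fun x => (ν.rnDeriv volume x).toReal) := by fun_prop
  refine ⟨_, ⟨m1, fun x => ENNReal.toReal_nonneg, Measure.integrable_toReal_rnDeriv, ?_, ?_, hh.2⟩, e⟩
  · have : ∫ x, (1 : ℝ) ∂ν = 1 := by simp
    rw [e, integral_mu m1 (fun x => ENNReal.toReal_nonneg)] at this
    simpa using this
  · have := h.2
    rw [e, integrable_mu m1 (fun x => ENNReal.toReal_nonneg)] at this
    exact this

lemma mix_mu {ρ k : Ed d → ℝ} (hρ : Measurable ρ) (hk : Measurable k) (h0 : ∀ x, 0 ≤ ρ x) (h1 : ∀ x, 0 ≤ k x)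
    {s : ℝ} (hs : 0 ≤ s) (hs1 : s ≤ 1) :
    mix s (mu ρ) (mu k) = mu (fun x => (1 - s) * ρ x + s * k x) := by
  rw [mix, mu, mu, mu, ← withDensity_smul _ (by fun_prop), ← withDensity_smul _ (by fun_prop),
    ← withDensity_add_left (by fun_prop)]
  congr 1
  ext x
  simp only [Pi.add_apply, Pi.smul_apply, smul_eq_mul]
  rw [ENNReal.ofReal_add (mul_nonneg (by linarith) (h0 x)) (mul_nonneg hs (h1 x)),
    ENNReal.ofReal_mul (by linarith), ENNReal.ofReal_mul hs]

/-! Nice densities -/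
section
variable {c₀ a₁ C₀ a₂ : ℝ}

lemma Nice.pos {ρ : Ed d → ℝ} (h : Nice c₀ a₁ C₀ a₂ ρ) (x : Ed d) : 0 < ρ x :=
  lt_of_lt_of_le (mul_pos h.c₀pos (exp_pos _)) (h.lb x)

lemma Nice.log_le {ρ : Ed d → ℝ} (h : Nice c₀ a₁ C₀ a₂ ρ) (x : Ed d) :
    |log (ρ x)| ≤ (|log c₀| + |log C₀| + a₁ + a₂) * (1 + ‖x‖ ^ 2) := by
  have h1 := log_le_log (mul_pos h.c₀pos (exp_pos _)) (h.lb x)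
  have h2 := log_le_log (h.pos x) (h.ub x)
  rw [log_mul h.c₀pos.ne' (exp_pos _).ne', log_exp] at h1
  rw [log_mul h.C₀pos.ne' (exp_pos _).ne', log_exp] at h2
  have := h.a₁pos; have := h.a₂pos
  have := neg_abs_le (log c₀); have := le_abs_self (log C₀)
  have p0 := sq_nonneg ‖x‖
  have p1 := mul_nonneg h.a₁pos.le p0
  have p2 := mul_nonneg h.a₂pos.le p0
  have p3 := mul_nonneg (abs_nonneg (log c₀)) p0
  have p4 := mul_nonneg (abs_nonneg (log C₀)) p0
  have p5 := abs_nonneg (log c₀)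
  have p6 := abs_nonneg (log C₀)
  rw [abs_le]; constructor <;> nlinarith

lemma Nice.PBlog (c₀ a₁ C₀ a₂ : ℝ) :
    PB (fun (ρ : {ρ : Ed d → ℝ // Nice c₀ a₁ C₀ a₂ ρ}) x => log (ρ.1 x)) := by
  refine ⟨|(|log c₀| + |log C₀| + a₁ + a₂)|, 1, abs_nonneg _, fun ρ x => (ρ.2.log_le x).trans ?_⟩
  rw [pow_one]; gcongr; exact le_abs_self _

lemma Nice.GB (c₀ a₁ C₀ a₂ : ℝ) :
    GB (fun (ρ : {ρ : Ed d → ℝ // Nice c₀ a₁ C₀ a₂ ρ}) x => ρ.1 x) := by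
  by_cases h : Nonempty {ρ : Ed d → ℝ // Nice c₀ a₁ C₀ a₂ ρ}
  · obtain ⟨ρ⟩ := h
    refine ⟨C₀, a₂, ρ.2.C₀pos.le, ρ.2.a₂pos, fun ρ x => ?_⟩
    rw [abs_of_pos (ρ.2.pos x)]; exact ρ.2.ub x
  · exact ⟨0, 1, le_rfl, one_pos, fun ρ => (h ⟨ρ⟩).elim⟩

lemma Nice.GB1 {ρ : Ed d → ℝ} (h : Nice c₀ a₁ C₀ a₂ ρ) : WGF.GB (fun (_ : Unit) x => ρ x) :=
  (Nice.GB c₀ a₁ C₀ a₂).comp (fun _ => ⟨ρ, h⟩)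

lemma Nice.PBlog1 {ρ : Ed d → ℝ} (h : Nice c₀ a₁ C₀ a₂ ρ) : PB (fun (_ : Unit) x => log (ρ x)) :=
  (Nice.PBlog c₀ a₁ C₀ a₂).comp (fun _ => ⟨ρ, h⟩)

lemma Nice.dens {ρ : Ed d → ℝ} (h : Nice c₀ a₁ C₀ a₂ ρ) : Dens ρ := by
  have hm := h.meas
  refine ⟨hm, fun x => (h.pos x).le, h.GB1.integrable () hm.aestronglyMeasurable, h.int1, ?_, ?_⟩
  · exact (PB.normsq.mul_GB h.GB1).integrable () (by fun_prop)
  · have := (h.PBlog1.mul_GB h.GB1).integrable () (Measurable.aestronglyMeasurable (by fun_prop))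
    refine this.congr (ae_of_all _ fun x => mul_comm _ _)
end

/-! quadratically bounded functions against densities -/
lemma Dens.integrable_mul {k g : Ed d → ℝ} (h : Dens k) (hg : Measurable g) {K : ℝ}
    (hK : ∀ x, |g x| ≤ K * (1 + ‖x‖ ^ 2)) : Integrable (fun x => g x * k x) := by
  have hm := h.meas
  refine Integrable.mono' ((h.integ.add h.sec).const_mul K) (Measurable.aestronglyMeasurable (by fun_prop))
    (ae_of_all _ fun x => ?_)
  rw [norm_eq_abs, abs_mul, abs_of_nonneg (h.nonneg x)]
  calc _ ≤ K * (1 + ‖x‖^2) * k x := mul_le_mul_of_nonneg_right (hK x) (h.nonneg x)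
    _ = _ := by simp only [Pi.add_apply]; ring

/-- tangent inequality -/
lemma tangent {a b : ℝ} (ha : 0 < a) (hb : 0 ≤ b) : a * log a + (1 + log a) * (b - a) ≤ b * log b := by
  rcases hb.eq_or_lt with rfl | hb
  · simp; nlinarith
  · have := one_sub_inv_le_log_of_pos (div_pos hb ha)
    rw [log_div hb.ne' ha.ne', inv_div] at this
    have h2 := mul_le_mul_of_nonneg_left this hb.le
    have : b * (1 - a / b) = b - a := by field_simp
    nlinarith

lemma mix_dens {ρ k : Ed d → ℝ} {c₀ a₁ C₀ a₂ : ℝ} (hρ : Nice c₀ a₁ C₀ a₂ ρ) (hk : Dens k)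
    {s : ℝ} (hs : 0 ≤ s) (hs1 : s ≤ 1) : Dens (fun x => (1 - s) * ρ x + s * k x) := by
  have m1 := hρ.meas; have m2 := hk.meas
  have D := hρ.dens
  have n : ∀ x, 0 ≤ (1 - s) * ρ x + s * k x := fun x =>
    add_nonneg (mul_nonneg (by linarith) (D.nonneg x)) (mul_nonneg hs (hk.nonneg x))
  refine ⟨by fun_prop, n,
    (D.integ.const_mul _).add (hk.integ.const_mul _), ?_, ?_, ?_⟩
  · rw [integral_add (D.integ.const_mul _) (hk.integ.const_mul _), integral_const_mul, integral_const_mul, D.int1, hk.int1]; ring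
  · refine ((D.sec.const_mul (1-s)).add (hk.sec.const_mul s)).congr (ae_of_all _ fun x => ?_)
    simp only [Pi.add_apply]; ring
  · have i1 := D.integrable_mul (g := fun x => log (ρ x)) (by fun_prop) hρ.log_le
    have i2 := hk.integrable_mul (g := fun x => log (ρ x)) (by fun_prop) hρ.log_le
    have I1 : Integrable (fun x => (1 - s) * (ρ x * log (ρ x)) + s * (k x * log (k x))) :=
      (D.ent.const_mul _).add (hk.ent.const_mul _)
    have I2 : Integrable (fun x => ρ x * log (ρ x) + s * (k x - ρ x + log (ρ x) * k x - log (ρ x) * ρ x)) :=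
      D.ent.add ((((hk.integ.sub D.integ).add i2).sub i1).const_mul s)
    refine integrable_of_le_of_le (Measurable.aestronglyMeasurable (by fun_prop)) (ae_of_all _ fun x => ?_) (ae_of_all _ fun x => ?_) I2 I1
    · have := tangent (hρ.pos x) (n x)
      simp only
      linarith
    · have := Real.convexOn_mul_log.2 (D.nonneg x) (hk.nonneg x) (by linarith : 0 ≤ 1 - s) hs (by ring)
      simpa using this

/-- the gradient inequality -/
lemma grad_ineq {G : Measure (Ed d) → ℝ} {τ' : ℝ} (hτ : 0 ≤ τ') (hc : ConvexFun (obj G τ')) {ρ k U : Ed d → ℝ}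
    {c₀ a₁ C₀ a₂ : ℝ} (hρ : Nice c₀ a₁ C₀ a₂ ρ) (hk : Dens k) (hU : IsFirstVariation G (mu ρ) U) (hUm : Measurable U)
    {K : ℝ} (hUK : ∀ x, |U x| ≤ K * (1 + ‖x‖ ^ 2)) :
    Fr G τ' ρ + ∫ x, (U x + τ' * log (ρ x)) * (k x - ρ x) ≤ Fr G τ' k := by
  have D := hρ.dens
  have m1 := hρ.meas; have m2 := hk.meas
  have i1 := D.integrable_mul (g := fun x => log (ρ x)) (by fun_prop) hρ.log_le
  have i2 := hk.integrable_mul (g := fun x => log (ρ x)) (by fun_prop) hρ.log_le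
  have j1 := D.integrable_mul hUm hUK
  have j2 := hk.integrable_mul hUm hUK
  have der := (hU (mu k) hk.isP2)
  rw [integral_mu m1 D.nonneg, integral_mu m2 hk.nonneg] at der
  have e : ∫ x, (U x + τ' * log (ρ x)) * (k x - ρ x) = ((∫ x, U x * k x) - ∫ x, U x * ρ x) +
      τ' * ((∫ x, log (ρ x) * k x) - ∫ x, log (ρ x) * ρ x) := by
    have h12 : Integrable (fun x => U x * k x - U x * ρ x) := j2.sub j1
    have h34 : Integrable (fun x => τ' * (log (ρ x) * k x - log (ρ x) * ρ x)) := (i2.sub i1).const_mul _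
    rw [← integral_sub j2 j1, ← integral_sub i2 i1, ← integral_const_mul, ← integral_add h12 h34]
    congr 1; ext x; ring
  rw [e]
  set lg := (∫ x, log (ρ x) * k x) - ∫ x, log (ρ x) * ρ x with hlg
  have key : ∀ s ∈ Ioc (0:ℝ) 1, s⁻¹ * (G (mix s (mu ρ) (mu k)) - G (mix 0 (mu ρ) (mu k))) ≤ Fr G τ' k - Fr G τ' ρ - τ' * lg := by
    intro s ⟨hs0, hs1⟩
    have mx := mix_dens hρ hk hs0.le hs1
    have cv := hc D.isP2 hk.isP2 hs0.le hs1
    rw [mix_mu m1 m2 D.nonneg hk.nonneg hs0.le hs1, obj_mu mx, obj_mu D, obj_mu hk] at cv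
    rw [mix_mu m1 m2 D.nonneg hk.nonneg hs0.le hs1, mix_mu m1 m2 D.nonneg hk.nonneg le_rfl zero_le_one]
    have cv' : Fr G τ' (fun x => (1 - s) * ρ x + s * k x) ≤ (1 - s) * Fr G τ' ρ + s * Fr G τ' k := by
      exact_mod_cast cv
    have hE : Ent ρ + s * lg ≤ Ent (fun x => (1 - s) * ρ x + s * k x) := by
      have I2 : Integrable (fun x => ρ x * log (ρ x) + s * (k x - ρ x + log (ρ x) * k x - log (ρ x) * ρ x)) :=
        D.ent.add ((((hk.integ.sub D.integ).add i2).sub i1).const_mul s)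
      have e3 : Ent ρ + s * lg = ∫ x, (ρ x * log (ρ x) + s * (k x - ρ x + log (ρ x) * k x - log (ρ x) * ρ x)) := by
        have A1 : Integrable (fun x => k x - ρ x) := hk.integ.sub D.integ
        have A2 : Integrable (fun x => k x - ρ x + log (ρ x) * k x) := A1.add i2
        have A3 : Integrable (fun x => s * (k x - ρ x + log (ρ x) * k x - log (ρ x) * ρ x)) := (A2.sub i1).const_mul s
        rw [integral_add D.ent A3, integral_const_mul,
          integral_sub A2 i1, integral_add A1 i2, integral_sub hk.integ D.integ,
          hk.int1, D.int1, hlg, Ent]; ring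
      rw [e3]
      refine integral_mono I2 mx.ent fun x => ?_
      have := tangent (hρ.pos x) (mx.nonneg x)
      simp only
      linarith
    have e0 : (fun x => (1 - 0) * ρ x + 0 * k x) = ρ := by ext x; ring
    rw [e0]
    rw [inv_mul_le_iff₀ hs0]
    simp only [Fr] at cv' ⊢
    have := mul_le_mul_of_nonneg_left hE hτ
    nlinarith
  have lim := (hasDerivWithinAt_iff_tendsto_slope' (by simp)).1 (der.mono Ioi_subset_Ici_self)
  have : ((∫ x, U x * k x) - ∫ x, U x * ρ x) ≤ Fr G τ' k - Fr G τ' ρ - τ' * lg := by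
    refine le_of_tendsto lim ?_
    filter_upwards [Ioc_mem_nhdsGT (zero_lt_one (α := ℝ))] with s hs
    rw [slope_def_module]; simpa using key s hs
  linarith

end

section

variable {d : ℕ}

structure Pot (α L : ℝ) (U : Ed d → ℝ) : Prop where
  smooth : ContDiff ℝ 1 U
  zero : U 0 = 0
  grad : ∀ i x, |pd i U x - α * x i| ≤ L
  bd : ∀ x, |U x - α / 2 * ‖x‖ ^ 2| ≤ L * ‖x‖

def Setup (G : Measure (Ed d) → ℝ) (G' : Measure (Ed d) → Ed d → ℝ) (α L : ℝ) : Prop :=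
  ∀ μ : Measure (Ed d), IsP2 μ → IsFirstVariation G μ (G' μ) ∧ Pot α L (G' μ)

lemma fderiv_halfsq (α : ℝ) (x : Ed d) :
    HasFDerivAt (fun x : Ed d => α / 2 * ‖x‖ ^ 2) (α • innerSL ℝ x) x := by
  have := (hasStrictFDerivAt_norm_sq x).hasFDerivAt.const_mul (α / 2)
  refine this.congr_fderiv ?_
  ext y
  simp
  ring

lemma pd_halfsq (α : ℝ) (i : Fin d) (x : Ed d) : pd i (fun x : Ed d => α / 2 * ‖x‖ ^ 2) x = α * x i := by
  rw [pd, (fderiv_halfsq α x).fderiv]; simp [EuclideanSpace.inner_single_right]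

lemma norm_single_one (i : Fin d) : ‖(EuclideanSpace.single i (1:ℝ) : Ed d)‖ = 1 := by simp

lemma setup_of_aii {G : Measure (Ed d) → ℝ} {G' : Measure (Ed d) → Ed d → ℝ} {α L : ℝ}
    (h : AssumptionAii G G' α L) : Setup G (fun μ x => G' μ x - G' μ 0) α L := by
  intro μ hμ
  obtain ⟨h1, h2, V, hV, hL⟩ := h μ hμ
  have hVe : V = fun x => G' μ x - α / 2 * ‖x‖ ^ 2 := by ext x; rw [hV]; ring
  have hdU : Differentiable ℝ (G' μ) := h2.differentiable (by simp)
  have hVd : ∀ x, HasFDerivAt V (fderiv ℝ (G' μ) x - α • innerSL ℝ x) x := by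
    intro x; rw [hVe]; exact (hdU x).hasFDerivAt.sub (fderiv_halfsq α x)
  have hVn : ∀ x, ‖fderiv ℝ V x‖ ≤ L := by
    intro x
    have := hL x
    rwa [gradient, LinearIsometryEquiv.norm_map] at this
  have hVlip : ∀ x, |V x - V 0| ≤ L * ‖x‖ := by
    intro x
    have := Convex.norm_image_sub_le_of_norm_fderiv_le (s := univ) (𝕜 := ℝ) (f := V) (C := L)
      (fun x _ => (hVd x).differentiableAt) (fun x _ => hVn x) convex_univ (mem_univ 0) (mem_univ x)
    simpa using this
  have hbd : ∀ x, |G' μ x| ≤ (α/2 |> abs) * ‖x‖^2 + L * ‖x‖ + |V 0| := by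
    intro x
    rw [hV]
    have := hVlip x
    have e : α/2 * ‖x‖^2 + V x = α/2 * ‖x‖^2 + (V x - V 0) + V 0 := by ring
    rw [e]
    refine (abs_add_three _ _ _).trans ?_
    rw [abs_mul, abs_of_nonneg (sq_nonneg ‖x‖)]
    gcongr
  have L0 : 0 ≤ L := (norm_nonneg _).trans (hL 0)
  have hInt0 : ∀ ν : Measure (Ed d), IsP2 ν → Integrable (G' μ) ν := by
    intro ν hν
    have := hν.1
    refine Integrable.mono' (g := fun x => (|α/2| + L) * ‖x‖^2 + (L + |V 0|)) ((hν.2.const_mul _).add (integrable_const _)) h2.continuous.measurable.aestronglyMeasurable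
      (ae_of_all _ fun x => ?_)
    rw [norm_eq_abs]
    refine (hbd x).trans ?_
    nlinarith [mul_nonneg L0 (sq_nonneg (‖x‖ - 1)), mul_nonneg L0 (sq_nonneg (‖x‖)), mul_nonneg L0 (norm_nonneg x)]
  refine ⟨?_, ?_, ?_, ?_, ?_⟩
  · intro ν hν
    have := h1 ν hν
    have := hν.1; have := hμ.1
    rw [integral_sub (hInt0 ν hν) (integrable_const _), integral_sub (hInt0 μ hμ) (integrable_const _)]
    simpa using h1 ν hν
  · exact h2.sub contDiff_const
  · simp
  · intro i x
    have e : pd i (fun x => G' μ x - G' μ 0) x - α * x i = fderiv ℝ V x (EuclideanSpace.single i 1) := by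
      rw [(hVd x).fderiv, pd, fderiv_sub_const]
      simp [EuclideanSpace.inner_single_right]
    rw [e, ← norm_eq_abs]
    refine (ContinuousLinearMap.le_opNorm _ _).trans ?_
    rw [norm_single_one, mul_one]; exact hVn x
  · intro x
    have e : G' μ x - G' μ 0 - α / 2 * ‖x‖^2 = V x - V 0 := by
      rw [hV, hV]; simp; ring
    rw [e]; exact hVlip x

section
variable {α L : ℝ}
lemma Pot.meas {U : Ed d → ℝ} (h : Pot α L U) : Measurable U := h.smooth.continuous.measurable

lemma Pot.cont_pd {U : Ed d → ℝ} (h : Pot α L U) (i : Fin d) : Continuous (pd i U) := by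
  exact (h.smooth.continuous_fderiv (by simp)).clm_apply continuous_const

lemma Pot.L0 {U : Ed d → ℝ} (h : Pot α L U) (i : Fin d) : 0 ≤ L := (abs_nonneg _).trans (h.grad i 0)

lemma Pot.hasFD {U : Ed d → ℝ} (h : Pot α L U) (x : Ed d) : DifferentiableAt ℝ U x :=
  (h.smooth.differentiable (by simp)) x

lemma Pot.le {U : Ed d → ℝ} (h : Pot α L U) (x : Ed d) : |U x| ≤ (|α| + |L|) * (1 + ‖x‖^2) := by
  have h1 := h.bd x
  have e : U x = (U x - α/2 * ‖x‖^2) + α/2*‖x‖^2 := by ring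
  rw [e]
  refine (abs_add_le _ _).trans ?_
  have h2 : |α / 2 * ‖x‖^2| = |α| * ‖x‖^2/2 := by
    rw [abs_mul, abs_div, abs_of_nonneg (sq_nonneg ‖x‖)]; simp; ring
  rw [h2]
  have h3 : L * ‖x‖ ≤ |L| * ‖x‖ := by gcongr; exact le_abs_self L
  nlinarith [mul_nonneg (abs_nonneg L) (sq_nonneg (‖x‖ - 1)), mul_nonneg (abs_nonneg L) (sq_nonneg ‖x‖), mul_nonneg (abs_nonneg α) (sq_nonneg ‖x‖), abs_nonneg L, abs_nonneg α]

lemma Pot.pd_le {U : Ed d → ℝ} (h : Pot α L U) (i : Fin d) (x : Ed d) : |pd i U x| ≤ (|α| + |L|) * (1 + ‖x‖^2) := by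
  have h1 := h.grad i x
  have e : pd i U x = (pd i U x - α * x i) + α*x i := by ring
  rw [e]
  refine (abs_add_le _ _).trans ?_
  rw [abs_mul]
  have h2 : |x i| ≤ ‖x‖ := PiLp.norm_apply_le x i
  have h3 : |α| * |x i| ≤ |α| * ‖x‖ := by gcongr
  have := le_abs_self L
  nlinarith [mul_nonneg (abs_nonneg α) (sq_nonneg (‖x‖ - 1)), mul_nonneg (abs_nonneg α) (sq_nonneg ‖x‖), mul_nonneg (abs_nonneg L) (sq_nonneg ‖x‖), abs_nonneg L, abs_nonneg α]

lemma Pot.PB (α L : ℝ) : PB (fun (U : {U : Ed d → ℝ // Pot α L U}) x => U.1 x) :=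
  ⟨|α| + |L|, 1, by positivity, fun U x => by simpa using U.2.le x⟩

lemma Pot.PBpd (α L : ℝ) (i : Fin d) : WGF.PB (fun (U : {U : Ed d → ℝ // Pot α L U}) x => pd i U.1 x) :=
  ⟨|α| + |L|, 1, by positivity, fun U x => by simpa using U.2.pd_le i x⟩
end

def KL (k ρ : Ed d → ℝ) : ℝ := Ent k - Ent ρ - ∫ x, log (ρ x) * (k x - ρ x)

/-- integrand of KL -/
def kld (k ρ : ℝ) : ℝ := k * log k - ρ * log ρ - (1 + log ρ) * (k - ρ)

lemma kld_ge {k ρ : ℝ} (hρ : 0 < ρ) (hk : 0 ≤ k) : (√k - √ρ)^2 ≤ kld k ρ := by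
  have hs : 0 < √ρ := sqrt_pos.2 hρ
  have e1 : √ρ ^ 2 = ρ := sq_sqrt hρ.le
  have e2 : √k ^ 2 = k := sq_sqrt hk
  rcases hk.eq_or_lt with rfl | hk0
  · rw [kld]; simp; nlinarith
  · have hu : 0 < √k := sqrt_pos.2 hk0
    have h1 := one_sub_inv_le_log_of_pos (div_pos hu hs)
    rw [inv_div, log_div hu.ne' hs.ne', log_sqrt hk, log_sqrt hρ.le] at h1
    have h2 := mul_le_mul_of_nonneg_left h1 hk0.le
    have h3 : k * (1 - √ρ / √k) = k - √k * √ρ := by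
      have : k * (√ρ / √k) = √k * √ρ := by
        rw [mul_div_assoc', div_eq_iff hu.ne']
        nlinarith
      rw [mul_sub, this, mul_one]
    rw [h3] at h2
    rw [kld]
    nlinarith

lemma kld_nonneg {k ρ : ℝ} (hρ : 0 < ρ) (hk : 0 ≤ k) : 0 ≤ kld k ρ := (sq_nonneg _).trans (kld_ge hρ hk)

lemma kld_le {k ρ : ℝ} (hρ : 0 < ρ) (hk : 0 < k) : kld k ρ ≤ (k - ρ)^2 / ρ := by
  have h1 := log_le_sub_one_of_pos (div_pos hk hρ)
  rw [log_div hk.ne' hρ.ne'] at h1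
  have h2 := mul_le_mul_of_nonneg_left h1 hk.le
  rw [kld]
  have : (k-ρ)^2/ρ = k * (k/ρ - 1) - k + ρ := by field_simp; ring
  rw [this]; nlinarith

lemma young {h k ρ δ : ℝ} (hρ : 0 < ρ) (hk : 0 ≤ k) (hδ : 0 < δ) :
    h * (ρ - k) - δ * kld k ρ ≤ h^2 * max k ρ / δ := by
  have e1 : √ρ ^ 2 = ρ := sq_sqrt hρ.le
  have e2 : √k ^ 2 = k := sq_sqrt hk
  have h1 := mul_le_mul_of_nonneg_left (kld_ge hρ hk) hδ.le
  have m1 := le_max_left k ρ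
  have m2 := le_max_right k ρ
  have h3 : (√ρ + √k)^2 ≤ 4 * max k ρ := by nlinarith [sq_nonneg (√ρ - √k)]
  rw [le_div_iff₀ hδ]
  have h5 : h * (ρ - k) = h * (√ρ - √k) * (√ρ + √k) := by
    conv_lhs => rw [← e1, ← e2]
    ring
  have h6 : (h * (ρ - k) - δ * (√k - √ρ)^2) * δ ≤ h^2 * ((√ρ + √k)^2 / 4) := by
    rw [h5]; nlinarith [sq_nonneg (δ * (√ρ - √k) - h * (√ρ+√k)/2)]
  have h7 : h^2 * ((√ρ + √k)^2 / 4) ≤ h^2 * max k ρ := by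
    apply mul_le_mul_of_nonneg_left _ (sq_nonneg h); linarith
  nlinarith

section
variable {c₀ a₁ C₀ a₂ : ℝ} {ρ k : Ed d → ℝ}

lemma kl_integrable (hρ : Nice c₀ a₁ C₀ a₂ ρ) (hk : Dens k) : Integrable (fun x => kld (k x) (ρ x)) := by
  have D := hρ.dens
  have m1 := hρ.meas; have m2 := hk.meas
  have i1 := D.integrable_mul (g := fun x => log (ρ x)) (by fun_prop) hρ.log_le
  have i2 := hk.integrable_mul (g := fun x => log (ρ x)) (by fun_prop) hρ.log_le
  refine ((hk.ent.sub D.ent).sub ((hk.integ.sub D.integ).add (i2.sub i1))).congr (ae_of_all _ fun x => ?_)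
  simp only [Pi.add_apply, Pi.sub_apply, kld]; ring

lemma kl_eq (hρ : Nice c₀ a₁ C₀ a₂ ρ) (hk : Dens k) : KL k ρ = ∫ x, kld (k x) (ρ x) := by
  have D := hρ.dens
  have m1 := hρ.meas; have m2 := hk.meas
  have i1 := D.integrable_mul (g := fun x => log (ρ x)) (by fun_prop) hρ.log_le
  have i2 := hk.integrable_mul (g := fun x => log (ρ x)) (by fun_prop) hρ.log_le
  have A : Integrable (fun x => log (ρ x) * (k x - ρ x)) :=
    (i2.sub i1).congr (ae_of_all _ fun x => by simp only [Pi.sub_apply]; ring)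
  have B : Integrable (fun x => k x - ρ x) := hk.integ.sub D.integ
  have B0 : ∫ x, (k x - ρ x) = 0 := by rw [integral_sub hk.integ D.integ, hk.int1, D.int1]; simp
  have E1 : Integrable (fun x => k x * log (k x) - ρ x * log (ρ x)) := hk.ent.sub D.ent
  have E2 : Integrable (fun x => k x * log (k x) - ρ x * log (ρ x) - log (ρ x) * (k x - ρ x)) := E1.sub A
  rw [KL, Ent, Ent, ← integral_sub hk.ent D.ent, ← integral_sub E1 A, ← sub_zero (∫ x, _), ← B0, ← integral_sub E2 B]
  congr 1; ext x; rw [kld]; ring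

lemma kl_nonneg (hρ : Nice c₀ a₁ C₀ a₂ ρ) (hk : Dens k) : 0 ≤ KL k ρ := by
  rw [kl_eq hρ hk]; exact integral_nonneg fun x => kld_nonneg (hρ.pos x) (hk.nonneg x)

variable {G : Measure (Ed d) → ℝ} {G' : Measure (Ed d) → Ed d → ℝ} {α L τ : ℝ}

lemma split_int (hρ : Nice c₀ a₁ C₀ a₂ ρ) (hk : Dens k) {U : Ed d → ℝ} (hU : Pot α L U) (t : ℝ) :
    Integrable (fun x => U x * (k x - ρ x)) ∧ Integrable (fun x => log (ρ x) * (k x - ρ x)) ∧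
    ∫ x, (U x + t * log (ρ x)) * (k x - ρ x) = (∫ x, U x * (k x - ρ x)) + t * ∫ x, log (ρ x) * (k x - ρ x) := by
  have D := hρ.dens
  have m1 := hρ.meas; have m2 := hk.meas
  have i1 := D.integrable_mul (g := fun x => log (ρ x)) (by fun_prop) hρ.log_le
  have i2 := hk.integrable_mul (g := fun x => log (ρ x)) (by fun_prop) hρ.log_le
  have j1 := D.integrable_mul hU.meas hU.le
  have j2 := hk.integrable_mul hU.meas hU.le
  have A : Integrable (fun x => log (ρ x) * (k x - ρ x)) :=
    (i2.sub i1).congr (ae_of_all _ fun x => by simp only [Pi.sub_apply]; ring)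
  have B : Integrable (fun x => U x * (k x - ρ x)) :=
    (j2.sub j1).congr (ae_of_all _ fun x => by simp only [Pi.sub_apply]; ring)
  refine ⟨B, A, ?_⟩
  rw [← integral_const_mul, ← integral_add B (A.const_mul _)]
  congr 1; ext x; ring

lemma G_ineq (hS : Setup G G' α L) (hτ : 0 ≤ τ) (hc : ConvexFun (obj G τ)) (hρ : Nice c₀ a₁ C₀ a₂ ρ) (hk : Dens k) :
    G (mu ρ) + (∫ x, G' (mu ρ) x * (k x - ρ x)) - τ * KL k ρ ≤ G (mu k) := by
  obtain ⟨hV, hP⟩ := hS _ hρ.dens.isP2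
  have := grad_ineq hτ hc hρ hk hV hP.meas hP.le
  rw [(split_int hρ hk hP τ).2.2] at this
  simp only [Fr] at this
  rw [KL]; linarith

lemma strong_ineq (hS : Setup G G' α L) (hτ : 0 < τ) (hc : ConvexFun (obj G τ)) (hρ : Nice c₀ a₁ C₀ a₂ ρ) (hk : Dens k) :
    Fr G τ ρ + (∫ x, (G' (mu ρ) x + τ * log (ρ x)) * (k x - ρ x)) + (τ - tauC G) * KL k ρ ≤ Fr G τ k := by
  obtain ⟨hV, hP⟩ := hS _ hρ.dens.isP2
  have key : ∀ τ' ∈ {τ' : ℝ | 0 ≤ τ' ∧ ConvexFun (obj G τ')},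
      (τ - τ') * KL k ρ ≤ Fr G τ k - (Fr G τ ρ + (∫ x, (G' (mu ρ) x + τ * log (ρ x)) * (k x - ρ x))) := by
    rintro τ' ⟨h0, h1⟩
    have := grad_ineq h0 h1 hρ hk hV hP.meas hP.le
    rw [(split_int hρ hk hP τ').2.2] at this
    rw [(split_int hρ hk hP τ).2.2]
    simp only [Fr] at this ⊢
    rw [KL]; linarith
  set X := Fr G τ k - (Fr G τ ρ + (∫ x, (G' (mu ρ) x + τ * log (ρ x)) * (k x - ρ x)))
  have hne : {τ' : ℝ | 0 ≤ τ' ∧ ConvexFun (obj G τ')}.Nonempty := ⟨τ, hτ.le, hc⟩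
  have K0 := kl_nonneg hρ hk
  have : (τ - tauC G) * KL k ρ ≤ X := by
    rcases K0.eq_or_lt with h | h
    · have := key τ ⟨hτ.le, hc⟩
      rw [← h] at this ⊢; simpa using this
    · have : τ - X / KL k ρ ≤ tauC G := by
        refine le_csInf hne fun τ' h' => ?_
        have := key τ' h'
        rw [← le_div_iff₀ h] at this
        linarith
      rw [← le_div_iff₀ h]; linarith
  simp only [X] at this
  linarith

lemma weak_ineq (hS : Setup G G' α L) (hτ : 0 < τ) (hc : ConvexFun (obj G τ)) (hρ : Nice c₀ a₁ C₀ a₂ ρ) (hk : Dens k) :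
    Fr G τ ρ + (∫ x, (G' (mu ρ) x + τ * log (ρ x)) * (k x - ρ x)) ≤ Fr G τ k := by
  obtain ⟨hV, hP⟩ := hS _ hρ.dens.isP2
  exact grad_ineq hτ.le hc hρ hk hV hP.meas hP.le

end

end

section

open scoped ContDiff
variable {d : ℕ}

structure Ker (χ : Ed d → ℝ) : Prop where
  smooth : ContDiff ℝ ∞ χ
  supp : ∀ z, 1 < ‖z‖ → χ z = 0

lemma Ker.compact {χ : Ed d → ℝ} (h : Ker χ) : HasCompactSupport χ := by
  refine HasCompactSupport.intro (isCompact_closedBall (0 : Ed d) 1) fun x hx => h.supp x ?_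
  simpa using hx

lemma Ker.cont {χ : Ed d → ℝ} (h : Ker χ) : Continuous χ := h.smooth.continuous

lemma Ker.integ {χ : Ed d → ℝ} (h : Ker χ) : Integrable χ := h.cont.integrable_of_hasCompactSupport h.compact

lemma contDiff_pd {f : Ed d → ℝ} (h : ContDiff ℝ ∞ f) (i : Fin d) : ContDiff ℝ ∞ (pd i f) :=
  (h.fderiv_right (m := ∞) (by simp)).clm_apply contDiff_const

lemma Ker.pd {χ : Ed d → ℝ} (h : Ker χ) (i : Fin d) : Ker (pd i χ) := by
  refine ⟨contDiff_pd h.smooth i, fun z hz => ?_⟩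
  have : χ =ᶠ[𝓝 z] fun _ => 0 := by
    filter_upwards [(isOpen_lt continuous_const continuous_norm).mem_nhds hz] with y hy
    exact h.supp y hy
  rw [WGF.pd, this.fderiv_eq]; simp

lemma Ker.mul {χ ψ : Ed d → ℝ} (h : Ker χ) (h' : Ker ψ) : Ker (fun x => χ x * ψ x) :=
  ⟨h.smooth.mul h'.smooth, fun z hz => by simp [h.supp z hz]⟩

lemma Ker.const_mul {χ : Ed d → ℝ} (h : Ker χ) (c : ℝ) : Ker (fun x => c * χ x) :=
  ⟨contDiff_const.mul h.smooth, fun z hz => by simp [h.supp z hz]⟩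

lemma Ker.bdd {χ : Ed d → ℝ} (h : Ker χ) : ∃ C, 0 ≤ C ∧ ∀ x, |χ x| ≤ C := by
  obtain ⟨C, hC⟩ := h.cont.bounded_above_of_compact_support h.compact
  exact ⟨C, (norm_nonneg _).trans (hC 0), hC⟩

def mol (η g : Ed d → ℝ) (x : Ed d) : ℝ := ∫ y, η (x - y) * g y

open scoped Convolution in
lemma mol_eq (η g : Ed d → ℝ) : mol η g = (η ⋆[ContinuousLinearMap.lsmul ℝ ℝ, volume] g) := by
  ext x; rw [convolution_lsmul_swap]; rfl

lemma mol_contDiff {χ g : Ed d → ℝ} (h : Ker χ) (hg : LocallyIntegrable g) : ContDiff ℝ ∞ (mol χ g) := by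
  rw [mol_eq]; exact h.compact.contDiff_convolution_left _ h.smooth hg

lemma shift_integ {χ g : Ed d → ℝ} (h : Ker χ) (hg : LocallyIntegrable g) (x : Ed d) :
    Integrable (fun y => χ (x - y) * g y) := by
  have hc : Continuous fun y => χ (x - y) := h.cont.comp (by fun_prop)
  have hs : HasCompactSupport fun y => χ (x - y) := by
    refine HasCompactSupport.intro (isCompact_closedBall x 1) fun y hy => h.supp _ ?_
    rw [mem_closedBall_iff_norm'] at hy; simpa using hy
  exact hg.integrable_smul_left_of_hasCompactSupport hc hs

lemma mol_add {χ f g : Ed d → ℝ} (h : Ker χ) (hf : LocallyIntegrable f) (hg : LocallyIntegrable g) (x : Ed d) :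
    mol χ (fun y => f y + g y) x = mol χ f x + mol χ g x := by
  rw [mol, mol, mol, ← integral_add (shift_integ h hf x) (shift_integ h hg x)]
  congr 1; ext y; ring

lemma mol_sub {χ f g : Ed d → ℝ} (h : Ker χ) (hf : LocallyIntegrable f) (hg : LocallyIntegrable g) (x : Ed d) :
    mol χ (fun y => f y - g y) x = mol χ f x - mol χ g x := by
  rw [mol, mol, mol, ← integral_sub (shift_integ h hf x) (shift_integ h hg x)]
  congr 1; ext y; ring

lemma mol_const_mul (χ f : Ed d → ℝ) (c : ℝ) (x : Ed d) :
    mol χ (fun y => c * f y) x = c * mol χ f x := by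
  rw [mol, mol, ← integral_const_mul]; congr 1; ext y; ring

lemma pd_mol {χ g : Ed d → ℝ} (h : Ker χ) (hg : LocallyIntegrable g) (i : Fin d) (x : Ed d) :
    pd i (mol χ g) x = mol (pd i χ) g x := by
  have hd := h.compact.hasFDerivAt_convolution_left (ContinuousLinearMap.lsmul ℝ ℝ) (h.smooth.of_le (by simp)) hg x
  have hex := (h.compact.fderiv (𝕜 := ℝ)).convolutionExists_left
    (ContinuousLinearMap.precompL (Ed d) (ContinuousLinearMap.lsmul ℝ ℝ : ℝ →L[ℝ] ℝ →L[ℝ] ℝ)) (h.smooth.continuous_fderiv (by simp)) hg x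
  have hI := hex.integrable_swap
  rw [pd, mol_eq, hd.fderiv, convolution_eq_swap, ContinuousLinearMap.integral_apply hI]
  rfl

lemma mol_le {χ g : Ed d → ℝ} (h : Ker χ) {K a : ℝ} (hK : 0 ≤ K) (ha : 0 < a) (hg : ∀ y, |g y| ≤ K * exp (-a * ‖y‖^2)) (x : Ed d) :
    |mol χ g x| ≤ (∫ y, |χ y|) * (K * exp a * exp (-(a/2) * ‖x‖^2)) := by
  rw [mol, ← integral_mul_const]
  have e : ∫ y, |χ y| * (K * exp a * exp (-(a/2) * ‖x‖^2)) = ∫ y, |χ (x - y)| * (K * exp a * exp (-(a/2) * ‖x‖^2)) :=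
    (integral_sub_left_eq_self (fun y => |χ y| * (K * exp a * exp (-(a/2) * ‖x‖^2))) volume x).symm
  rw [e]
  refine abs_integral_le_integral_abs.trans (integral_mono_of_nonneg (ae_of_all _ fun y => abs_nonneg _) ?_ (ae_of_all _ fun y => ?_))
  · exact ((h.integ.comp_sub_left x).abs).mul_const _
  · simp only [abs_mul]
    by_cases hy : 1 < ‖x - y‖
    · rw [h.supp _ hy]; simp
    · refine mul_le_mul_of_nonneg_left ((hg y).trans ?_) (abs_nonneg _)
      rw [mul_assoc, ← exp_add]
      refine mul_le_mul_of_nonneg_left (exp_le_exp.2 ?_) hK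
      have h1 : ‖x‖ ≤ 1 + ‖y‖ := by
        have := norm_le_norm_add_norm_sub y x
        rw [norm_sub_rev] at this; linarith
      have h2 : ‖x‖^2 ≤ 2 + 2 * ‖y‖^2 := by nlinarith [norm_nonneg x, norm_nonneg y, sq_nonneg (‖y‖ - 1)]
      nlinarith

lemma mol_GB {ι κ : Type*} {g : ι → Ed d → ℝ} (hg : GB g) {χ : κ → Ed d → ℝ} (h : ∀ k, Ker (χ k)) {C : ℝ}
    (hC : ∀ k, ∫ y, |χ k y| ≤ C) : GB (fun (p : κ × ι) => mol (χ p.1) (g p.2)) := by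
  obtain ⟨K, a, hK, ha, hb⟩ := hg
  refine ⟨|C| * (K * exp a), a / 2, by positivity, by positivity, fun p x => ?_⟩
  refine (mol_le (h p.1) hK ha (hb p.2) x).trans ?_
  rw [mul_assoc |C|]
  refine mul_le_mul_of_nonneg_right ((hC _).trans (le_abs_self _)) (by positivity)

lemma mol_GB1 {ι : Type*} {g : ι → Ed d → ℝ} (hg : GB g) {χ : Ed d → ℝ} (h : Ker χ) : GB (fun i => mol χ (g i)) :=
  (mol_GB hg (χ := fun _ : Unit => χ) (fun _ => h) (fun _ => le_rfl)).comp (fun i => ((), i))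

lemma integral_shift (χ : Ed d → ℝ) (x : Ed d) : ∫ y, χ (x - y) = ∫ y, χ y :=
  integral_sub_left_eq_self χ volume x

/-- Cauchy-Schwarz -/
lemma cs_integral {X : Type*} [MeasurableSpace X] {μ : Measure X} {u v : X → ℝ} (hu : Integrable (fun x => u x ^ 2) μ)
    (hv : Integrable (fun x => v x ^ 2) μ) (huv : Integrable (fun x => u x * v x) μ) :
    (∫ x, u x * v x ∂μ) ^ 2 ≤ (∫ x, u x ^ 2 ∂μ) * ∫ x, v x ^ 2 ∂μ := by
  have h : ∀ t : ℝ, 0 ≤ (∫ x, v x ^ 2 ∂μ) * (t * t) + (2 * ∫ x, u x * v x ∂μ) * t + ∫ x, u x ^ 2 ∂μ := by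
    intro t
    have e : (∫ x, v x ^ 2 ∂μ) * (t * t) + (2 * ∫ x, u x * v x ∂μ) * t + ∫ x, u x ^ 2 ∂μ = ∫ x, (u x + t * v x)^2 ∂μ := by
      have A : Integrable (fun x => (t*t) * v x ^ 2) μ := hv.const_mul _
      have B : Integrable (fun x => (2 * t) * (u x * v x)) μ := huv.const_mul _
      have AB : Integrable (fun x => (t*t) * v x ^ 2 + (2 * t) * (u x * v x)) μ := A.add B
      have : (fun x => (u x + t * v x)^2) = fun x => (t*t) * v x ^ 2 + (2 * t) * (u x * v x) + u x ^ 2 := by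
        ext x; ring
      rw [this, integral_add AB hu, integral_add A B, integral_const_mul, integral_const_mul]; ring
    rw [e]; exact integral_nonneg fun x => sq_nonneg _
  have := discrim_le_zero h
  rw [discrim] at this
  nlinarith

/-! The mollifier -/
def bump (d n : ℕ) : ContDiffBump (0 : Ed d) where
  rIn := 1 / (2 * (n + 1))
  rOut := 1 / (n + 1)
  rIn_pos := by positivity
  rIn_lt_rOut := by
    apply one_div_lt_one_div_of_lt <;> [positivity; skip]
    have : (0:ℝ) < n + 1 := by positivity
    linarith

def Zn (d n : ℕ) : ℝ := ∫ x : Ed d, (bump d n x) ^ 2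

def pn (d n : ℕ) (x : Ed d) : ℝ := (√(Zn d n))⁻¹ * bump d n x

def eta (d n : ℕ) (x : Ed d) : ℝ := pn d n x * pn d n x

lemma bump_sq_integ (d n : ℕ) : Integrable (fun x : Ed d => (bump d n x)^2) := by
  have hc : Continuous (fun x : Ed d => (bump d n x)^2) := (bump d n).continuous.pow 2
  refine hc.integrable_of_hasCompactSupport ?_
  exact (bump d n).hasCompactSupport.comp_left (g := fun t : ℝ => t ^ 2) (by simp)

lemma Zn_ge (d n : ℕ) : volume.real (Metric.closedBall (0 : Ed d) (1 / (2 * (n+1)))) ≤ Zn d n := by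
  rw [Zn, ← integral_indicator_one (Metric.isClosed_closedBall.measurableSet)]
  refine integral_mono_of_nonneg (ae_of_all _ fun x => indicator_nonneg (by simp) _) (bump_sq_integ d n) (ae_of_all _ fun x => ?_)
  simp only
  by_cases hx : x ∈ Metric.closedBall (0 : Ed d) (1 / (2 * (n+1)))
  · rw [indicator_of_mem hx, (bump d n).one_of_mem_closedBall hx]; simp
  · rw [indicator_of_notMem hx]; positivity

lemma vol_ball_pos (d n : ℕ) : 0 < volume.real (Metric.closedBall (0 : Ed d) (1 / (2 * (n+1)))) :=
  ENNReal.toReal_pos (Metric.measure_closedBall_pos _ _ (by positivity)).ne' (measure_closedBall_lt_top).ne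

lemma Zn_pos (d n : ℕ) : 0 < Zn d n := (vol_ball_pos d n).trans_le (Zn_ge d n)

lemma bump_zero (d n : ℕ) {z : Ed d} (hz : 1 / ((n:ℝ) + 1) ≤ ‖z‖) : bump d n z = 0 := by
  apply (bump d n).zero_of_le_dist
  simpa [bump] using hz

lemma inv_le_one (n : ℕ) : 1 / ((n:ℝ) + 1) ≤ 1 := by
  rw [div_le_one (by positivity)]; linarith [n.cast_nonneg (α := ℝ)]

lemma pn_ker (d n : ℕ) : Ker (pn d n) := by
  refine ⟨contDiff_const.mul (bump d n).contDiff, fun z hz => ?_⟩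
  rw [pn, bump_zero d n ((inv_le_one n).trans hz.le)]; simp

lemma eta_ker (d n : ℕ) : Ker (eta d n) := (pn_ker d n).mul (pn_ker d n)

lemma eta_eq (d n : ℕ) (x : Ed d) : eta d n x = (Zn d n)⁻¹ * (bump d n x)^2 := by
  have : (√(Zn d n))⁻¹ * (√(Zn d n))⁻¹ = (Zn d n)⁻¹ := by
    rw [← mul_inv, mul_self_sqrt (Zn_pos d n).le]
  rw [eta, pn, ← this]; ring

lemma eta_nonneg (d n : ℕ) (x : Ed d) : 0 ≤ eta d n x := mul_self_nonneg _

lemma eta_int (d n : ℕ) : ∫ x, eta d n x = 1 := by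
  simp_rw [eta_eq, integral_const_mul]
  exact inv_mul_cancel₀ (Zn_pos d n).ne'

lemma eta_int_abs (d n : ℕ) : ∫ x, |eta d n x| = 1 := by
  simp_rw [abs_of_nonneg (eta_nonneg d n _)]; exact eta_int d n

lemma eta_even (d n : ℕ) (x : Ed d) : eta d n (-x) = eta d n x := by
  rw [eta_eq, eta_eq, (bump d n).neg]

lemma eta_zero (d n : ℕ) {z : Ed d} (hz : 1 / ((n:ℝ) + 1) ≤ ‖z‖) : eta d n z = 0 := by
  rw [eta_eq, bump_zero d n hz]; simp

lemma pd_eta (d n : ℕ) (i : Fin d) (x : Ed d) : pd i (eta d n) x = pn d n x * (2 * pd i (pn d n) x) := by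
  have h : DifferentiableAt ℝ (pn d n) x := ((pn_ker d n).smooth.differentiable (by simp)) x
  have : HasFDerivAt (eta d n) _ x := h.hasFDerivAt.mul h.hasFDerivAt
  rw [pd, this.fderiv, pd]; simp; ring

lemma tendsto_eps : Tendsto (fun n : ℕ => 1 / ((n:ℝ) + 1)) atTop (𝓝 0) := tendsto_one_div_add_atTop_nhds_zero_nat

lemma mol_tendsto_ae {g : Ed d → ℝ} (hg : LocallyIntegrable g) :
    ∀ᵐ x, Tendsto (fun n => mol (eta d n) g x) atTop (𝓝 (g x)) := by
  filter_upwards [(Besicovitch.vitaliFamily (volume : Measure (Ed d))).ae_tendsto_average_norm_sub hg] with x₀ h₀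
  have hφ' : Tendsto (fun n : ℕ => 1 / ((n:ℝ) + 1)) atTop (𝓝[>] 0) :=
    tendsto_nhdsWithin_iff.2 ⟨tendsto_eps, Eventually.of_forall (fun i ↦ by simp only [mem_Ioi]; positivity)⟩
  have := (h₀.comp (Besicovitch.tendsto_filterAt volume x₀)).comp hφ'
  refine tendsto_integral_smul_of_tendsto_average_norm_sub (2 ^ (Module.finrank ℝ (Ed d))) this ?_ ?_ ?_ ?_
  · filter_upwards with i using hg.integrableOn_isCompact (isCompact_closedBall _ _)
  · apply tendsto_const_nhds.congr (fun i ↦ ?_)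
    rw [integral_shift, eta_int]
  · filter_upwards with i x hx
    by_contra hc
    apply hx
    apply eta_zero
    rw [mem_closedBall_iff_norm', not_le] at hc
    exact hc.le
  · filter_upwards with n x
    rw [abs_of_nonneg (eta_nonneg _ _ _), Measure.addHaar_real_closedBall_center, eta_eq]
    have e1 : Metric.closedBall (0 : Ed d) (1 / (n+1)) = Metric.closedBall (0 : Ed d) (2 * (1 / (2 * (n+1)))) := by
      congr 1; field_simp
    have hk2 : volume.real (Metric.closedBall (0 : Ed d) (2 * (1 / (2 * ((n:ℝ)+1))))) = 2 ^ Module.finrank ℝ (Ed d) * volume.real (Metric.closedBall (0 : Ed d) (1 / (2 * ((n:ℝ)+1)))) := by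
      rw [Measure.addHaar_real_closedBall' volume (0 : Ed d) (r := 2 * (1 / (2 * ((n:ℝ)+1)))) (by positivity),
        Measure.addHaar_real_closedBall' volume (0 : Ed d) (r := 1 / (2 * ((n:ℝ)+1))) (by positivity), mul_pow, mul_assoc]
    rw [e1, hk2]
    rw [← div_div, div_self (by positivity), inv_mul_eq_div]
    have hb : bump d n (x₀ - x) ^ 2 ≤ 1 := by
      have h1 := (bump d n).nonneg (x := x₀ - x); have h2 := (bump d n).le_one (x := x₀ - x)
      nlinarith
    exact div_le_div₀ zero_le_one hb (vol_ball_pos d n) (Zn_ge d n)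

lemma mol_tendsto_cont {g : Ed d → ℝ} (hg : Continuous g) (x : Ed d) :
    Tendsto (fun n => mol (eta d n) g x) atTop (𝓝 (g x)) := by
  rw [Metric.tendsto_atTop]
  intro ε hε
  obtain ⟨r, hr, hb⟩ := Metric.continuousAt_iff.1 (hg.continuousAt (x := x)) (ε/2) (by positivity)
  obtain ⟨N, hN⟩ := (Metric.tendsto_atTop.1 tendsto_eps r hr)
  refine ⟨N, fun n hn => ?_⟩
  have hn' := hN n hn
  rw [dist_zero_right, norm_eq_abs, abs_of_nonneg (by positivity)] at hn'
  have hl := hg.locallyIntegrable (μ := (volume : Measure (Ed d)))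
  have e : mol (eta d n) g x - g x = ∫ y, eta d n (x - y) * (g y - g x) := by
    have : ∫ y, eta d n (x - y) * g x = g x := by
      rw [integral_mul_const, integral_shift, eta_int, one_mul]
    conv_lhs => rw [← this]
    rw [mol, ← integral_sub (shift_integ (eta_ker d n) hl x) (((eta_ker d n).integ.comp_sub_left x).mul_const _)]
    congr 1; ext y; ring
  rw [dist_eq_norm, e]
  refine lt_of_le_of_lt (norm_integral_le_of_norm_le (g := fun y => eta d n (x - y) * (ε/2)) (((eta_ker d n).integ.comp_sub_left x).mul_const _) (ae_of_all _ fun y => ?_)) ?_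
  · rw [norm_mul, norm_eq_abs, abs_of_nonneg (eta_nonneg _ _ _)]
    by_cases hy : 1 / ((n:ℝ)+1) ≤ ‖x - y‖
    · rw [eta_zero d n hy]; simp
    · refine mul_le_mul_of_nonneg_left ?_ (eta_nonneg _ _ _)
      have := hb (x := y) (by rw [dist_eq_norm, norm_sub_rev]; linarith)
      rw [dist_eq_norm] at this; exact this.le
  · rw [integral_mul_const, integral_shift, eta_int]; linarith

end

section

open scoped ContDiff Convolution
variable {d : ℕ} {c₀ a₁ C₀ a₂ : ℝ}

lemma mol_integrable {χ g : Ed d → ℝ} (h : Ker χ) (hg : Integrable g) : Integrable (mol χ g) := by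
  rw [mol_eq]; exact h.integ.integrable_convolution _ hg

lemma mol_integral {χ g : Ed d → ℝ} (h : Ker χ) (hg : Integrable g) : ∫ x, mol χ g x = (∫ x, χ x) * ∫ x, g x := by
  rw [mol_eq]; rw [integral_convolution _ h.integ hg]; rfl

lemma mol_eta_integral {g : Ed d → ℝ} (n : ℕ) (hg : Integrable g) : ∫ x, mol (eta d n) g x = ∫ x, g x := by
  rw [mol_integral (eta_ker d n) hg, eta_int, one_mul]

lemma mol_abs_le (n : ℕ) (g : Ed d → ℝ) (x : Ed d) : |mol (eta d n) g x| ≤ mol (eta d n) (fun y => |g y|) x := by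
  refine abs_integral_le_integral_abs.trans (le_of_eq ?_)
  rw [mol]; congr 1; ext y; rw [abs_mul, abs_of_nonneg (eta_nonneg _ _ _)]

lemma mol_L1 {g : Ed d → ℝ} (n : ℕ) (hg : Integrable g) : ∫ x, |mol (eta d n) g x| ≤ ∫ x, |g x| := by
  rw [← mol_eta_integral n hg.abs]
  exact integral_mono (mol_integrable (eta_ker d n) hg).abs (mol_integrable (eta_ker d n) hg.abs) (mol_abs_le n g)

lemma mol_lb {η : Ed d → ℝ} (hη : Ker η) (h0 : ∀ z, 0 ≤ η z) (he : ∀ z, η (-z) = η z) (h1 : ∫ z, η z = 1)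
    {a : ℝ} (ha : 0 < a) (x : Ed d) : exp (-a) * exp (-a * ‖x‖^2) ≤ ∫ z, η z * exp (-a * ‖x - z‖^2) := by
  have hI1 : Integrable (fun z => η z * (exp (-a) * exp (-a * ‖x‖^2))) := hη.integ.mul_const _
  have hc : Continuous (fun z : Ed d => inner ℝ x z) := by fun_prop
  have hI2 : Integrable (fun z => η z * inner ℝ x z) := 
    (hη.cont.mul hc).integrable_of_hasCompactSupport hη.compact.mul_right
  have hz : ∫ z, η z * inner ℝ x z = 0 := by
    have := integral_neg_eq_self (fun z => η z * inner ℝ x z) (volume : Measure (Ed d))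
    simp only [he, inner_neg_right, mul_neg, integral_neg] at this
    linarith
  have e : exp (-a) * exp (-a * ‖x‖^2) = ∫ z, (η z * (exp (-a) * exp (-a * ‖x‖^2)) + (2 * a * (exp (-a) * exp (-a * ‖x‖^2))) * (η z * inner ℝ x z)) := by
    rw [integral_add hI1 (hI2.const_mul _), integral_const_mul, hz, integral_mul_const, h1]; ring
  rw [e]
  refine integral_mono (hI1.add (hI2.const_mul _)) ?_ fun z => ?_
  · have hc2 : Continuous (fun z : Ed d => exp (-a * ‖x - z‖^2)) := by fun_prop
    exact (hη.cont.mul hc2).integrable_of_hasCompactSupport hη.compact.mul_right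
  · show η z * (exp (-a) * exp (-a * ‖x‖^2)) + (2 * a * (exp (-a) * exp (-a * ‖x‖^2))) * (η z * inner ℝ x z) ≤ η z * exp (-a * ‖x - z‖^2)
    have : η z * (exp (-a) * exp (-a * ‖x‖^2)) + (2 * a * (exp (-a) * exp (-a * ‖x‖^2))) * (η z * inner ℝ x z) = η z * ((exp (-a) * exp (-a * ‖x‖^2)) * (2 * a * inner ℝ x z + 1)) := by ring
    rw [this]
    by_cases hz1 : 1 < ‖z‖
    · rw [hη.supp z hz1]; simp
    · refine mul_le_mul_of_nonneg_left ?_ (h0 z)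
      refine (mul_le_mul_of_nonneg_left (add_one_le_exp _) (by positivity)).trans ?_
      rw [← exp_add, ← exp_add, exp_le_exp, norm_sub_sq_real]
      have : ‖z‖^2 ≤ 1 := by nlinarith [norm_nonneg z]
      nlinarith

lemma nice_mol {ρ : Ed d → ℝ} (h : Nice c₀ a₁ C₀ a₂ ρ) (n : ℕ) :
    Nice (c₀ * exp (-a₁)) a₁ (C₀ * exp a₂) (a₂/2) (mol (eta d n) ρ) := by
  have hl := h.dens.integ.locallyIntegrable
  have := h.c₀pos; have := h.a₁pos; have := h.C₀pos; have := h.a₂pos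
  refine ⟨by positivity, h.a₁pos, by positivity, by positivity, 
    (mol_contDiff (eta_ker d n) hl).continuous.measurable, ?_, fun x => ?_, fun x => ?_⟩
  · rw [mol_eta_integral n h.dens.integ, h.int1]
  · have h1 := mol_lb (eta_ker d n) (eta_nonneg d n) (eta_even d n) (eta_int d n) h.a₁pos x
    have e : ∫ z, eta d n z * exp (-a₁ * ‖x - z‖^2) = ∫ y, eta d n (x - y) * exp (-a₁ * ‖y‖^2) := by
      rw [← integral_sub_left_eq_self (fun z => eta d n z * exp (-a₁ * ‖x - z‖^2)) volume x]
      simp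
    rw [e] at h1
    calc c₀ * exp (-a₁) * exp (-a₁ * ‖x‖^2) = c₀ * (exp (-a₁) * exp (-a₁ * ‖x‖^2)) := by ring
      _ ≤ c₀ * ∫ y, eta d n (x - y) * exp (-a₁ * ‖y‖^2) := by gcongr
      _ = ∫ y, eta d n (x - y) * (c₀ * exp (-a₁ * ‖y‖^2)) := by 
        rw [← integral_const_mul]; congr 1; ext y; ring
      _ ≤ _ := by
        refine integral_mono (shift_integ (eta_ker d n) (((integrable_gauss h.a₁pos).const_mul _).locallyIntegrable) x) 
          (shift_integ (eta_ker d n) hl x) fun y => ?_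
        exact mul_le_mul_of_nonneg_left (h.lb y) (eta_nonneg _ _ _)
  · have := mol_le (eta_ker d n) h.C₀pos.le h.a₂pos (g := ρ) (fun y => by rw [abs_of_pos (h.pos y)]; exact h.ub y) x
    rw [eta_int_abs, one_mul] at this
    exact (le_abs_self _).trans this

lemma cs_dens {ρ : Ed d → ℝ} (h : Dens ρ) {u v : Ed d → ℝ} (hu : Continuous u) (hv : Continuous v)
    (hcu : HasCompactSupport u) (hcv : HasCompactSupport v) :
    (∫ y, (u y * v y) * ρ y)^2 ≤ (∫ y, u y ^ 2 * ρ y) * ∫ y, v y ^ 2 * ρ y := by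
  have := h.isProb
  have A : HasCompactSupport (fun y => u y ^ 2) := by simp only [sq]; exact hcu.mul_right
  have B : HasCompactSupport (fun y => v y ^ 2) := by simp only [sq]; exact hcv.mul_right
  have C : HasCompactSupport (fun y => u y * v y) := hcu.mul_right
  have A' : Integrable (fun y => u y ^ 2) (mu ρ) := (hu.pow 2).integrable_of_hasCompactSupport A
  have B' : Integrable (fun y => v y ^ 2) (mu ρ) := (hv.pow 2).integrable_of_hasCompactSupport B
  have C' : Integrable (fun y => u y * v y) (mu ρ) := (hu.mul hv).integrable_of_hasCompactSupport C
  have := cs_integral A' B' C'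
  rw [integral_mu h.meas h.nonneg, integral_mu h.meas h.nonneg, integral_mu h.meas h.nonneg] at this
  exact this

lemma Ker.shift_cont {χ : Ed d → ℝ} (h : Ker χ) (x : Ed d) : Continuous fun y => χ (x - y) := h.cont.comp (by fun_prop)

lemma Ker.shift_compact {χ : Ed d → ℝ} (h : Ker χ) (x : Ed d) : HasCompactSupport fun y => χ (x - y) := by
  refine HasCompactSupport.intro (isCompact_closedBall x 1) fun y hy => h.supp _ ?_
  rw [mem_closedBall_iff_norm'] at hy; simpa using hy

lemma Ker.shift_smooth {χ : Ed d → ℝ} (h : Ker χ) (x : Ed d) : ContDiff ℝ ∞ fun y => χ (x - y) := h.smooth.comp (by fun_prop)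

lemma mol_cs {ρ p q : Ed d → ℝ} (h : Dens ρ) (hp : Ker p) (hq : Ker q) (x : Ed d) :
    (mol (fun z => p z * q z) ρ x)^2 ≤ mol (fun z => p z * p z) ρ x * mol (fun z => q z * q z) ρ x := by
  simpa only [mol, sq] using cs_dens h (hp.shift_cont x) (hq.shift_cont x) (hp.shift_compact x) (hq.shift_compact x)

lemma mol_cs_b {ρ b : Ed d → ℝ} (h : Dens ρ) (n : ℕ) (hb : Continuous b) (x : Ed d) :
    (mol (eta d n) (fun y => b y * ρ y) x)^2 ≤ mol (eta d n) ρ x * mol (eta d n) (fun y => b y ^ 2 * ρ y) x := by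
  have := cs_dens h ((pn_ker d n).shift_cont x) (((pn_ker d n).shift_cont x).mul hb) ((pn_ker d n).shift_compact x) ((pn_ker d n).shift_compact x).mul_right
  have e1 : mol (eta d n) (fun y => b y * ρ y) x = ∫ y, (pn d n (x - y) * (pn d n (x - y) * b y)) * ρ y := by
    rw [mol]; congr 1; ext y; rw [eta]; ring
  have e2 : mol (eta d n) ρ x = ∫ y, pn d n (x - y) ^ 2 * ρ y := by
    rw [mol]; congr 1; ext y; rw [eta]; ring
  have e3 : mol (eta d n) (fun y => b y ^ 2 * ρ y) x = ∫ y, (pn d n (x - y) * b y) ^ 2 * ρ y := by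
    rw [mol]; congr 1; ext y; rw [eta]; ring
  rw [e1, e2, e3]; exact this

end

section

variable {d : ℕ}

abbrev V2 (d : ℕ) : Measure (Ed d × Ed d) := (volume : Measure (Ed d)).prod volume

/-- Gaussian weight -/
def wg (d : ℕ) (a : ℝ) (x : Ed d) : ℝ := exp (-a * ‖x‖ ^ 2)

lemma wg_pos (a : ℝ) (x : Ed d) : 0 < wg d a x := exp_pos _

lemma wg_cont (a : ℝ) : Continuous (wg d a) := by unfold wg; fun_prop

lemma wg_integ {a : ℝ} (ha : 0 < a) : Integrable (wg d a) := integrable_gauss ha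

lemma wg_int_pos {a : ℝ} (ha : 0 < a) : 0 < ∫ x, wg d a x :=
  integral_pos_of_integrable_nonneg_nonzero (x := 0) (wg_cont a) (wg_integ ha) (fun x => (wg_pos a x).le) (wg_pos a 0).ne'

def rotL (d : ℕ) (θ : ℝ) : (Ed d × Ed d) ≃ₗ[ℝ] (Ed d × Ed d) where
  toFun p := (cos θ • p.1 + sin θ • p.2, - sin θ • p.1 + cos θ • p.2)
  map_add' p q := by ext <;> simp <;> ring
  map_smul' c p := by ext <;> simp <;> ring
  invFun p := (cos θ • p.1 - sin θ • p.2, sin θ • p.1 + cos θ • p.2)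
  left_inv p := by
    have h := sin_sq_add_cos_sq θ
    ext i <;> simp
    · linear_combination (p.1 i) * h
    · linear_combination (p.2 i) * h
  right_inv p := by
    have h := sin_sq_add_cos_sq θ
    ext i <;> simp
    · linear_combination (p.1 i) * h
    · linear_combination (p.2 i) * h

lemma rotL_apply (θ : ℝ) (p : Ed d × Ed d) : rotL d θ p = (cos θ • p.1 + sin θ • p.2, - sin θ • p.1 + cos θ • p.2) := rfl

lemma rotL_cont (θ : ℝ) : Continuous (rotL d θ) := by
  show Continuous (fun p : Ed d × Ed d => (cos θ • p.1 + sin θ • p.2, - sin θ • p.1 + cos θ • p.2))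
  fun_prop

lemma wg_rot (a θ : ℝ) (p : Ed d × Ed d) :
    wg d a (rotL d θ p).1 * wg d a (rotL d θ p).2 = wg d a p.1 * wg d a p.2 := by
  rw [rotL_apply]; simp only [wg, ← exp_add]
  congr 1
  rw [norm_add_sq_real, norm_add_sq_real]
  simp only [norm_smul, inner_smul_left, inner_smul_right, mul_pow, norm_eq_abs, sq_abs, neg_sq]
  simp
  have h := sin_sq_add_cos_sq θ
  linear_combination (-a * (‖p.1‖^2 + ‖p.2‖^2)) * h

lemma rot_mp (θ : ℝ) : MeasurePreserving (rotL d θ) (V2 d) (V2 d) := by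
  have hm : Measurable (rotL d θ) := (rotL_cont θ).measurable
  refine ⟨hm, ?_⟩
  have hdet : LinearMap.det (rotL d θ : (Ed d × Ed d) →ₗ[ℝ] (Ed d × Ed d)) ≠ 0 := (LinearEquiv.isUnit_det' _).ne_zero
  have h := Measure.map_linearMap_addHaar_eq_smul_addHaar (V2 d) hdet
  have h' : Measure.map (rotL d θ) (V2 d) = _ := h
  rw [h']
  set c := ENNReal.ofReal |(LinearMap.det (rotL d θ : (Ed d × Ed d) →ₗ[ℝ] (Ed d × Ed d)))⁻¹| with hc
  have hWc : Continuous (fun p : Ed d × Ed d => wg d 1 p.1 * wg d 1 p.2) :=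
    ((wg_cont 1).comp continuous_fst).mul ((wg_cont 1).comp continuous_snd)
  have hWm : Measurable (fun p : Ed d × Ed d => ENNReal.ofReal (wg d 1 p.1 * wg d 1 p.2)) := hWc.measurable.ennreal_ofReal
  have hWi : Integrable (fun p : Ed d × Ed d => wg d 1 p.1 * wg d 1 p.2) (V2 d) :=
    (wg_integ one_pos).mul_prod (wg_integ one_pos)
  have e1 : ∫⁻ p, ENNReal.ofReal (wg d 1 p.1 * wg d 1 p.2) ∂(Measure.map (rotL d θ) (V2 d)) 
      = ∫⁻ p : Ed d × Ed d, ENNReal.ofReal (wg d 1 p.1 * wg d 1 p.2) ∂(V2 d) := by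
    rw [lintegral_map hWm hm]; simp_rw [wg_rot]
  rw [h', lintegral_smul_measure, smul_eq_mul] at e1
  have hpos : ∫⁻ p : Ed d × Ed d, ENNReal.ofReal (wg d 1 p.1 * wg d 1 p.2) ∂(V2 d) ≠ 0 := by
    have : 0 < ∫ p : Ed d × Ed d, wg d 1 p.1 * wg d 1 p.2 ∂(V2 d) :=
      integral_pos_of_integrable_nonneg_nonzero (x := 0) hWc hWi (fun x => (mul_pos (wg_pos 1 _) (wg_pos 1 _)).le) (mul_pos (wg_pos 1 _) (wg_pos 1 _)).ne'
    rw [← ofReal_integral_eq_lintegral_ofReal hWi (ae_of_all _ fun x => (mul_pos (wg_pos 1 _) (wg_pos 1 _)).le)]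
    simpa using this
  have hfin : ∫⁻ p : Ed d × Ed d, ENNReal.ofReal (wg d 1 p.1 * wg d 1 p.2) ∂(V2 d) ≠ ⊤ := hWi.lintegral_lt_top.ne
  have : c = 1 := by
    have := (ENNReal.mul_eq_right hpos hfin).1 e1
    exact this
  rw [this, one_smul]

lemma fderiv_sq_le (f : Ed d → ℝ) (x y : Ed d) : (fderiv ℝ f x y)^2 ≤ (∑ i, pd i f x ^ 2) * ‖y‖^2 := by
  have e : fderiv ℝ f x y = ∑ i, pd i f x * y i := by
    conv_lhs => rw [← (EuclideanSpace.basisFun (Fin d) ℝ).sum_repr y]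
    rw [map_sum]
    refine Finset.sum_congr rfl fun i _ => ?_
    simp [pd, mul_comm]
  rw [e, EuclideanSpace.norm_sq_eq]
  simp only [norm_eq_abs, sq_abs]
  exact Finset.sum_mul_sq_le_sq_mul_sq _ _ _

lemma jensen_path {f : Ed d → ℝ} (hf : ContDiff ℝ 1 f) (p : Ed d × Ed d) :
    (f p.1 - f p.2)^2 ≤ (π/2) * ∫ θ in (0:ℝ)..(π/2), (fderiv ℝ f (rotL d θ p).1 (rotL d θ p).2)^2 := by
  have hfc : Continuous (fderiv ℝ f) := hf.continuous_fderiv (by simp)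
  have hc1 : Continuous (fun θ : ℝ => (rotL d θ p).1) := by simp only [rotL_apply]; fun_prop
  have hc2 : Continuous (fun θ : ℝ => (rotL d θ p).2) := by simp only [rotL_apply]; fun_prop
  have hg : Continuous (fun θ : ℝ => fderiv ℝ f (rotL d θ p).1 (rotL d θ p).2) := (hfc.comp hc1).clm_apply hc2
  have hd : ∀ θ : ℝ, HasDerivAt (fun θ => f (rotL d θ p).1) (fderiv ℝ f (rotL d θ p).1 (rotL d θ p).2) θ := by
    intro θ
    have h1 : HasDerivAt (fun θ : ℝ => (rotL d θ p).1) (rotL d θ p).2 θ := by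
      simp only [rotL_apply]
      exact ((hasDerivAt_cos θ).smul_const p.1).add ((hasDerivAt_sin θ).smul_const p.2)
    exact ((hf.differentiable (by simp)) _).hasFDerivAt.comp_hasDerivAt θ h1
  have hftc := intervalIntegral.integral_eq_sub_of_hasDerivAt (a := 0) (b := π/2) (fun θ _ => hd θ) (hg.intervalIntegrable _ _)
  have e1 : (rotL d (π/2) p).1 = p.2 := by rw [rotL_apply]; simp
  have e2 : (rotL d 0 p).1 = p.1 := by rw [rotL_apply]; simp
  rw [e1, e2] at hftc
  have hpi : (0:ℝ) ≤ π/2 := by positivity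
  have hcs := cs_integral (μ := volume.restrict (Ioc (0:ℝ) (π/2))) (u := fun _ => (1:ℝ)) (v := fun θ : ℝ => fderiv ℝ f (rotL d θ p).1 (rotL d θ p).2)
    (by simp) (by exact ((hg.pow 2).integrableOn_Icc).mono_set Ioc_subset_Icc_self) 
    (by simp only [one_mul]; exact (hg.integrableOn_Icc).mono_set Ioc_subset_Icc_self)
  simp only [one_mul, one_pow] at hcs
  rw [intervalIntegral.integral_of_le hpi] at hftc
  rw [intervalIntegral.integral_of_le hpi]
  have e3 : ∫ _ in Ioc (0:ℝ) (π/2), (1:ℝ) = π/2 := by simp [hpi]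
  rw [e3, hftc] at hcs
  nlinarith

lemma poincare_lint {f : Ed d → ℝ} (hf : ContDiff ℝ 1 f) (a : ℝ) :
    ∫⁻ p : Ed d × Ed d, ENNReal.ofReal ((f p.1 - f p.2)^2 * (wg d a p.1 * wg d a p.2)) ∂(V2 d) ≤
      ENNReal.ofReal (π^2/4) * ((∫⁻ x, ENNReal.ofReal ((∑ i, pd i f x ^ 2) * wg d a x)) * ∫⁻ y : Ed d, ENNReal.ofReal (‖y‖^2 * wg d a y)) := by
  have hfc : Continuous (fderiv ℝ f) := hf.continuous_fderiv (by simp)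
  obtain ⟨D, hD⟩ : ∃ D : Ed d × Ed d → ℝ, D = fun p => (fderiv ℝ f p.1 p.2)^2 * (wg d a p.1 * wg d a p.2) := ⟨_, rfl⟩
  have hDc : Continuous D := by
    rw [hD]; exact (((hfc.comp continuous_fst).clm_apply continuous_snd).pow 2).mul (((wg_cont a).comp continuous_fst).mul ((wg_cont a).comp continuous_snd))
  have hD0 : ∀ p, 0 ≤ D p := fun p => by rw [hD]; exact mul_nonneg (sq_nonneg _) (mul_pos (wg_pos a _) (wg_pos a _)).le
  have hj : Continuous (fun q : (Ed d × Ed d) × ℝ => D (rotL d q.2 q.1)) := by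
    refine hDc.comp ?_
    simp only [rotL_apply]; fun_prop
  have hpi : (0:ℝ) ≤ π/2 := by positivity
  have step : ∀ p : Ed d × Ed d, ENNReal.ofReal ((f p.1 - f p.2)^2 * (wg d a p.1 * wg d a p.2)) ≤ 
      ENNReal.ofReal (π/2) * ∫⁻ θ in Ioc (0:ℝ) (π/2), ENNReal.ofReal (D (rotL d θ p)) := by
    intro p
    have hci : Continuous (fun θ : ℝ => D (rotL d θ p)) := by
      refine hDc.comp ?_
      simp only [rotL_apply]; fun_prop
    have hci' : Integrable (fun θ : ℝ => D (rotL d θ p)) (volume.restrict (Ioc (0:ℝ) (π/2))) := hci.integrableOn_Icc.mono_set Ioc_subset_Icc_self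
    rw [← ofReal_integral_eq_lintegral_ofReal hci' (ae_of_all _ fun θ => hD0 _),
      ← ENNReal.ofReal_mul hpi]
    refine ENNReal.ofReal_le_ofReal ?_
    have h1 := jensen_path hf p
    have h2 : ∫ θ in Ioc (0:ℝ) (π/2), D (rotL d θ p) = (∫ θ in (0:ℝ)..(π/2), (fderiv ℝ f (rotL d θ p).1 (rotL d θ p).2)^2) * (wg d a p.1 * wg d a p.2) := by
      rw [intervalIntegral.integral_of_le hpi, ← integral_mul_const]
      simp only [hD, wg_rot]
    rw [h2, ← mul_assoc (π/2)]
    exact mul_le_mul_of_nonneg_right h1 (mul_pos (wg_pos a _) (wg_pos a _)).le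
  refine (lintegral_mono step).trans ?_
  rw [lintegral_const_mul' _ _ ENNReal.ofReal_ne_top]
  rw [lintegral_lintegral_swap (by exact (hj.measurable.ennreal_ofReal).aemeasurable)]
  have e : ∀ θ : ℝ, ∫⁻ p, ENNReal.ofReal (D (rotL d θ p)) ∂(V2 d) = ∫⁻ p, ENNReal.ofReal (D p) ∂(V2 d) := fun θ =>
    (rot_mp θ).lintegral_comp hDc.measurable.ennreal_ofReal
  simp only [e]
  rw [lintegral_const, Measure.restrict_apply_univ, volume_Ioc, sub_zero]
  have hle : ∫⁻ p, ENNReal.ofReal (D p) ∂(V2 d) ≤ (∫⁻ x, ENNReal.ofReal ((∑ i, pd i f x ^ 2) * wg d a x)) * ∫⁻ y : Ed d, ENNReal.ofReal (‖y‖^2 * wg d a y) := by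
    have hm1 : Measurable (fun x => ENNReal.ofReal ((∑ i, pd i f x ^ 2) * wg d a x)) := by
      refine Measurable.ennreal_ofReal (Continuous.measurable (Continuous.mul ?_ (wg_cont a)))
      exact continuous_finsetSum _ fun i _ => (hfc.clm_apply continuous_const).pow 2
    have hm2 : Measurable (fun y : Ed d => ENNReal.ofReal (‖y‖^2 * wg d a y)) := by
      refine Measurable.ennreal_ofReal (Continuous.measurable (Continuous.mul (by fun_prop) (wg_cont a)))
    rw [← lintegral_prod_mul hm1.aemeasurable hm2.aemeasurable]
    refine lintegral_mono fun p => ?_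
    rw [← ENNReal.ofReal_mul (mul_nonneg (Finset.sum_nonneg fun i _ => sq_nonneg _) (wg_pos a _).le)]
    refine ENNReal.ofReal_le_ofReal ?_
    have := mul_le_mul_of_nonneg_right (fderiv_sq_le f p.1 p.2) (mul_pos (wg_pos a p.1) (wg_pos a p.2)).le
    simp only [hD]
    nlinarith
  have h3 : ENNReal.ofReal (π/2) * (∫⁻ p, ENNReal.ofReal (D p) ∂(V2 d)) * ENNReal.ofReal (π/2) = ENNReal.ofReal (π^2/4) * ∫⁻ p, ENNReal.ofReal (D p) ∂(V2 d) := by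
    rw [mul_right_comm, ← ENNReal.ofReal_mul hpi]; congr 2; ring
  rw [← mul_assoc, h3]
  exact mul_le_mul_right hle _

/-- weighted variance -/
def var (a : ℝ) (f : Ed d → ℝ) : ℝ := (∫ x, wg d a x) * (∫ x, f x ^ 2 * wg d a x) - (∫ x, f x * wg d a x)^2

def Cp (d : ℕ) (a : ℝ) : ℝ := π^2/8 * ∫ y : Ed d, ‖y‖^2 * wg d a y

lemma poincare {f : Ed d → ℝ} (hf : ContDiff ℝ 1 f) {a : ℝ} (ha : 0 < a) (h1 : Integrable (fun x => f x * wg d a x))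
    (h2 : Integrable (fun x => f x ^ 2 * wg d a x)) (h3 : Integrable (fun x => (∑ i, pd i f x ^ 2) * wg d a x)) :
    var a f ≤ Cp d a * ∫ x, (∑ i, pd i f x ^ 2) * wg d a x := by
  have hq : Integrable (fun y : Ed d => ‖y‖^2 * wg d a y) := 
    ((PB.normsq (ι := Unit)).mul_GB (GB.gauss ha)).integrable () (Continuous.aestronglyMeasurable (by fun_prop))
  have hw := wg_integ (d := d) ha
  have A1 : Integrable (fun p : Ed d × Ed d => (f p.1 ^ 2 * wg d a p.1) * wg d a p.2) (V2 d) := h2.mul_prod hw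
  have A2 : Integrable (fun p : Ed d × Ed d => wg d a p.1 * (f p.2 ^ 2 * wg d a p.2)) (V2 d) := hw.mul_prod h2
  have A3 : Integrable (fun p : Ed d × Ed d => (f p.1 * wg d a p.1) * (f p.2 * wg d a p.2)) (V2 d) := h1.mul_prod h1
  have A12 : Integrable (fun p : Ed d × Ed d => (f p.1 ^ 2 * wg d a p.1) * wg d a p.2 + wg d a p.1 * (f p.2 ^ 2 * wg d a p.2)) (V2 d) := A1.add A2
  have A3' : Integrable (fun p : Ed d × Ed d => 2 * ((f p.1 * wg d a p.1) * (f p.2 * wg d a p.2))) (V2 d) := A3.const_mul 2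
  have e : (fun p : Ed d × Ed d => (f p.1 - f p.2)^2 * (wg d a p.1 * wg d a p.2)) = 
      fun p => ((f p.1 ^ 2 * wg d a p.1) * wg d a p.2 + wg d a p.1 * (f p.2 ^ 2 * wg d a p.2)) - 2 * ((f p.1 * wg d a p.1) * (f p.2 * wg d a p.2)) := by
    ext p; ring
  have hI : Integrable (fun p : Ed d × Ed d => (f p.1 - f p.2)^2 * (wg d a p.1 * wg d a p.2)) (V2 d) := by
    rw [e]; exact A12.sub A3'
  have hval : ∫ p : Ed d × Ed d, (f p.1 - f p.2)^2 * (wg d a p.1 * wg d a p.2) ∂(V2 d) = 2 * var a f := by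
    rw [e, integral_sub A12 A3', integral_add A1 A2, integral_const_mul,
      integral_prod_mul (fun x => f x ^ 2 * wg d a x) (fun x => wg d a x), 
      integral_prod_mul (fun x => wg d a x) (fun x => f x ^ 2 * wg d a x),
      integral_prod_mul (fun x => f x * wg d a x) (fun x => f x * wg d a x), var]
    ring
  have hp := poincare_lint hf a
  have s0 : ∀ x, 0 ≤ (∑ i, pd i f x ^ 2) * wg d a x := fun x => mul_nonneg (Finset.sum_nonneg fun i _ => sq_nonneg _) (wg_pos a _).le
  have q0 : ∀ y : Ed d, 0 ≤ ‖y‖^2 * wg d a y := fun y => mul_nonneg (sq_nonneg _) (wg_pos a _).le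
  rw [← ofReal_integral_eq_lintegral_ofReal hI (ae_of_all _ fun p => mul_nonneg (sq_nonneg _) (mul_pos (wg_pos a _) (wg_pos a _)).le),
    ← ofReal_integral_eq_lintegral_ofReal h3 (ae_of_all _ s0), ← ofReal_integral_eq_lintegral_ofReal hq (ae_of_all _ q0),
    ← ENNReal.ofReal_mul (integral_nonneg s0), ← ENNReal.ofReal_mul (by positivity), hval] at hp
  have hp' := (ENNReal.ofReal_le_ofReal_iff (mul_nonneg (by positivity) (mul_nonneg (integral_nonneg s0) (integral_nonneg q0)))).1 hp
  rw [Cp]; nlinarith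

end

section

open scoped ContDiff
variable {d : ℕ} {c₀ a₁ C₀ a₂ α L τ : ℝ}

def Phi (τ : ℝ) (ρ U : Ed d → ℝ) (n : ℕ) (i : Fin d) (x : Ed d) : ℝ :=
  mol (eta d n) (fun y => pd i U y * ρ y) x + τ * mol (pd i (eta d n)) ρ x

def Sc (τ : ℝ) (ρ : Ed d → ℝ) (n : ℕ) (i : Fin d) (x : Ed d) : ℝ :=
  τ * mol (pd i (eta d n)) ρ x / mol (eta d n) ρ x

def zeta (τ : ℝ) (ρ U : Ed d → ℝ) (n : ℕ) (x : Ed d) : ℝ := ∑ i, pd i (Phi τ ρ U n i) x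

def Qi (τ : ℝ) (ρ U V : Ed d → ℝ) (n : ℕ) (i : Fin d) : ℝ := ∫ x, (pd i V x + Sc τ ρ n i x) * Phi τ ρ U n i x

def Fi (τ : ℝ) (ρ : Ed d → ℝ) (n : ℕ) (i : Fin d) : ℝ := ∫ x, Sc τ ρ n i x ^ 2 * mol (eta d n) ρ x

def K1 (ρ : Ed d → ℝ) (n : ℕ) (i : Fin d) : Ed d → ℝ := mol (fun z => (2 * pd i (pn d n) z) * (2 * pd i (pn d n) z)) ρ

def K2 (ρ b : Ed d → ℝ) (n : ℕ) : Ed d → ℝ := mol (eta d n) (fun y => b y ^ 2 * ρ y)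

lemma pdR_sq {ρ : Ed d → ℝ} (h : Dens ρ) (n : ℕ) (i : Fin d) (x : Ed d) :
    (mol (pd i (eta d n)) ρ x)^2 ≤ mol (eta d n) ρ x * K1 ρ n i x := by
  have e : pd i (eta d n) = fun z => pn d n z * (2 * pd i (pn d n) z) := by ext z; exact pd_eta d n i z
  rw [e]
  exact mol_cs h (pn_ker d n) (((pn_ker d n).pd i).const_mul 2) x

lemma div_bound {a b R A B : ℝ} (hR : 0 < R) (ha : a^2 ≤ R * A) (hb : b^2 ≤ R * B) : |a * b / R| ≤ A + B := by
  rw [abs_div, abs_of_pos hR, div_le_iff₀ hR, abs_mul]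
  have := two_mul_le_add_sq |a| |b|
  rw [sq_abs, sq_abs] at this
  nlinarith [abs_nonneg a, abs_nonneg b, sq_nonneg a, sq_nonneg b]

lemma K1_ker (n : ℕ) (i : Fin d) : Ker (fun z => (2 * pd i (pn d n) z) * (2 * pd i (pn d n) z)) :=
  (((pn_ker d n).pd i).const_mul 2).mul (((pn_ker d n).pd i).const_mul 2)

lemma K1_cont {ρ : Ed d → ℝ} (h : Dens ρ) (n : ℕ) (i : Fin d) : Continuous (K1 ρ n i) :=
  (mol_contDiff (K1_ker n i) h.integ.locallyIntegrable).continuous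

lemma K1_integ {ρ : Ed d → ℝ} (h : Dens ρ) (n : ℕ) (i : Fin d) : Integrable (K1 ρ n i) :=
  mol_integrable (K1_ker n i) h.integ

lemma PB.mulNice {b ρ : Ed d → ℝ} (hb : PB (fun (_ : Unit) => b)) (h : Nice c₀ a₁ C₀ a₂ ρ) :
    GB (fun (_ : Unit) x => b x * ρ x) := hb.mul_GB h.GB1

lemma Pot.PBpd1 {U : Ed d → ℝ} (hU : Pot α L U) (i : Fin d) : WGF.PB (fun (_ : Unit) => pd i U) :=
  (Pot.PBpd α L i).comp (fun _ => ⟨U, hU⟩)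

lemma Pot.PB1 {U : Ed d → ℝ} (hU : Pot α L U) : WGF.PB (fun (_ : Unit) => U) :=
  (Pot.PB α L).comp (fun _ => ⟨U, hU⟩)

lemma bρ_integ {ρ b : Ed d → ℝ} (h : Nice c₀ a₁ C₀ a₂ ρ) (hb : PB (fun (_ : Unit) => b)) (hc : Measurable b) :
    Integrable (fun y => b y * ρ y) := (hb.mulNice h).integrable () (hc.mul h.meas).aestronglyMeasurable

lemma K2_integ {ρ b : Ed d → ℝ} (h : Nice c₀ a₁ C₀ a₂ ρ) (hb : PB (fun (_ : Unit) => b)) (hc : Measurable b) (n : ℕ) :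
    Integrable (K2 ρ b n) := mol_integrable (eta_ker d n) (bρ_integ h (by simpa using hb.sq) (hc.pow_const 2))

lemma R_smooth {ρ : Ed d → ℝ} (h : Nice c₀ a₁ C₀ a₂ ρ) (n : ℕ) : ContDiff ℝ ∞ (mol (eta d n) ρ) :=
  mol_contDiff (eta_ker d n) h.dens.integ.locallyIntegrable

lemma P_smooth {ρ : Ed d → ℝ} (h : Nice c₀ a₁ C₀ a₂ ρ) (n : ℕ) (i : Fin d) : ContDiff ℝ ∞ (mol (pd i (eta d n)) ρ) :=
  mol_contDiff ((eta_ker d n).pd i) h.dens.integ.locallyIntegrable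

lemma bρ_loc {ρ U : Ed d → ℝ} (h : Nice c₀ a₁ C₀ a₂ ρ) (hU : Pot α L U) (i : Fin d) : 
    LocallyIntegrable (fun y => pd i U y * ρ y) := 
  (bρ_integ h (hU.PBpd1 i) (hU.cont_pd i).measurable).locallyIntegrable

lemma B_smooth {ρ U : Ed d → ℝ} (h : Nice c₀ a₁ C₀ a₂ ρ) (hU : Pot α L U) (n : ℕ) (i : Fin d) : 
    ContDiff ℝ ∞ (mol (eta d n) (fun y => pd i U y * ρ y)) :=
  mol_contDiff (eta_ker d n) (bρ_loc h hU i)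

lemma Phi_smooth {ρ U : Ed d → ℝ} (h : Nice c₀ a₁ C₀ a₂ ρ) (hU : Pot α L U) (n : ℕ) (i : Fin d) : 
    ContDiff ℝ ∞ (Phi τ ρ U n i) := (B_smooth h hU n i).add (contDiff_const.mul (P_smooth h n i))

lemma pd_Phi {ρ U : Ed d → ℝ} (h : Nice c₀ a₁ C₀ a₂ ρ) (hU : Pot α L U) (n : ℕ) (i : Fin d) (x : Ed d) :
    pd i (Phi τ ρ U n i) x = mol (pd i (eta d n)) (fun y => pd i U y * ρ y) x + τ * mol (pd i (pd i (eta d n))) ρ x := by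
  have h1 := ((B_smooth h hU n i).differentiable (by simp) x).hasFDerivAt
  have h2 := ((P_smooth h n i).differentiable (by simp) x).hasFDerivAt
  have : HasFDerivAt (Phi τ ρ U n i) _ x := h1.add (h2.const_mul τ)
  rw [pd, this.fderiv]
  have e1 := pd_mol (eta_ker d n) (bρ_loc h hU i) i x
  have e2 := pd_mol ((eta_ker d n).pd i) h.dens.integ.locallyIntegrable i x
  rw [pd] at e1 e2
  simp [e1, e2]

lemma Sc_cont {ρ : Ed d → ℝ} (h : Nice c₀ a₁ C₀ a₂ ρ) (n : ℕ) (i : Fin d) : Continuous (Sc τ ρ n i) :=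
  (continuous_const.mul (P_smooth h n i).continuous).div (R_smooth h n).continuous (fun x => ((nice_mol h n).pos x).ne')

lemma pdV_R {ρ V : Ed d → ℝ} (h : Nice c₀ a₁ C₀ a₂ ρ) (hV : Pot α L V) (n : ℕ) (x : Ed d) :
    HasFDerivAt (fun x => V x + τ * log (mol (eta d n) ρ x)) 
      (fderiv ℝ V x + τ • ((mol (eta d n) ρ x)⁻¹ • fderiv ℝ (mol (eta d n) ρ) x)) x := by
  have h1 := (hV.hasFD x).hasFDerivAt
  have h2 := (((R_smooth h n).differentiable (by simp) x).hasFDerivAt.log ((nice_mol h n).pos x).ne').const_mul τ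
  exact h1.add h2

lemma pdV_R' {ρ V : Ed d → ℝ} (h : Nice c₀ a₁ C₀ a₂ ρ) (hV : Pot α L V) (n : ℕ) (i : Fin d) (x : Ed d) :
    pd i (fun x => V x + τ * log (mol (eta d n) ρ x)) x = pd i V x + Sc τ ρ n i x := by
  rw [pd, (pdV_R h hV n x).fderiv]
  have := pd_mol (eta_ker d n) h.dens.integ.locallyIntegrable i x
  rw [pd] at this
  simp [pd, Sc, this]; ring

/-- all the integrability at fixed n -/
lemma ScPhi_bound {ρ U : Ed d → ℝ} (h : Nice c₀ a₁ C₀ a₂ ρ) (hU : Pot α L U) (n : ℕ) (i : Fin d) (x : Ed d) :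
    |Sc τ ρ n i x * Phi τ ρ U n i x| ≤ (|τ| + 2 * τ^2) * (K1 ρ n i x + K2 ρ (pd i U) n x) := by
  have hR := (nice_mol h n).pos x
  have hP := pdR_sq h.dens n i x
  have hB : _ ≤ _ * K2 ρ (pd i U) n x := mol_cs_b h.dens n (hU.cont_pd i) x
  have h1 := div_bound hR hP hB
  have h2 := div_bound hR hP hP
  have e : Sc τ ρ n i x * Phi τ ρ U n i x = τ * (mol (pd i (eta d n)) ρ x * mol (eta d n) (fun y => pd i U y * ρ y) x / mol (eta d n) ρ x)
      + τ^2 * (mol (pd i (eta d n)) ρ x * mol (pd i (eta d n)) ρ x / mol (eta d n) ρ x) := by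
    rw [Sc, Phi]; field_simp
  have k2 : 0 ≤ K2 ρ (pd i U) n x := by
    exact nonneg_of_mul_nonneg_right ((sq_nonneg _).trans hB) hR
  rw [e]
  refine (abs_add_le _ _).trans ?_
  rw [abs_mul, abs_mul, abs_of_nonneg (sq_nonneg τ)]
  have := mul_le_mul_of_nonneg_left h1 (abs_nonneg τ)
  have := mul_le_mul_of_nonneg_left h2 (sq_nonneg τ)
  have k1 : 0 ≤ K1 ρ n i x := nonneg_of_mul_nonneg_right ((sq_nonneg _).trans hP) hR
  nlinarith [sq_nonneg τ, mul_nonneg (sq_nonneg τ) k2]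

lemma ScPhi_integ {ρ U : Ed d → ℝ} (h : Nice c₀ a₁ C₀ a₂ ρ) (hU : Pot α L U) (n : ℕ) (i : Fin d) :
    Integrable (fun x => Sc τ ρ n i x * Phi τ ρ U n i x) := by
  refine Integrable.mono' (((K1_integ h.dens n i).add (K2_integ h (hU.PBpd1 i) (hU.cont_pd i).measurable n)).const_mul (|τ| + 2 * τ^2)) 
    ((Sc_cont h n i).mul (Phi_smooth h hU n i).continuous).aestronglyMeasurable (ae_of_all _ fun x => ScPhi_bound h hU n i x)

lemma Phi_GB1 {ρ U : Ed d → ℝ} (h : Nice c₀ a₁ C₀ a₂ ρ) (hU : Pot α L U) (n : ℕ) (i : Fin d) :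
    GB (fun (_ : Unit) => Phi τ ρ U n i) :=
  (mol_GB1 ((hU.PBpd1 i).mulNice h) (eta_ker d n)).add ((mol_GB1 h.GB1 ((eta_ker d n).pd i)).const_mul τ)

lemma Fi_integ {ρ : Ed d → ℝ} (h : Nice c₀ a₁ C₀ a₂ ρ) (n : ℕ) (i : Fin d) :
    Integrable (fun x => Sc τ ρ n i x ^ 2 * mol (eta d n) ρ x) := by
  refine Integrable.mono' (((K1_integ h.dens n i)).const_mul (τ^2)) 
    (((Sc_cont h n i).pow 2).mul (R_smooth h n).continuous).aestronglyMeasurable (ae_of_all _ fun x => ?_)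
  have hR := (nice_mol h n).pos x
  have hP := pdR_sq h.dens n i x
  have e : Sc τ ρ n i x ^ 2 * mol (eta d n) ρ x = τ^2 * ((mol (pd i (eta d n)) ρ x)^2 / mol (eta d n) ρ x) := by
    rw [Sc]; field_simp
  rw [norm_eq_abs, abs_of_nonneg (by positivity), e]
  refine mul_le_mul_of_nonneg_left ?_ (sq_nonneg τ)
  rw [div_le_iff₀ hR]; linarith

lemma pdVPhi_integ {ρ U V : Ed d → ℝ} (h : Nice c₀ a₁ C₀ a₂ ρ) (hU : Pot α L U) (hV : Pot α L V) (n : ℕ) (i : Fin d) :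
    Integrable (fun x => pd i V x * Phi τ ρ U n i x) :=
  ((hV.PBpd1 i).mul_GB (Phi_GB1 h hU n i)).integrable () ((hV.cont_pd i).mul (Phi_smooth h hU n i).continuous).aestronglyMeasurable

lemma Qi_integ {ρ U V : Ed d → ℝ} (h : Nice c₀ a₁ C₀ a₂ ρ) (hU : Pot α L U) (hV : Pot α L V) (n : ℕ) (i : Fin d) :
    Integrable (fun x => (pd i V x + Sc τ ρ n i x) * Phi τ ρ U n i x) := by
  simp only [add_mul]; exact (pdVPhi_integ h hU hV n i).add (ScPhi_integ h hU n i)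

lemma pdPhi_GB1 {ρ U : Ed d → ℝ} (h : Nice c₀ a₁ C₀ a₂ ρ) (hU : Pot α L U) (n : ℕ) (i : Fin d) :
    GB (fun (_ : Unit) => pd i (Phi τ ρ U n i)) := by
  have : GB (fun (_ : Unit) x => mol (pd i (eta d n)) (fun y => pd i U y * ρ y) x + τ * mol (pd i (pd i (eta d n))) ρ x) :=
    (mol_GB1 ((hU.PBpd1 i).mulNice h) ((eta_ker d n).pd i)).add ((mol_GB1 h.GB1 (((eta_ker d n).pd i).pd i)).const_mul τ)
  exact this.mono fun _ x => by rw [pd_Phi h hU]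

lemma by_parts {ρ U V : Ed d → ℝ} (h : Nice c₀ a₁ C₀ a₂ ρ) (hU : Pot α L U) (hV : Pot α L V) (n : ℕ) :
    ∫ x, (V x + τ * log (mol (eta d n) ρ x)) * zeta τ ρ U n x = - ∑ i, Qi τ ρ U V n i := by
  have hfPB : PB (fun (_ : Unit) x => V x + τ * log (mol (eta d n) ρ x)) := hV.PB1.add ((nice_mol h n).PBlog1.const_mul τ)
  have hfc : Continuous (fun x => V x + τ * log (mol (eta d n) ρ x)) := 
    hV.smooth.continuous.add (continuous_const.mul ((R_smooth h n).continuous.log fun x => ((nice_mol h n).pos x).ne'))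
  have hI : ∀ i, Integrable (fun x => (V x + τ * log (mol (eta d n) ρ x)) * pd i (Phi τ ρ U n i) x) := fun i =>
    (hfPB.mul_GB (pdPhi_GB1 h hU n i)).integrable () (hfc.mul (contDiff_pd (Phi_smooth h hU n i) i).continuous).aestronglyMeasurable
  simp only [zeta, Finset.mul_sum]
  rw [integral_finsetSum _ fun i _ => hI i, ← Finset.sum_neg_distrib]
  refine Finset.sum_congr rfl fun i _ => ?_
  have hq := Qi_integ (τ := τ) h hU hV n i
  have hf : Differentiable ℝ (fun x => V x + τ * log (mol (eta d n) ρ x)) := fun x => (pdV_R h hV n x).differentiableAt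
  have := integral_mul_fderiv_eq_neg_fderiv_mul_of_integrable (μ := (volume : Measure (Ed d))) (v := EuclideanSpace.single i 1)
    (f := fun x => V x + τ * log (mol (eta d n) ρ x)) (g := Phi τ ρ U n i)
    ?_ (hI i) ?_ (fun x _ => hf x) (fun x _ => (Phi_smooth h hU n i).differentiable (by simp) x)
  · refine this.trans ?_
    rw [Qi]; congr 2; ext x; rw [← pdV_R' h hV]; rfl
  · refine hq.congr (ae_of_all _ fun x => ?_)
    simp only; rw [← pdV_R' h hV]; rfl
  · exact (hfPB.mul_GB (Phi_GB1 h hU n i)).integrable () (hfc.mul (Phi_smooth h hU n i).continuous).aestronglyMeasurable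

end

section

open scoped ContDiff
variable {d : ℕ} {c₀ a₁ C₀ a₂ α L τ : ℝ}

lemma pt1 {b S B R K : ℝ} (hR : 0 < R) (hB : B^2 ≤ R * K) :
    1/2 * (S^2 * R) - 3/2 * (b^2 * R) - 3/2 * K ≤ (b + S) * (B + S * R) := by
  have h1 : -(S * B) ≤ 1/4 * (S^2 * R) + K := by
    have : 0 ≤ (S * R + 2 * B)^2 := sq_nonneg _
    nlinarith
  have h2 : -(b * B) ≤ 1/2 * (b^2*R) + 1/2 * K := by
    have : 0 ≤ (b * R + B)^2 := sq_nonneg _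
    nlinarith
  have h3 : -(b * S * R) ≤ 1/4 * (S^2*R) + b^2 * R := by
    nlinarith [mul_nonneg hR.le (sq_nonneg (S + 2 * b))]
  nlinarith

lemma Phi_eq {ρ U : Ed d → ℝ} (h : Nice c₀ a₁ C₀ a₂ ρ) (n : ℕ) (i : Fin d) (x : Ed d) :
    Phi τ ρ U n i x = mol (eta d n) (fun y => pd i U y * ρ y) x + Sc τ ρ n i x * mol (eta d n) ρ x := by
  have hR := (nice_mol h n).pos x
  rw [Phi, Sc]; field_simp

lemma mol_eta_GB {ι : Type*} {g : ι → Ed d → ℝ} (hg : GB g) : GB (fun (p : ℕ × ι) => mol (eta d p.1) (g p.2)) :=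
  mol_GB hg (χ := fun n => eta d n) (fun n => eta_ker d n) (C := 1) (fun n => (eta_int_abs d n).le)

lemma bR_integ {ρ b : Ed d → ℝ} (h : Nice c₀ a₁ C₀ a₂ ρ) (hb : PB (fun (_ : Unit) => b)) (hc : Measurable b) (n : ℕ) :
    Integrable (fun x => b x * mol (eta d n) ρ x) := bρ_integ (nice_mol h n) hb hc

lemma Qi_ge (c₀ a₁ C₀ a₂ α L τ : ℝ) (i : Fin d) : ∃ C', 0 ≤ C' ∧ ∀ (ρ U V : Ed d → ℝ), Nice c₀ a₁ C₀ a₂ ρ → Pot α L U → Pot α L V → 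
    ∀ n, 1/2 * Fi τ ρ n i - C' ≤ Qi τ ρ U V n i := by
  have g1 : GB (fun (p : {U : Ed d → ℝ // Pot α L U} × {ρ : Ed d → ℝ // Nice c₀ a₁ C₀ a₂ ρ}) x => pd i p.1.1 x ^ 2 * p.2.1 x) :=
    ((Pot.PBpd α L i).sq.comp Prod.fst).mul_GB ((Nice.GB c₀ a₁ C₀ a₂).comp Prod.snd)
  have g2 : GB (fun (p : {U : Ed d → ℝ // Pot α L U} × {ρ : Ed d → ℝ // Nice (c₀ * exp (-a₁)) a₁ (C₀ * exp a₂) (a₂/2) ρ}) x => pd i p.1.1 x ^ 2 * p.2.1 x) :=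
    ((Pot.PBpd α L i).sq.comp Prod.fst).mul_GB ((Nice.GB _ _ _ _).comp Prod.snd)
  obtain ⟨C1, hC1, h1⟩ := g1.abs_integral_le
  obtain ⟨C2, hC2, h2⟩ := g2.abs_integral_le
  refine ⟨3/2 * C2 + 3/2 * C1, by positivity, fun ρ U V h hU hV n => ?_⟩
  have i1 := (Fi_integ (τ := τ) h n i).const_mul (1/2)
  have i2 := (bR_integ h (b := fun x => pd i V x ^ 2) (hV.PBpd1 i).sq ((hV.cont_pd i).pow 2).measurable n).const_mul (3/2)
  have i3 := (K2_integ h (hU.PBpd1 i) (hU.cont_pd i).measurable n).const_mul (3/2)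
  have i12 : Integrable (fun x => 1/2 * (Sc τ ρ n i x ^ 2 * mol (eta d n) ρ x) - 3/2 * (pd i V x ^ 2 * mol (eta d n) ρ x)) := i1.sub i2
  have key : ∫ x, (1/2 * (Sc τ ρ n i x ^ 2 * mol (eta d n) ρ x) - 3/2 * (pd i V x ^ 2 * mol (eta d n) ρ x) - 3/2 * K2 ρ (pd i U) n x) ≤ Qi τ ρ U V n i := by
    refine integral_mono (i12.sub i3) (Qi_integ h hU hV n i) fun x => ?_
    simp only [Phi_eq h]
    exact pt1 ((nice_mol h n).pos x) (mol_cs_b h.dens n (hU.cont_pd i) x)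
  rw [integral_sub i12 i3, integral_sub i1 i2, integral_const_mul, integral_const_mul, integral_const_mul] at key
  have e3 : ∫ x, K2 ρ (pd i U) n x = ∫ x, pd i U x ^ 2 * ρ x := 
    mol_eta_integral n (bρ_integ h (hU.PBpd1 i).sq ((hU.cont_pd i).pow 2).measurable)
  have b1 := (le_abs_self _).trans (h1 (⟨U, hU⟩, ⟨ρ, h⟩))
  have b2 := (le_abs_self _).trans (h2 (⟨V, hV⟩, ⟨_, nice_mol h n⟩))
  rw [e3] at key
  simp only [Fi] at *
  linarith

def Hn (ρ b : Ed d → ℝ) (n : ℕ) (x : Ed d) : ℝ :=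
  K2 ρ b n x - 2 * b x * mol (eta d n) (fun y => b y * ρ y) x + b x ^ 2 * mol (eta d n) ρ x

lemma Hn_GB {ρ b : Ed d → ℝ} (h : Nice c₀ a₁ C₀ a₂ ρ) (hb : PB (fun (_ : Unit) => b)) : GB (fun (n : ℕ) x => Hn ρ b n x) := by
  have hb' : PB (fun (_ : ℕ) => b) := hb.comp (fun _ => ())
  have k2 : GB (fun (n : ℕ) x => K2 ρ b n x) := (mol_eta_GB (hb.sq.mulNice h)).comp (fun n => (n, ()))
  have k3 : GB (fun (n : ℕ) => mol (eta d n) (fun y => b y * ρ y)) := (mol_eta_GB (hb.mulNice h)).comp (fun n => (n, ()))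
  have k4 : GB (fun (n : ℕ) => mol (eta d n) ρ) := (mol_eta_GB h.GB1).comp (fun n => (n, ()))
  exact (k2.sub ((hb'.const_mul 2).mul_GB k3)).add (hb'.sq.mul_GB k4)

lemma Hn_cont {ρ b : Ed d → ℝ} (h : Nice c₀ a₁ C₀ a₂ ρ) (hb : PB (fun (_ : Unit) => b)) (hc : Continuous b) (n : ℕ) : Continuous (Hn ρ b n) := by
  have c1 : Continuous (K2 ρ b n) := (mol_contDiff (eta_ker d n) (bρ_integ h hb.sq (hc.pow 2).measurable).locallyIntegrable).continuous
  have c2 := (mol_contDiff (eta_ker d n) (bρ_integ h hb hc.measurable).locallyIntegrable).continuous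
  have c3 := (R_smooth h n).continuous
  exact (c1.sub ((continuous_const.mul hc).mul c2)).add ((hc.pow 2).mul c3)

lemma Hn_tendsto {ρ b : Ed d → ℝ} (h : Nice c₀ a₁ C₀ a₂ ρ) (hb : PB (fun (_ : Unit) => b)) (hc : Continuous b) :
    Tendsto (fun n => ∫ x, Hn ρ b n x) atTop (𝓝 0) := by
  have := (Hn_GB h hb).tendsto (l := atTop) (f := fun _ => 0) (Eventually.of_forall fun n => (Hn_cont h hb hc n).aestronglyMeasurable) ?_
  · simpa using this
  · filter_upwards [mol_tendsto_ae (bρ_integ h hb.sq (hc.pow 2).measurable).locallyIntegrable, 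
      mol_tendsto_ae (bρ_integ h hb hc.measurable).locallyIntegrable, mol_tendsto_ae h.dens.integ.locallyIntegrable] with x h1 h2 h3
    have := (h1.sub (h2.const_mul (2 * b x))).add (h3.const_mul (b x ^ 2))
    have e : b x ^ 2 * ρ x - 2 * b x * (b x * ρ x) + b x ^ 2 * ρ x = 0 := by ring
    rw [e] at this
    exact this

lemma pt2 {b S B R H d' : ℝ} (hR : 0 < R) (hB : (B - b * R)^2 ≤ R * H) :
    1/2 * ((b + S)^2 * R) - 1/2 * H + d' * (B + S * R) ≤ ((b + d') + S) * (B + S * R) := by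
  have : -(2 * (b + S) * (B - b * R)) ≤ (b+S)^2 * R + H := by
    have : 0 ≤ ((b + S) * R + (B - b * R))^2 := sq_nonneg _
    nlinarith
  nlinarith

lemma vsq_integ {ρ U : Ed d → ℝ} (h : Nice c₀ a₁ C₀ a₂ ρ) (hU : Pot α L U) (n : ℕ) (i : Fin d) :
    Integrable (fun x => (pd i U x + Sc τ ρ n i x)^2 * mol (eta d n) ρ x) := by
  have i2 := (bR_integ h (b := fun x => pd i U x ^ 2) (hU.PBpd1 i).sq ((hU.cont_pd i).pow 2).measurable n).const_mul 2
  have i1 := (Fi_integ (τ := τ) h n i).const_mul 2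
  refine Integrable.mono' (i1.add i2) ((((hU.cont_pd i).add (Sc_cont h n i)).pow 2).mul (R_smooth h n).continuous).aestronglyMeasurable (ae_of_all _ fun x => ?_)
  have hR := (nice_mol h n).pos x
  rw [norm_eq_abs, abs_of_nonneg (by positivity)]
  show _ ≤ 2 * (Sc τ ρ n i x ^ 2 * mol (eta d n) ρ x) + 2 * (pd i U x ^ 2 * mol (eta d n) ρ x)
  nlinarith [mul_nonneg hR.le (sq_nonneg (pd i U x - Sc τ ρ n i x))]

lemma Qi_ge2 {ρ U V : Ed d → ℝ} (h : Nice c₀ a₁ C₀ a₂ ρ) (hU : Pot α L U) (hV : Pot α L V) (n : ℕ) (i : Fin d) :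
    1/2 * (∫ x, (pd i U x + Sc τ ρ n i x)^2 * mol (eta d n) ρ x) - 1/2 * (∫ x, Hn ρ (pd i U) n x) 
      + ∫ x, (pd i V x - pd i U x) * Phi τ ρ U n i x ≤ Qi τ ρ U V n i := by
  have i1 := (vsq_integ (τ := τ) h hU n i).const_mul (1/2)
  have i2 := ((Hn_GB h (hU.PBpd1 i)).integrable n (Hn_cont h (hU.PBpd1 i) (hU.cont_pd i) n).aestronglyMeasurable).const_mul (1/2)
  have i3 : Integrable (fun x => (pd i V x - pd i U x) * Phi τ ρ U n i x) := by
    simp only [sub_mul]; exact (pdVPhi_integ h hU hV n i).sub (pdVPhi_integ h hU hU n i)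
  have i12 : Integrable (fun x => 1/2 * ((pd i U x + Sc τ ρ n i x)^2 * mol (eta d n) ρ x) - 1/2 * Hn ρ (pd i U) n x) := i1.sub i2
  rw [← integral_const_mul, ← integral_const_mul, ← integral_sub i1 i2, ← integral_add i12 i3]
  refine integral_mono (i12.add i3) (Qi_integ h hU hV n i) fun x => ?_
  simp only [Phi_eq h]
  have hB := mol_cs_b h.dens n (hU.cont_pd i) x
  have := pt2 (b := pd i U x) (S := Sc τ ρ n i x) (H := Hn ρ (pd i U) n x) (d' := pd i V x - pd i U x) ((nice_mol h n).pos x) (B := mol (eta d n) (fun y => pd i U y * ρ y) x) (by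
    rw [Hn, K2]; nlinarith)
  rw [add_sub_cancel] at this
  exact this

end

section

open scoped ContDiff
variable {d : ℕ} {c₀ a₁ C₀ a₂ α L τ : ℝ}

lemma R_tendsto {ρ b : Ed d → ℝ} (h : Nice c₀ a₁ C₀ a₂ ρ) (hb : PB (fun (_ : Unit) => b)) (hc : Measurable b) :
    Tendsto (fun n => ∫ x, b x * mol (eta d n) ρ x) atTop (𝓝 (∫ x, b x * ρ x)) := by
  have hg : GB (fun (n : ℕ) x => b x * mol (eta d n) ρ x) :=
    (hb.comp (fun _ : ℕ => ())).mul_GB ((mol_eta_GB h.GB1).comp (fun n : ℕ => (n, ())))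
  refine hg.tendsto (Eventually.of_forall fun n => (bR_integ h hb hc n).aestronglyMeasurable) ?_
  filter_upwards [mol_tendsto_ae h.dens.integ.locallyIntegrable] with x hx
  exact hx.const_mul _

lemma PB_of_compact {φ : Ed d → ℝ} (h1 : Continuous φ) (h2 : HasCompactSupport φ) : PB (fun (_ : Unit) => φ) := by
  obtain ⟨C, hC⟩ := h2.exists_bound_of_continuous h1
  refine ⟨|C|, 0, abs_nonneg _, fun _ x => ?_⟩
  have := hC x
  rw [Real.norm_eq_abs] at this
  simp only [pow_zero, mul_one]
  exact this.trans (le_abs_self _)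

lemma pd_compact {φ : Ed d → ℝ} (h2 : HasCompactSupport φ) (i : Fin d) : HasCompactSupport (pd i φ) :=
  h2.fderiv_apply (𝕜 := ℝ) _

lemma parts_R {ρ φ : Ed d → ℝ} (h : Nice c₀ a₁ C₀ a₂ ρ) (hφ : ContDiff ℝ ∞ φ) (hc : HasCompactSupport φ) (n : ℕ) (i : Fin d) :
    ∫ x, pd i φ x * mol (eta d n) ρ x = - ∫ x, φ x * mol (pd i (eta d n)) ρ x := by
  have hR := R_smooth h n
  have e : ∀ x, fderiv ℝ (mol (eta d n) ρ) x (EuclideanSpace.single i 1) = mol (pd i (eta d n)) ρ x :=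
    fun x => pd_mol (eta_ker d n) h.dens.integ.locallyIntegrable i x
  have i1 : Integrable (fun x => φ x * mol (pd i (eta d n)) ρ x) :=
    (hφ.continuous.mul (P_smooth h n i).continuous).integrable_of_hasCompactSupport hc.mul_right
  have i2 : Integrable (fun x => pd i φ x * mol (eta d n) ρ x) :=
    ((contDiff_pd hφ i).continuous.mul hR.continuous).integrable_of_hasCompactSupport (pd_compact hc i).mul_right
  have i3 : Integrable (fun x => φ x * mol (eta d n) ρ x) :=
    (hφ.continuous.mul hR.continuous).integrable_of_hasCompactSupport hc.mul_right
  have := integral_mul_fderiv_eq_neg_fderiv_mul_of_integrable (μ := (volume : Measure (Ed d))) (f := φ) (g := mol (eta d n) ρ)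
    (v := EuclideanSpace.single i 1) i2 (by simpa only [e] using i1) i3 (fun x _ => hφ.differentiable (by simp) x) (fun x _ => hR.differentiable (by simp) x)
  simp only [e] at this
  rw [this, neg_neg]
  rfl

lemma fisher_bound {ρ φ : Ed d → ℝ} (h : Nice c₀ a₁ C₀ a₂ ρ) (hτ : 0 < τ) (i : Fin d) {A : ℝ}
    (hA : ∃ᶠ n in atTop, Fi τ ρ n i ≤ A) (hφ : ContDiff ℝ ∞ φ) (hc : HasCompactSupport φ) :
    τ^2 * (∫ x, pd i φ x * ρ x)^2 ≤ A * ∫ x, φ x ^ 2 * ρ x := by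
  have t1 := ((R_tendsto h (PB_of_compact (contDiff_pd hφ i).continuous (pd_compact hc i)) (contDiff_pd hφ i).continuous.measurable).pow 2).const_mul (τ^2)
  have t2 := (R_tendsto h (PB_of_compact hφ.continuous hc).sq (hφ.continuous.pow 2).measurable).const_mul A
  refine le_of_tendsto_of_tendsto_of_frequently t1 t2 (hA.mono fun n hn => ?_)
  have hR := nice_mol h n
  set R := mol (eta d n) ρ with hRd
  rw [parts_R h hφ hc]
  have Rc : Continuous R := (R_smooth h n).continuous
  have e1 : τ * ∫ x, φ x * mol (pd i (eta d n)) ρ x = ∫ x, (φ x * √(R x)) * (Sc τ ρ n i x * √(R x)) := by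
    rw [← integral_const_mul]
    congr 1; ext x
    have h0 := hR.pos x
    have : √(R x) * √(R x) = R x := Real.mul_self_sqrt h0.le
    have h2 : Sc τ ρ n i x * R x = τ * mol (pd i (eta d n)) ρ x := by
      rw [Sc, ← hRd]; field_simp
    linear_combination φ x * (- h2) - φ x * Sc τ ρ n i x * this
  have sq : ∀ x, √(R x) ^ 2 = R x := fun x => Real.sq_sqrt (hR.pos x).le
  have j1 : Integrable (fun x => (φ x * √(R x)) ^ 2) := by
    apply Continuous.integrable_of_hasCompactSupport
    · exact (hφ.continuous.mul Rc.sqrt).pow 2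
    · refine hc.mono' (Function.support_subset_iff'.2 fun x hx => ?_)
      have : φ x = 0 := image_eq_zero_of_notMem_tsupport hx
      simp [this]
  have j2 : Integrable (fun x => (Sc τ ρ n i x * √(R x)) ^ 2) := by
    simp only [mul_pow, sq]; exact Fi_integ h n i
  have j3 : Integrable (fun x => (φ x * √(R x)) * (Sc τ ρ n i x * √(R x))) := by
    apply Continuous.integrable_of_hasCompactSupport
    · exact (hφ.continuous.mul Rc.sqrt).mul ((Sc_cont h n i).mul Rc.sqrt)
    · refine hc.mono' (Function.support_subset_iff'.2 fun x hx => ?_)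
      have : φ x = 0 := image_eq_zero_of_notMem_tsupport hx
      simp [this]
  have cs := cs_integral j1 j2 j3
  rw [← e1] at cs
  simp only [mul_pow, sq] at cs
  have e2 : (∫ x, Sc τ ρ n i x ^ 2 * R x) = Fi τ ρ n i := rfl
  rw [e2] at cs
  have p0 : 0 ≤ ∫ x, φ x ^ 2 * R x := integral_nonneg fun x => mul_nonneg (sq_nonneg _) (hR.pos x).le
  rw [neg_sq]
  refine cs.trans ?_
  rw [mul_comm A]
  gcongr

/-- smooth compactly supported functions -/
def CS (d : ℕ) : Submodule ℝ (Ed d → ℝ) where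
  carrier := {φ | ContDiff ℝ ∞ φ ∧ HasCompactSupport φ}
  add_mem' h1 h2 := ⟨h1.1.add h2.1, h1.2.add h2.2⟩
  zero_mem' := ⟨contDiff_const, HasCompactSupport.zero⟩
  smul_mem' c φ h := ⟨h.1.const_smul c, by
    have := h.2
    exact this.smul_left (f := fun _ => c)⟩

lemma pd_add' {f g : Ed d → ℝ} {x : Ed d} (i : Fin d) (hf : DifferentiableAt ℝ f x) (hg : DifferentiableAt ℝ g x) :
    pd i (f + g) x = pd i f x + pd i g x := by
  simp only [pd]; rw [fderiv_add hf hg]; rfl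

lemma pd_smul' {f : Ed d → ℝ} {x : Ed d} (i : Fin d) (c : ℝ) (hf : DifferentiableAt ℝ f x) :
    pd i (c • f) x = c * pd i f x := by
  simp only [pd]; rw [fderiv_const_smul hf]; rfl

lemma CS.pd_integ {ρ : Ed d → ℝ} (h : Nice c₀ a₁ C₀ a₂ ρ) (φ : CS d) (i : Fin d) : Integrable (fun x => pd i φ.1 x * ρ x) :=
  bρ_integ h (PB_of_compact (contDiff_pd φ.2.1 i).continuous (pd_compact φ.2.2 i)) (contDiff_pd φ.2.1 i).continuous.measurable

lemma score {ρ : Ed d → ℝ} (h : Nice c₀ a₁ C₀ a₂ ρ) (i : Fin d) {K : ℝ}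
    (hK : ∀ φ : Ed d → ℝ, ContDiff ℝ ∞ φ → HasCompactSupport φ → (∫ x, pd i φ x * ρ x)^2 ≤ K * ∫ x, φ x ^ 2 * ρ x) :
    ∃ J : Ed d → ℝ, Integrable J ∧ ∀ φ : Ed d → ℝ, ContDiff ℝ ∞ φ → HasCompactSupport φ → 
      ∫ x, pd i φ x * ρ x = - ∫ x, φ x * J x := by
  have hm := h.meas
  have h0 : ∀ x, 0 ≤ ρ x := fun x => (h.pos x).le
  have := h.dens.isProb
  have mem : ∀ φ : CS d, MemLp φ.1 2 (mu ρ) := fun φ => φ.2.1.continuous.memLp_of_hasCompactSupport φ.2.2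
  let e : CS d →ₗ[ℝ] Lp ℝ 2 (mu ρ) :=
    { toFun := fun φ => (mem φ).toLp φ.1
      map_add' := fun φ ψ => MemLp.toLp_add (mem φ) (mem ψ)
      map_smul' := fun c φ => MemLp.toLp_const_smul c (mem φ) }
  let f : CS d →ₗ[ℝ] ℝ :=
    { toFun := fun φ => ∫ x, pd i φ.1 x * ρ x
      map_add' := fun φ ψ => by
        rw [← integral_add (CS.pd_integ h φ i) (CS.pd_integ h ψ i)]
        congr 1; ext x
        have := pd_add' (f := φ.1) (g := ψ.1) (x := x) i (φ.2.1.differentiable (by simp) x) (ψ.2.1.differentiable (by simp) x)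
        rw [show ((φ + ψ : CS d) : Ed d → ℝ) = φ.1 + ψ.1 from rfl, this]; ring
      map_smul' := fun c φ => by
        simp only [RingHom.id_apply, smul_eq_mul]
        rw [← integral_const_mul]
        congr 1; ext x
        have := pd_smul' (f := φ.1) (x := x) i c (φ.2.1.differentiable (by simp) x)
        rw [show ((c • φ : CS d) : Ed d → ℝ) = c • φ.1 from rfl, this]; ring }
  have dense : DenseRange e := by
    have := Lp.dense_hasCompactSupport_contDiff (E := Ed d) (F := ℝ) (μ := mu ρ) (p := 2) (by simp)
    refine this.mono ?_
    rintro g ⟨φ, hg, hc, hs⟩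
    refine ⟨⟨φ, hs, hc⟩, ?_⟩
    apply Lp.ext
    exact (MemLp.coeFn_toLp (mem ⟨φ, hs, hc⟩)).trans hg.symm
  have nrm : ∀ φ : CS d, ‖e φ‖ ^ 2 = ∫ x, φ.1 x ^ 2 * ρ x := by
    intro φ
    rw [← real_inner_self_eq_norm_sq, L2.inner_def, ← integral_mu hm h0]
    apply integral_congr_ae
    filter_upwards [MemLp.coeFn_toLp (mem φ)] with x hx
    have : (e φ : Ed d → ℝ) x = φ.1 x := hx
    rw [this]; simp [pow_two]
  have bd : ∃ C : ℝ, ∀ φ, ‖f φ‖ ≤ C * ‖e φ‖ := by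
    refine ⟨√|K|, fun φ => ?_⟩
    have := hK φ.1 φ.2.1 φ.2.2
    rw [← nrm] at this
    rw [Real.norm_eq_abs]
    apply abs_le_of_sq_le_sq
    · rw [mul_pow, Real.sq_sqrt (abs_nonneg _)]
      exact this.trans (mul_le_mul_of_nonneg_right (le_abs_self K) (sq_nonneg _))
    · positivity
  let T : Lp ℝ 2 (mu ρ) →L[ℝ] ℝ := f.extendOfNorm e
  let s := (InnerProductSpace.toDual ℝ (Lp ℝ 2 (mu ρ))).symm T
  have hs : ∀ φ, ⟪s, e φ⟫ = f φ := fun φ => by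
    rw [InnerProductSpace.toDual_symm_apply]
    exact LinearMap.extendOfNorm_eq dense bd φ
  refine ⟨fun x => - (s x * ρ x), ?_, fun φ h1 h2 => ?_⟩
  · refine Integrable.neg ?_
    rw [← integrable_mu hm h0]
    exact (Lp.memLp s).integrable (by norm_num)
  · have := hs ⟨φ, h1, h2⟩
    rw [L2.inner_def] at this
    change _ = ∫ x, pd i φ x * ρ x at this
    rw [← this, ← integral_neg]
    rw [integral_congr_ae (g := fun x => φ x * s x), integral_mu hm h0]
    · congr 1; ext x; ring
    · filter_upwards [MemLp.coeFn_toLp (mem ⟨φ, h1, h2⟩)] with x hx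
      have : (e ⟨φ, h1, h2⟩ : Ed d → ℝ) x = φ x := hx
      rw [this]; simp

lemma pd_shift {χ : Ed d → ℝ} (h : Ker χ) (i : Fin d) (x y : Ed d) : pd i (fun y => χ (x - y)) y = - pd i χ (x - y) := by
  have h1 : HasFDerivAt (fun y : Ed d => x - y) (-(ContinuousLinearMap.id ℝ (Ed d))) y := by
    simpa using (hasFDerivAt_id y).const_sub x
  have h2 : HasFDerivAt χ (fderiv ℝ χ (x - y)) (x - y) := (h.smooth.differentiable (by simp) _).hasFDerivAt
  have := (h2.comp y h1).fderiv
  simp only [pd]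
  rw [show (fun y => χ (x - y)) = χ ∘ (fun y => x - y) from rfl, this]
  simp

lemma Phi_mol {ρ U : Ed d → ℝ} (h : Nice c₀ a₁ C₀ a₂ ρ) (hU : Pot α L U) (hτ : 0 < τ) (i : Fin d) {A : ℝ}
    (hA : ∃ᶠ n in atTop, Fi τ ρ n i ≤ A) : ∃ J : Ed d → ℝ, Integrable J ∧ ∀ n x, Phi τ ρ U n i x = mol (eta d n) J x := by
  obtain ⟨J, hJ, hJ'⟩ := score h i (K := A / τ^2) (fun φ h1 h2 => by
    have := fisher_bound h hτ i hA h1 h2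
    rw [div_mul_eq_mul_div, le_div_iff₀ (by positivity)]
    linarith)
  have hb := bρ_integ h (hU.PBpd1 i) (hU.cont_pd i).measurable
  refine ⟨fun y => pd i U y * ρ y + τ * J y, hb.add (hJ.const_mul τ), fun n x => ?_⟩
  rw [mol_add (eta_ker d n) hb.locallyIntegrable (hJ.const_mul τ).locallyIntegrable, mol_const_mul, Phi]
  congr 2
  have := hJ' _ ((eta_ker d n).shift_smooth x) ((eta_ker d n).shift_compact x)
  simp only [pd_shift (eta_ker d n)] at this
  simp only [neg_mul, integral_neg] at this
  exact neg_injective this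

end

section

open scoped ContDiff
variable {d : ℕ} {c₀ a₁ C₀ a₂ α L τ : ℝ} {G : Measure (Ed d) → ℝ} {G' : Measure (Ed d) → Ed d → ℝ} {ρ k : Ed d → ℝ}

lemma R_ae (h : Nice c₀ a₁ C₀ a₂ ρ) : ∀ᵐ x, Tendsto (fun n => mol (eta d n) ρ x) atTop (𝓝 (ρ x)) :=
  mol_tendsto_ae h.dens.integ.locallyIntegrable

lemma R_GB (h : Nice c₀ a₁ C₀ a₂ ρ) : GB (fun (n : ℕ) x => mol (eta d n) ρ x) :=
  (mol_eta_GB h.GB1).comp (fun n : ℕ => (n, ()))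

lemma R_PBlog (h : Nice c₀ a₁ C₀ a₂ ρ) : PB (fun (n : ℕ) x => log (mol (eta d n) ρ x)) :=
  (Nice.PBlog (d := d) (c₀ * exp (-a₁)) a₁ (C₀ * exp a₂) (a₂/2)).comp (fun n : ℕ => ⟨mol (eta d n) ρ, nice_mol h n⟩)

lemma Ent_tendsto (h : Nice c₀ a₁ C₀ a₂ ρ) : Tendsto (fun n => Ent (mol (eta d n) ρ)) atTop (𝓝 (Ent ρ)) := by
  have hg : GB (fun (n : ℕ) x => mol (eta d n) ρ x * log (mol (eta d n) ρ x)) := by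
    refine ((R_PBlog h).mul_GB (R_GB h)).mono fun n x => ?_
    rw [mul_comm]
  refine hg.tendsto (Eventually.of_forall fun n => (nice_mol h n).dens.ent.aestronglyMeasurable) ?_
  filter_upwards [R_ae h] with x hx
  exact hx.mul (hx.log (h.pos x).ne')

lemma logR_tendsto (h : Nice c₀ a₁ C₀ a₂ ρ) {k : Ed d → ℝ} (hk : Nice c₀ a₁ C₀ a₂ k) :
    Tendsto (fun n => ∫ x, log (mol (eta d n) ρ x) * (k x - mol (eta d n) ρ x)) atTop (𝓝 (∫ x, log (ρ x) * (k x - ρ x))) := by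
  have hg : GB (fun (n : ℕ) x => log (mol (eta d n) ρ x) * (k x - mol (eta d n) ρ x)) :=
    (R_PBlog h).mul_GB ((hk.GB1.comp (fun _ : ℕ => ())).sub (R_GB h))
  refine hg.tendsto (Eventually.of_forall fun n => ?_) ?_
  · have hR := nice_mol h n
    exact (hR.meas.log.mul (hk.meas.sub hR.meas)).aestronglyMeasurable
  filter_upwards [R_ae h] with x hx
  exact (hx.log (h.pos x).ne').mul (hx.const_sub _)

lemma KL_tendsto (h : Nice c₀ a₁ C₀ a₂ ρ) {k : Ed d → ℝ} (hk : Nice c₀ a₁ C₀ a₂ k) :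
    Tendsto (fun n => KL k (mol (eta d n) ρ)) atTop (𝓝 (KL k ρ)) :=
  ((Ent_tendsto h).const_sub (Ent k)).sub (logR_tendsto h hk)

lemma KL_self (k : Ed d → ℝ) : KL k k = 0 := by simp [KL]

lemma KL_tendsto' (h : Nice c₀ a₁ C₀ a₂ ρ) : Tendsto (fun n => KL (mol (eta d n) ρ) ρ) atTop (𝓝 0) := by
  have h1 := R_tendsto h h.PBlog1 h.meas.log
  have h2 := ((Ent_tendsto h).sub_const (Ent ρ)).sub (h1.sub_const (∫ x, log (ρ x) * ρ x))
  simp only [sub_self] at h2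
  refine h2.congr fun n => ?_
  rw [KL]
  congr 1
  rw [← integral_sub (bR_integ h h.PBlog1 h.meas.log n) (bρ_integ h h.PBlog1 h.meas.log)]
  congr 1; ext x; ring

lemma UnR_tendsto (h : Nice c₀ a₁ C₀ a₂ ρ) {V : ℕ → Ed d → ℝ} (hV : ∀ n, Pot α L (V n)) :
    Tendsto (fun n => ∫ x, V n x * (ρ x - mol (eta d n) ρ x)) atTop (𝓝 0) := by
  have hP : PB (fun (n : ℕ) x => V n x) := (Pot.PB (d := d) α L).comp (fun n : ℕ => ⟨V n, hV n⟩)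
  have hg : GB (fun (n : ℕ) x => V n x * (ρ x - mol (eta d n) ρ x)) :=
    hP.mul_GB ((h.GB1.comp (fun _ : ℕ => ())).sub (R_GB h))
  have := hg.tendsto (l := atTop) (f := fun _ => 0) (Eventually.of_forall fun n => ?_) ?_
  · simpa using this
  · exact ((hV n).meas.mul (h.meas.sub (nice_mol h n).meas)).aestronglyMeasurable
  filter_upwards [R_ae h] with x hx
  have h1 : Tendsto (fun n => ρ x - mol (eta d n) ρ x) atTop (𝓝 0) := by simpa using hx.const_sub (ρ x)
  refine isBoundedUnder_le_mul_tendsto_zero ?_ h1 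
  refine ⟨(|α| + |L|) * (1 + ‖x‖^2), ?_⟩
  simp only [eventually_map, Function.comp, Real.norm_eq_abs]
  exact Eventually.of_forall fun n => (hV n).le x

lemma G_tendsto (hS : Setup G G' α L) (hτ : 0 < τ) (hc : ConvexFun (obj G τ)) (h : Nice c₀ a₁ C₀ a₂ ρ) :
    Tendsto (fun n => G (mu (mol (eta d n) ρ))) atTop (𝓝 (G (mu ρ))) := by
  have hP : ∀ n, Pot α L (G' (mu (mol (eta d n) ρ))) := fun n => (hS _ (nice_mol h n).dens.isP2).2
  have hP0 : Pot α L (G' (mu ρ)) := (hS _ h.dens.isP2).2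
  have lo : Tendsto (fun n => G (mu ρ) + (∫ x, G' (mu ρ) x * (mol (eta d n) ρ x - ρ x)) - τ * KL (mol (eta d n) ρ) ρ) atTop (𝓝 (G (mu ρ))) := by
    have h1 := UnR_tendsto h (fun _ => hP0)
    have h2 := (h1.neg.const_add (G (mu ρ))).sub ((KL_tendsto' h).const_mul τ)
    simp only [neg_zero, add_zero, mul_zero, sub_zero] at h2
    refine h2.congr fun n => ?_
    rw [← integral_neg]
    congr 3; ext x; ring
  have up : Tendsto (fun n => G (mu ρ) - (∫ x, G' (mu (mol (eta d n) ρ)) x * (ρ x - mol (eta d n) ρ x)) + τ * KL ρ (mol (eta d n) ρ)) atTop (𝓝 (G (mu ρ))) := by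
    have h2 := ((UnR_tendsto h hP).const_sub (G (mu ρ))).add ((KL_tendsto h h).const_mul τ)
    simpa [KL_self] using h2
  refine tendsto_of_tendsto_of_tendsto_of_le_of_le lo up (fun n => ?_) (fun n => ?_)
  · exact G_ineq hS hτ.le hc h (nice_mol h n).dens
  · have := G_ineq hS hτ.le hc (nice_mol h n) h.dens
    simp only; linarith

lemma Fr_tendsto (hS : Setup G G' α L) (hτ : 0 < τ) (hc : ConvexFun (obj G τ)) (h : Nice c₀ a₁ C₀ a₂ ρ) :
    Tendsto (fun n => Fr G τ (mol (eta d n) ρ)) atTop (𝓝 (Fr G τ ρ)) :=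
  (G_tendsto hS hτ hc h).add ((Ent_tendsto h).const_mul τ)

lemma Nice.weaken {c₀' C₀' : ℝ} (h : Nice c₀ a₁ C₀ a₂ ρ) (h1 : 0 < c₀') (h2 : c₀' ≤ c₀) (h3 : C₀ ≤ C₀') : Nice c₀' a₁ C₀' a₂ ρ where
  c₀pos := h1
  a₁pos := h.a₁pos
  C₀pos := h.C₀pos.trans_le h3
  a₂pos := h.a₂pos
  meas := h.meas
  int1 := h.int1
  lb x := le_trans (by gcongr) (h.lb x)
  ub x := (h.ub x).trans (by gcongr)

lemma nice_pert (h : Nice c₀ a₁ C₀ a₂ ρ) {ζ : Ed d → ℝ} (hm : Measurable ζ) (hi : Integrable ζ) (h0 : ∫ x, ζ x = 0)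
    (hb : ∀ x, |ζ x| ≤ ρ x / 2) {s : ℝ} (hs : 0 ≤ s) (hs1 : s ≤ 1) : Nice (c₀/2) a₁ (2*C₀) a₂ (fun x => ρ x + s * ζ x) where
  c₀pos := by have := h.c₀pos; positivity
  a₁pos := h.a₁pos
  C₀pos := by have := h.C₀pos; positivity
  a₂pos := h.a₂pos
  meas := h.meas.add (hm.const_mul s)
  int1 := by
    rw [integral_add h.dens.integ (hi.const_mul s), integral_const_mul, h0, h.int1]; simp
  lb x := by
    have h1 := h.lb x
    have h2 := abs_le.1 (hb x)
    have h3 := h.pos x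
    nlinarith
  ub x := by
    have h1 := h.ub x
    have h2 := abs_le.1 (hb x)
    have h3 := h.pos x
    nlinarith

lemma KL_pert (h : Nice c₀ a₁ C₀ a₂ ρ) {ζ : Ed d → ℝ} (hm : Measurable ζ) (hi : Integrable ζ) (h0 : ∫ x, ζ x = 0)
    (hb : ∀ x, |ζ x| ≤ ρ x / 2) {s : ℝ} (hs : 0 ≤ s) (hs1 : s ≤ 1) : KL (fun x => ρ x + s * ζ x) ρ ≤ s^2 * ∫ x, |ζ x| := by
  have hk := nice_pert h hm hi h0 hb hs hs1
  rw [kl_eq h hk.dens, ← integral_const_mul]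
  refine integral_mono (kl_integrable h hk.dens) (hi.abs.const_mul _) fun x => ?_
  refine (kld_le (h.pos x) (hk.pos x)).trans ?_
  have h3 := h.pos x
  rw [div_le_iff₀ h3]
  have : (ρ x + s * ζ x - ρ x)^2 = s^2 * (|ζ x| * |ζ x|) := by rw [abs_mul_abs_self]; ring
  rw [this, mul_assoc]
  have := hb x
  gcongr
  linarith

lemma weak_le (hS : Setup G G' α L) (hτ : 0 < τ) (hc : ConvexFun (obj G τ)) (h : Nice c₀ a₁ C₀ a₂ ρ)
    {ζ : Ed d → ℝ} (hm : Measurable ζ) (hi : Integrable ζ) (h0 : ∫ x, ζ x = 0) (hb : ∀ x, |ζ x| ≤ ρ x / 2) {ε : ℝ} (hε : 0 < ε) :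
    ∀ᶠ n in atTop, ∫ x, G' (mu (mol (eta d n) ρ)) x * ζ x < (∫ x, G' (mu ρ) x * ζ x) + ε := by
  have hP : ∀ n, Pot α L (G' (mu (mol (eta d n) ρ))) := fun n => (hS _ (nice_mol h n).dens.isP2).2
  have hP0 : Pot α L (G' (mu ρ)) := (hS _ h.dens.isP2).2
  have hgb : GB (fun (_ : Unit) => ζ) := h.GB1.mono fun _ x => by
    have := hb x; have h3 := h.pos x; simp only [abs_of_pos h3]; linarith
  have Vint : ∀ V, Pot α L V → Integrable (fun x => V x * ζ x) := fun V hV => 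
    (hV.PB1.mul_GB hgb).integrable () (hV.meas.mul hm).aestronglyMeasurable
  have hk1 := nice_pert h hm hi h0 hb zero_le_one le_rfl
  -- derivative
  have hd := (hS _ h.dens.isP2).1 _ hk1.dens.isP2
  rw [← hasDerivWithinAt_Ioi_iff_Ici, hasDerivWithinAt_iff_tendsto_slope' (by simp)] at hd
  have e1 : (∫ x, G' (mu ρ) x ∂mu fun x => ρ x + 1 * ζ x) - ∫ x, G' (mu ρ) x ∂mu ρ = ∫ x, G' (mu ρ) x * ζ x := by
    have i1 : Integrable (fun x => G' (mu ρ) x * ρ x) := bρ_integ h hP0.PB1 hP0.meas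
    rw [integral_mu hk1.meas (fun x => (hk1.pos x).le), integral_mu h.meas (fun x => (h.pos x).le)]
    have i2 : Integrable (fun x => G' (mu ρ) x * (ρ x + 1 * ζ x)) := by
      refine (i1.add (Vint _ hP0)).congr (ae_of_all _ fun x => ?_)
      simp only [Pi.add_apply]; ring
    rw [← integral_sub i2 i1]
    congr 1; ext x; ring
  rw [e1] at hd
  have hKs : Tendsto (fun s : ℝ => τ * (s * ∫ x, |ζ x|)) (𝓝[>] 0) (𝓝 0) := by
    have : Continuous (fun s : ℝ => τ * (s * ∫ x, |ζ x|)) := by fun_prop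
    have := this.tendsto 0
    simp only [zero_mul, mul_zero] at this
    exact this.mono_left nhdsWithin_le_nhds
  have hsum := hd.add hKs
  rw [add_zero] at hsum
  have ev := hsum.eventually (gt_mem_nhds (show ∫ x, G' (mu ρ) x * ζ x < (∫ x, G' (mu ρ) x * ζ x) + ε by linarith))
  have ev2 : ∀ᶠ s : ℝ in 𝓝[>] 0, s ∈ Ioc (0:ℝ) 1 := Ioc_mem_nhdsGT zero_lt_one
  obtain ⟨s, hs, hs0, hs1⟩ := (ev.and ev2).exists
  have hk := nice_pert h hm hi h0 hb hs0.le hs1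
  have e2 : mix s (mu ρ) (mu fun x => ρ x + 1 * ζ x) = mu (fun x => ρ x + s * ζ x) := by
    rw [mix_mu h.meas hk1.meas (fun x => (h.pos x).le) (fun x => (hk1.pos x).le) hs0.le hs1]
    congr 1; ext x; ring
  have e3 : mix 0 (mu ρ) (mu fun x => ρ x + 1 * ζ x) = mu ρ := by
    rw [mix_mu h.meas hk1.meas (fun x => (h.pos x).le) (fun x => (hk1.pos x).le) le_rfl zero_le_one]
    congr 1; ext x; ring
  rw [slope_def_field, e2, e3, sub_zero] at hs
  have hw : Nice (c₀/2) a₁ (2*C₀) a₂ ρ := h.weaken (by have := h.c₀pos; positivity) (by linarith [h.c₀pos]) (by linarith [h.C₀pos])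
  have hKL := KL_pert h hm hi h0 hb hs0.le hs1
  have lim : Tendsto (fun n => G (mu (fun x => ρ x + s * ζ x)) - G (mu (mol (eta d n) ρ)) + τ * KL (fun x => ρ x + s * ζ x) (mol (eta d n) ρ)
      - ∫ x, G' (mu (mol (eta d n) ρ)) x * (ρ x - mol (eta d n) ρ x)) atTop
      (𝓝 (G (mu (fun x => ρ x + s * ζ x)) - G (mu ρ) + τ * KL (fun x => ρ x + s * ζ x) ρ - 0)) :=
    (((G_tendsto hS hτ hc h).const_sub _).add ((KL_tendsto hw hk).const_mul τ)).sub (UnR_tendsto h hP)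
  have lt : G (mu (fun x => ρ x + s * ζ x)) - G (mu ρ) + τ * KL (fun x => ρ x + s * ζ x) ρ - 0 < s * ((∫ x, G' (mu ρ) x * ζ x) + ε) := by
    have h1 := mul_lt_mul_of_pos_left hs hs0
    have h2 : s * ((G (mu (fun x => ρ x + s * ζ x)) - G (mu ρ)) / s) = G (mu (fun x => ρ x + s * ζ x)) - G (mu ρ) := by field_simp
    rw [mul_add, h2] at h1
    have h3 := mul_le_mul_of_nonneg_left hKL hτ.le
    nlinarith
  filter_upwards [lim.eventually (gt_mem_nhds lt)] with n hn
  have hg := G_ineq hS hτ.le hc (nice_mol h n) hk.dens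
  have i1 : Integrable (fun x => G' (mu (mol (eta d n) ρ)) x * (ρ x - mol (eta d n) ρ x)) := by
    refine ((bρ_integ h (hP n).PB1 (hP n).meas).sub (bR_integ h (hP n).PB1 (hP n).meas n)).congr (ae_of_all _ fun x => ?_)
    simp only [Pi.sub_apply]; ring
  have e4 : ∫ x, G' (mu (mol (eta d n) ρ)) x * (ρ x + s * ζ x - mol (eta d n) ρ x) = 
      (∫ x, G' (mu (mol (eta d n) ρ)) x * (ρ x - mol (eta d n) ρ x)) + s * ∫ x, G' (mu (mol (eta d n) ρ)) x * ζ x := by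
    rw [← integral_const_mul, ← integral_add i1 ((Vint _ (hP n)).const_mul s)]
    congr 1; ext x; ring
  rw [e4] at hg
  have : s * (∫ x, G' (mu (mol (eta d n) ρ)) x * ζ x) < s * ((∫ x, G' (mu ρ) x * ζ x) + ε) := by linarith
  exact lt_of_mul_lt_mul_left this hs0.le

lemma weak_tendsto0 (hS : Setup G G' α L) (hτ : 0 < τ) (hc : ConvexFun (obj G τ)) (h : Nice c₀ a₁ C₀ a₂ ρ)
    {ζ : Ed d → ℝ} (hm : Measurable ζ) (hi : Integrable ζ) (h0 : ∫ x, ζ x = 0) (hb : ∀ x, |ζ x| ≤ ρ x / 2) :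
    Tendsto (fun n => ∫ x, G' (mu (mol (eta d n) ρ)) x * ζ x) atTop (𝓝 (∫ x, G' (mu ρ) x * ζ x)) := by
  rw [Metric.tendsto_nhds]
  intro ε hε
  have h1 := weak_le hS hτ hc h hm hi h0 hb hε
  have h2 := weak_le hS hτ hc h (ζ := fun x => - ζ x) hm.neg hi.neg (by rw [integral_neg, h0, neg_zero]) (fun x => by rw [abs_neg]; exact hb x) hε
  filter_upwards [h1, h2] with n k1 k2
  simp only [mul_neg, integral_neg] at k2
  rw [Real.dist_eq, abs_lt]
  constructor <;> linarith

lemma weak_tendsto (hS : Setup G G' α L) (hτ : 0 < τ) (hc : ConvexFun (obj G τ)) (h : Nice c₀ a₁ C₀ a₂ ρ)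
    {ζ : Ed d → ℝ} (hm : Continuous ζ) (hcs : HasCompactSupport ζ) (h0 : ∫ x, ζ x = 0) :
    Tendsto (fun n => ∫ x, G' (mu (mol (eta d n) ρ)) x * ζ x) atTop (𝓝 (∫ x, G' (mu ρ) x * ζ x)) := by
  have hcont : Continuous (fun x : Ed d => ζ x * exp (a₁ * ‖x‖^2)) := by fun_prop
  obtain ⟨C, hC⟩ := (hcs.mul_right (f' := fun x : Ed d => exp (a₁ * ‖x‖^2))).exists_bound_of_continuous hcont
  have c0 := h.c₀pos
  set s := (c₀ / 2) / (|C| + 1) with hs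
  have hspos : 0 < s := by positivity
  have hb : ∀ x, |s * ζ x| ≤ ρ x / 2 := fun x => by
    have h1 : |ζ x| ≤ (|C| + 1) * exp (-a₁ * ‖x‖^2) := by
      have := hC x
      simp only [Pi.mul_apply] at this
      rw [norm_mul, Real.norm_eq_abs, Real.norm_eq_abs, abs_of_pos (exp_pos _)] at this
      have e : |ζ x| = (|ζ x| * exp (a₁ * ‖x‖^2)) * exp (-a₁ * ‖x‖^2) := by
        rw [mul_assoc, ← exp_add]; simp
      rw [e]
      gcongr
      linarith [le_abs_self C]
    have h2 := h.lb x
    rw [abs_mul, abs_of_pos hspos]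
    calc s * |ζ x| ≤ s * ((|C| + 1) * exp (-a₁ * ‖x‖^2)) := by gcongr
      _ = c₀ * exp (-a₁ * ‖x‖^2) / 2 := by rw [hs]; field_simp
      _ ≤ _ := by linarith
  have := weak_tendsto0 hS hτ hc h (ζ := fun x => s * ζ x) (hm.measurable.const_mul s) ((hm.integrable_of_hasCompactSupport hcs).const_mul s)
    (by rw [integral_const_mul, h0, mul_zero]) hb
  have := this.const_mul s⁻¹
  simp only [← integral_const_mul] at this
  have e : ∀ f : Ed d → ℝ, ∫ x, s⁻¹ * (f x * (s * ζ x)) = ∫ x, f x * ζ x := fun f => by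
    congr 1; ext x; field_simp
  simpa only [e] using this

end

section

open scoped ContDiff
variable {d : ℕ} {c₀ a₁ C₀ a₂ α L τ : ℝ} {G : Measure (Ed d) → ℝ} {G' : Measure (Ed d) → Ed d → ℝ} {ρ k : Ed d → ℝ}

lemma GB_of_compact {φ : Ed d → ℝ} (h1 : Continuous φ) (h2 : HasCompactSupport φ) : GB (fun (_ : Unit) => φ) := by
  have hcont : Continuous (fun x : Ed d => φ x * exp (1 * ‖x‖^2)) := by fun_prop
  obtain ⟨C, hC⟩ := (h2.mul_right (f' := fun x : Ed d => exp (1 * ‖x‖^2))).exists_bound_of_continuous hcont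
  refine ⟨|C|, 1, abs_nonneg _, one_pos, fun _ x => ?_⟩
  have := hC x
  simp only [Pi.mul_apply] at this
  rw [norm_mul, Real.norm_eq_abs, Real.norm_eq_abs, abs_of_pos (exp_pos _)] at this
  have e : |φ x| = (|φ x| * exp (1 * ‖x‖^2)) * exp (-1 * ‖x‖^2) := by
    rw [mul_assoc, ← exp_add]; simp
  rw [e]
  gcongr
  linarith [le_abs_self C]

lemma exists_CS_L1 {J : Ed d → ℝ} (hJ : Integrable J) {ε : ℝ} (hε : 0 < ε) :
    ∃ ξ : Ed d → ℝ, ContDiff ℝ ∞ ξ ∧ HasCompactSupport ξ ∧ ∫ x, |J x - ξ x| ≤ ε := by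
  obtain ⟨ξ, h1, h2, h3⟩ := MemLp.exist_eLpNorm_sub_le (p := 1) (by simp) le_rfl (memLp_one_iff_integrable.2 hJ) hε
  refine ⟨ξ, h2, h1, ?_⟩
  have hi : Integrable ξ := h2.continuous.integrable_of_hasCompactSupport h1
  have := integral_norm_eq_lintegral_enorm (hJ.sub hi).aestronglyMeasurable
  simp only [Pi.sub_apply, Real.norm_eq_abs] at this
  rw [this]
  rw [eLpNorm_one_eq_lintegral_enorm] at h3
  exact ENNReal.toReal_le_of_le_ofReal hε.le h3

lemma abs_int_le {v g : Ed d → ℝ} {B : ℝ} (hv : ∀ x, |v x| ≤ B) (hg : Integrable g) : |∫ x, v x * g x| ≤ B * ∫ x, |g x| := by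
  rw [← integral_const_mul]
  refine (abs_integral_le_integral_abs).trans ?_
  refine integral_mono_of_nonneg (ae_of_all _ fun x => abs_nonneg _) (hg.abs.const_mul B) (ae_of_all _ fun x => ?_)
  simp only [abs_mul]
  exact mul_le_mul_of_nonneg_right (hv x) (abs_nonneg _)

lemma weak_mol {v : ℕ → Ed d → ℝ} {B : ℝ} (hc : ∀ n, Continuous (v n)) (hv : ∀ n x, |v n x| ≤ B)
    (hw : ∀ ξ : Ed d → ℝ, ContDiff ℝ ∞ ξ → HasCompactSupport ξ → Tendsto (fun n => ∫ x, v n x * ξ x) atTop (𝓝 0))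
    {J : Ed d → ℝ} (hJ : Integrable J) : Tendsto (fun n => ∫ x, v n x * mol (eta d n) J x) atTop (𝓝 0) := by
  have hB : 0 ≤ B := (abs_nonneg _).trans (hv 0 0)
  rw [Metric.tendsto_nhds]
  intro ε hε
  obtain ⟨ξ, h1, h2, h3⟩ := exists_CS_L1 hJ (ε := ε / (2 * (B + 1))) (by positivity)
  have hξ : Integrable ξ := h1.continuous.integrable_of_hasCompactSupport h2
  have hgb := GB_of_compact h1.continuous h2
  have hmd : GB (fun (n : ℕ) x => |mol (eta d n) ξ x - ξ x|) :=
    (((mol_eta_GB hgb).comp (fun n : ℕ => (n, ()))).sub (hgb.comp (fun _ : ℕ => ()))).abs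
  have hmi : ∀ n, Integrable (mol (eta d n) ξ) := fun n => mol_integrable (eta_ker d n) hξ
  have hmj : ∀ n, Integrable (mol (eta d n) J) := fun n => mol_integrable (eta_ker d n) hJ
  have t1 : Tendsto (fun n => ∫ x, |mol (eta d n) ξ x - ξ x|) atTop (𝓝 (∫ x : Ed d, (0:ℝ))) := by
    refine hmd.tendsto (Eventually.of_forall fun n => ((hmi n).sub hξ).abs.aestronglyMeasurable) (ae_of_all _ fun x => ?_)
    have := ((mol_tendsto_cont h1.continuous x).sub_const (ξ x)).abs
    simpa using this
  simp only [integral_zero] at t1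
  have t2 := (t1.const_mul B).add (hw ξ h1 h2).abs
  simp only [mul_zero, abs_zero, add_zero] at t2
  filter_upwards [t2.eventually (gt_mem_nhds (half_pos hε))] with n hn
  have j1 : Integrable (fun x => v n x * mol (eta d n) (fun y => J y - ξ y) x) :=
    (mol_integrable (eta_ker d n) (hJ.sub hξ)).bdd_mul (hc n).aestronglyMeasurable (ae_of_all _ (hv n))
  have j2 : Integrable (fun x => v n x * (mol (eta d n) ξ x - ξ x)) :=
    ((hmi n).sub hξ).bdd_mul (hc n).aestronglyMeasurable (ae_of_all _ (hv n))
  have j3 : Integrable (fun x => v n x * ξ x) := hξ.bdd_mul (hc n).aestronglyMeasurable (ae_of_all _ (hv n))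
  have j12 : Integrable (fun x => v n x * mol (eta d n) (fun y => J y - ξ y) x + v n x * (mol (eta d n) ξ x - ξ x)) := j1.add j2
  have e : ∫ x, v n x * mol (eta d n) J x = (∫ x, v n x * mol (eta d n) (fun y => J y - ξ y) x) + (∫ x, v n x * (mol (eta d n) ξ x - ξ x))
      + ∫ x, v n x * ξ x := by
    rw [← integral_add j1 j2, ← integral_add j12 j3]
    congr 1; ext x
    rw [mol_sub (eta_ker d n) hJ.locallyIntegrable hξ.locallyIntegrable]; ring
  have b1 := (abs_int_le (hv n) (mol_integrable (eta_ker d n) (hJ.sub hξ))).trans (mul_le_mul_of_nonneg_left (mol_L1 n (hJ.sub hξ)) hB)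
  have b2 := abs_int_le (hv n) ((hmi n).sub hξ)
  simp only [Pi.sub_apply] at b1 b2
  have b3 : B * ∫ x, |J x - ξ x| ≤ ε / 2 := by
    refine (mul_le_mul_of_nonneg_left h3 hB).trans ?_
    rw [mul_div_assoc', div_le_div_iff₀ (by positivity) (by positivity)]
    nlinarith
  rw [Real.dist_eq, sub_zero, e]
  have b4 : |∫ x, v n x * mol (eta d n) (fun y => J y - ξ y) x| ≤ B * ∫ x, |J x - ξ x| := b1
  calc _ ≤ |∫ x, v n x * mol (eta d n) (fun y => J y - ξ y) x| + |∫ x, v n x * (mol (eta d n) ξ x - ξ x)| + |∫ x, v n x * ξ x| := abs_add_three _ _ _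
    _ < ε := by linarith

lemma parts_U {U ξ : Ed d → ℝ} (hU : Pot α L U) (hξ : ContDiff ℝ ∞ ξ) (hc : HasCompactSupport ξ) (i : Fin d) :
    ∫ x, pd i U x * ξ x = - ∫ x, U x * pd i ξ x := by
  have i1 : Integrable (fun x => U x * pd i ξ x) :=
    (hU.smooth.continuous.mul (contDiff_pd hξ i).continuous).integrable_of_hasCompactSupport (pd_compact hc i).mul_left
  have i2 : Integrable (fun x => pd i U x * ξ x) :=
    ((hU.cont_pd i).mul hξ.continuous).integrable_of_hasCompactSupport hc.mul_left
  have i3 : Integrable (fun x => U x * ξ x) :=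
    (hU.smooth.continuous.mul hξ.continuous).integrable_of_hasCompactSupport hc.mul_left
  have := integral_mul_fderiv_eq_neg_fderiv_mul_of_integrable (μ := (volume : Measure (Ed d))) (f := U) (g := ξ)
    (v := EuclideanSpace.single i 1) i2 i1 i3 (fun x _ => hU.hasFD x) (fun x _ => hξ.differentiable (by simp) x)
  have h2 : (∫ x, U x * pd i ξ x) = - ∫ x, pd i U x * ξ x := this
  rw [h2, neg_neg]

lemma int_pd_zero {ξ : Ed d → ℝ} (hξ : ContDiff ℝ ∞ ξ) (hc : HasCompactSupport ξ) (i : Fin d) : ∫ x, pd i ξ x = 0 := by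
  have i1 : Integrable (fun x => pd i ξ x) :=
    (contDiff_pd hξ i).continuous.integrable_of_hasCompactSupport (pd_compact hc i)
  have i3 : Integrable ξ := hξ.continuous.integrable_of_hasCompactSupport hc
  have := integral_mul_fderiv_eq_neg_fderiv_mul_of_integrable (μ := (volume : Measure (Ed d))) (f := fun _ => (1:ℝ)) (g := ξ)
    (v := EuclideanSpace.single i 1) (by simp) (by simp only [one_mul]; exact i1) (by simpa using i3) (fun x _ => by fun_prop) (fun x _ => hξ.differentiable (by simp) x)
  simp only [one_mul] at this
  refine (show _ = _ from this).trans ?_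
  simp

lemma err_tendsto (hS : Setup G G' α L) (hτ : 0 < τ) (hc : ConvexFun (obj G τ)) (h : Nice c₀ a₁ C₀ a₂ ρ) (i : Fin d)
    {J : Ed d → ℝ} (hJ : Integrable J) : 
    Tendsto (fun n => ∫ x, (pd i (G' (mu (mol (eta d n) ρ))) x - pd i (G' (mu ρ)) x) * mol (eta d n) J x) atTop (𝓝 0) := by
  have hP : ∀ n, Pot α L (G' (mu (mol (eta d n) ρ))) := fun n => (hS _ (nice_mol h n).dens.isP2).2
  have hP0 : Pot α L (G' (mu ρ)) := (hS _ h.dens.isP2).2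
  refine weak_mol (v := fun n x => pd i (G' (mu (mol (eta d n) ρ))) x - pd i (G' (mu ρ)) x) (B := 2 * L) (fun n => ((hP n).cont_pd i).sub (hP0.cont_pd i)) (fun n x => ?_) (fun ξ h1 h2 => ?_) hJ
  · have a1 := abs_le.1 ((hP n).grad i x)
    have a2 := abs_le.1 (hP0.grad i x)
    rw [abs_le]; constructor <;> linarith
  · have hw := weak_tendsto hS hτ hc h (contDiff_pd h1 i).continuous (pd_compact h2 i) (int_pd_zero h1 h2 i)
    have := (hw.sub_const (∫ x, G' (mu ρ) x * pd i ξ x)).neg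
    simp only [sub_self, neg_zero] at this
    refine this.congr fun n => ?_
    have k : ∀ V, Pot α L V → Integrable (fun x => pd i V x * ξ x) := fun V hV =>
      ((hV.cont_pd i).mul h1.continuous).integrable_of_hasCompactSupport h2.mul_left
    have e : ∫ x, (pd i (G' (mu (mol (eta d n) ρ))) x - pd i (G' (mu ρ)) x) * ξ x = 
        (∫ x, pd i (G' (mu (mol (eta d n) ρ))) x * ξ x) - ∫ x, pd i (G' (mu ρ)) x * ξ x := by
      rw [← integral_sub (k _ (hP n)) (k _ hP0)]
      congr 1; ext x; ring
    rw [e, parts_U (hP n) h1 h2, parts_U hP0 h1 h2]; ring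

lemma Fi_nonneg (h : Nice c₀ a₁ C₀ a₂ ρ) (n : ℕ) (i : Fin d) : 0 ≤ Fi τ ρ n i :=
  integral_nonneg fun x => mul_nonneg (sq_nonneg _) ((nice_mol h n).pos x).le

lemma Cp_nonneg (a : ℝ) : 0 ≤ Cp d a :=
  mul_nonneg (by positivity) (integral_nonneg fun x => mul_nonneg (sq_nonneg _) (wg_pos a x).le)

lemma fn_PB {U : Ed d → ℝ} (h : Nice c₀ a₁ C₀ a₂ ρ) (hU : Pot α L U) (τ : ℝ) : PB (fun (n : ℕ) x => U x + τ * log (mol (eta d n) ρ x)) :=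
  (hU.PB1.comp (fun _ : ℕ => ())).add ((R_PBlog h).const_mul τ)

lemma fn_cont {U : Ed d → ℝ} (h : Nice c₀ a₁ C₀ a₂ ρ) (hU : Pot α L U) (τ : ℝ) (n : ℕ) : ContDiff ℝ 1 (fun x => U x + τ * log (mol (eta d n) ρ x)) :=
  hU.smooth.add (contDiff_const.mul (((R_smooth h n).of_le (by simp)).log fun x => ((nice_mol h n).pos x).ne'))

lemma var_tendsto {U : Ed d → ℝ} (h : Nice c₀ a₁ C₀ a₂ ρ) (hU : Pot α L U) (τ : ℝ) {a : ℝ} (ha : 0 < a) :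
    Tendsto (fun n => var a (fun x => U x + τ * log (mol (eta d n) ρ x))) atTop (𝓝 (var a (fun x => U x + τ * log (ρ x)))) := by
  have hP := fn_PB h hU τ
  have hg : GB (fun (_ : ℕ) x => wg d a x) := GB.gauss ha
  have lim : ∀ᵐ x, Tendsto (fun n => U x + τ * log (mol (eta d n) ρ x)) atTop (𝓝 (U x + τ * log (ρ x))) := by
    filter_upwards [R_ae h] with x hx
    exact ((hx.log (h.pos x).ne').const_mul τ).const_add _
  have t1 := (hP.mul_GB hg).tendsto (l := atTop) (f := fun x => (U x + τ * log (ρ x)) * wg d a x)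
    (Eventually.of_forall fun n => ((fn_cont h hU τ n).continuous.mul (wg_cont a)).aestronglyMeasurable)
    (by filter_upwards [lim] with x hx; exact hx.mul_const _)
  have t2 := (hP.sq.mul_GB hg).tendsto (l := atTop) (f := fun x => (U x + τ * log (ρ x))^2 * wg d a x)
    (Eventually.of_forall fun n => (((fn_cont h hU τ n).continuous.pow 2).mul (wg_cont a)).aestronglyMeasurable)
    (by filter_upwards [lim] with x hx; exact (hx.pow 2).mul_const _)
  exact (t2.const_mul _).sub (t1.pow 2)

lemma fn_poincare {U : Ed d → ℝ} (h : Nice c₀ a₁ C₀ a₂ ρ) (hU : Pot α L U) (n : ℕ) :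
    c₀ * exp (-a₁) * var a₁ (fun x => U x + τ * log (mol (eta d n) ρ x)) ≤ 
      Cp d a₁ * ∑ i, ∫ x, (pd i U x + Sc τ ρ n i x)^2 * mol (eta d n) ρ x := by
  have hc := fn_cont h hU τ n
  have hP := fn_PB h hU τ
  have hg : GB (fun (_ : ℕ) x => wg d a₁ x) := GB.gauss h.a₁pos
  have c0 := h.c₀pos
  have hR := nice_mol h n
  have ptw : ∀ i x, (pd i U x + Sc τ ρ n i x)^2 * wg d a₁ x ≤ (c₀ * exp (-a₁))⁻¹ * ((pd i U x + Sc τ ρ n i x)^2 * mol (eta d n) ρ x) := fun i x => by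
    have h1 := hR.lb x
    have h2 : wg d a₁ x ≤ (c₀ * exp (-a₁))⁻¹ * mol (eta d n) ρ x := by
      rw [inv_mul_eq_div, le_div_iff₀ (by positivity), mul_comm]; exact h1
    calc _ ≤ (pd i U x + Sc τ ρ n i x)^2 * ((c₀ * exp (-a₁))⁻¹ * mol (eta d n) ρ x) := by gcongr
      _ = _ := by ring
  have iv : ∀ i, Integrable (fun x => (pd i U x + Sc τ ρ n i x)^2 * wg d a₁ x) := fun i => by
    refine ((vsq_integ (τ := τ) h hU n i).const_mul (c₀ * exp (-a₁))⁻¹).mono' ?_ (ae_of_all _ fun x => ?_)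
    · exact ((((hU.cont_pd i).add (Sc_cont h n i)).pow 2).mul (wg_cont a₁)).aestronglyMeasurable
    · rw [Real.norm_eq_abs, abs_of_nonneg (mul_nonneg (sq_nonneg _) (wg_pos _ _).le)]
      exact ptw i x
  have e : ∀ x, (∑ i, pd i (fun x => U x + τ * log (mol (eta d n) ρ x)) x ^ 2) * wg d a₁ x = ∑ i, (pd i U x + Sc τ ρ n i x)^2 * wg d a₁ x := fun x => by
    rw [Finset.sum_mul]
    exact Finset.sum_congr rfl fun i _ => by rw [pdV_R' h hU]
  have pc := poincare hc h.a₁pos ((hP.mul_GB hg).integrable n (hc.continuous.mul (wg_cont a₁)).aestronglyMeasurable)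
    ((hP.sq.mul_GB hg).integrable n ((hc.continuous.pow 2).mul (wg_cont a₁)).aestronglyMeasurable)
    (by simp only [e]; exact integrable_finsetSum _ fun i _ => iv i)
  simp only [e] at pc
  rw [integral_finsetSum _ fun i _ => iv i] at pc
  have le : ∑ i, ∫ x, (pd i U x + Sc τ ρ n i x)^2 * wg d a₁ x ≤ (c₀ * exp (-a₁))⁻¹ * ∑ i, ∫ x, (pd i U x + Sc τ ρ n i x)^2 * mol (eta d n) ρ x := by
    rw [Finset.mul_sum]
    refine Finset.sum_le_sum fun i _ => ?_
    rw [← integral_const_mul]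
    exact integral_mono (iv i) ((vsq_integ h hU n i).const_mul _) (ptw i)
  calc _ ≤ c₀ * exp (-a₁) * (Cp d a₁ * ((c₀ * exp (-a₁))⁻¹ * ∑ i, ∫ x, (pd i U x + Sc τ ρ n i x)^2 * mol (eta d n) ρ x)) := by
        gcongr
        exact pc.trans (mul_le_mul_of_nonneg_left le (Cp_nonneg _))
    _ = _ := by field_simp

theorem diss_lower (hS : Setup G G' α L) (hτ : 0 < τ) (hc : ConvexFun (obj G τ)) (h : Nice c₀ a₁ C₀ a₂ ρ) {l : ℝ}
    (hf : ∃ᶠ n in atTop, ∑ i, Qi τ ρ (G' (mu ρ)) (G' (mu (mol (eta d n) ρ))) n i ≤ l) :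
    c₀ * exp (-a₁) * var a₁ (fun x => G' (mu ρ) x + τ * log (ρ x)) ≤ 2 * Cp d a₁ * l := by
  have hP : ∀ n, Pot α L (G' (mu (mol (eta d n) ρ))) := fun n => (hS _ (nice_mol h n).dens.isP2).2
  have hP0 : Pot α L (G' (mu ρ)) := (hS _ h.dens.isP2).2
  choose C' hC0 hC using fun i : Fin d => Qi_ge (d := d) c₀ a₁ C₀ a₂ α L τ i
  have hA : ∀ i, ∃ᶠ n in atTop, Fi τ ρ n i ≤ 2 * (l + ∑ j, C' j) := fun i => hf.mono fun n hn => by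
    have h1 : ∀ j, 0 ≤ Qi τ ρ (G' (mu ρ)) (G' (mu (mol (eta d n) ρ))) n j + C' j := fun j => by
      have := hC j ρ _ _ h hP0 (hP n) n
      have := Fi_nonneg (τ := τ) h n j
      linarith
    have h2 := Finset.single_le_sum (f := fun j => Qi τ ρ (G' (mu ρ)) (G' (mu (mol (eta d n) ρ))) n j + C' j) (fun j _ => h1 j) (Finset.mem_univ i)
    rw [Finset.sum_add_distrib] at h2
    have := hC i ρ _ _ h hP0 (hP n) n
    linarith
  choose J hJ hJ' using fun i => Phi_mol h hP0 hτ i (hA i)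
  have er : ∀ i, Tendsto (fun n => ∫ x, (pd i (G' (mu (mol (eta d n) ρ))) x - pd i (G' (mu ρ)) x) * Phi τ ρ (G' (mu ρ)) n i x) atTop (𝓝 0) := fun i => by
    simp only [hJ']
    exact err_tendsto hS hτ hc h i (hJ i)
  have hH : ∀ i, Tendsto (fun n => ∫ x, Hn ρ (pd i (G' (mu ρ))) n x) atTop (𝓝 0) := fun i => Hn_tendsto h (hP0.PBpd1 i) (hP0.cont_pd i)
  have t1 : Tendsto (fun n => ∑ i, ((∫ x, Hn ρ (pd i (G' (mu ρ))) n x) - 2 * ∫ x, (pd i (G' (mu (mol (eta d n) ρ))) x - pd i (G' (mu ρ)) x) * Phi τ ρ (G' (mu ρ)) n i x)) 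
      atTop (𝓝 (∑ i : Fin d, (0 - 2 * 0))) := tendsto_finsetSum _ fun i _ => (hH i).sub ((er i).const_mul 2)
  have t2 := (t1.const_add (2 * l)).const_mul (Cp d a₁)
  have t3 := (var_tendsto h hP0 τ h.a₁pos).const_mul (c₀ * exp (-a₁))
  have := le_of_tendsto_of_tendsto_of_frequently t3 t2 (hf.mono fun n hn => ?_)
  · refine this.trans (le_of_eq ?_)
    simp; ring
  · refine (fn_poincare h hP0 n).trans (mul_le_mul_of_nonneg_left ?_ (Cp_nonneg _))
    have : ∑ i, (1/2 * (∫ x, (pd i (G' (mu ρ)) x + Sc τ ρ n i x)^2 * mol (eta d n) ρ x) - 1/2 * (∫ x, Hn ρ (pd i (G' (mu ρ))) n x) 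
      + ∫ x, (pd i (G' (mu (mol (eta d n) ρ))) x - pd i (G' (mu ρ)) x) * Phi τ ρ (G' (mu ρ)) n i x) ≤ l :=
      (Finset.sum_le_sum fun i _ => Qi_ge2 h hP0 (hP n) n i).trans hn
    rw [Finset.sum_add_distrib, Finset.sum_sub_distrib, ← Finset.mul_sum, ← Finset.mul_sum] at this
    rw [Finset.sum_sub_distrib, ← Finset.mul_sum]
    linarith

end

section

open scoped ContDiff
variable {d : ℕ} {c₀ a₁ C₀ a₂ α L τ : ℝ} {G : Measure (Ed d) → ℝ} {G' : Measure (Ed d) → Ed d → ℝ} {ρ : ℝ → Ed d → ℝ}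

/-- the weak generator at time `s` -/
def Ag (G' : Measure (Ed d) → Ed d → ℝ) (τ : ℝ) (ρ : ℝ → Ed d → ℝ) (φ : Ed d → ℝ) (s : ℝ) : ℝ :=
  ∫ x, ∑ i, (-(pd i φ x * pd i (G' (mu (ρ s))) x) + τ * pd i (pd i φ) x) ∂(mu (ρ s))

structure Flow (G' : Measure (Ed d) → Ed d → ℝ) (τ c₀ a₁ C₀ a₂ α L : ℝ) (ρ : ℝ → Ed d → ℝ) : Prop where
  nice : ∀ t, 0 ≤ t → Nice c₀ a₁ C₀ a₂ (ρ t)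
  pot : ∀ t, 0 ≤ t → Pot α L (G' (mu (ρ t)))
  pde : ∀ φ : Ed d → ℝ, ContDiff ℝ ∞ φ → HasCompactSupport φ → ∀ s t : ℝ, 0 ≤ s → s ≤ t →
    (∫ x, φ x * ρ t x) - (∫ x, φ x * ρ s x) = ∫ r in s..t, Ag G' τ ρ φ r

lemma gen_integ {ρ U φ : Ed d → ℝ} (h : Nice c₀ a₁ C₀ a₂ ρ) (hU : Pot α L U) (hφ : ContDiff ℝ ∞ φ) (hc : HasCompactSupport φ) (i : Fin d) :
    Integrable (fun x => (-(pd i φ x * pd i U x) + τ * pd i (pd i φ) x) * ρ x) := by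
  have h1 : PB (fun (_ : Unit) => pd i φ) := PB_of_compact (contDiff_pd hφ i).continuous (pd_compact hc i)
  have h2 : PB (fun (_ : Unit) => pd i (pd i φ)) := PB_of_compact (contDiff_pd (contDiff_pd hφ i) i).continuous (pd_compact (pd_compact hc i) i)
  refine bρ_integ h ((h1.mul (hU.PBpd1 i)).neg.add (h2.const_mul τ)) ?_
  exact ((((contDiff_pd hφ i).continuous.mul (hU.cont_pd i)).neg).add (continuous_const.mul (contDiff_pd (contDiff_pd hφ i) i).continuous)).measurable

lemma Ag_eq (hF : Flow G' τ c₀ a₁ C₀ a₂ α L ρ) {φ : Ed d → ℝ} (hφ : ContDiff ℝ ∞ φ) (hc : HasCompactSupport φ) {s : ℝ} (hs : 0 ≤ s) :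
    Ag G' τ ρ φ s = ∑ i, ∫ x, (-(pd i φ x * pd i (G' (mu (ρ s))) x) + τ * pd i (pd i φ) x) * ρ s x := by
  have h := hF.nice s hs
  rw [Ag, integral_mu h.meas (fun x => (h.pos x).le)]
  simp only [Finset.sum_mul]
  rw [integral_finsetSum _ fun i _ => gen_integ h (hF.pot s hs) hφ hc i]

lemma Ag_bdd (hF : Flow G' τ c₀ a₁ C₀ a₂ α L ρ) {φ : Ed d → ℝ} (hφ : ContDiff ℝ ∞ φ) (hc : HasCompactSupport φ) :
    ∃ C, ∀ s, 0 ≤ s → |Ag G' τ ρ φ s| ≤ C := by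
  have key : ∀ i : Fin d, ∃ C, 0 ≤ C ∧ ∀ s : {s : ℝ // 0 ≤ s}, |∫ x, (-(pd i φ x * pd i (G' (mu (ρ s.1))) x) + τ * pd i (pd i φ) x) * ρ s.1 x| ≤ C := by
    intro i
    have h1 : PB (fun (_ : Unit) => pd i φ) := PB_of_compact (contDiff_pd hφ i).continuous (pd_compact hc i)
    have h2 : PB (fun (_ : Unit) => pd i (pd i φ)) := PB_of_compact (contDiff_pd (contDiff_pd hφ i) i).continuous (pd_compact (pd_compact hc i) i)
    have h3 : PB (fun (s : {s : ℝ // 0 ≤ s}) => pd i (G' (mu (ρ s.1)))) := (Pot.PBpd (d := d) α L i).comp (fun s : {s : ℝ // 0 ≤ s} => ⟨G' (mu (ρ s.1)), hF.pot s.1 s.2⟩)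
    have h4 : GB (fun (s : {s : ℝ // 0 ≤ s}) => ρ s.1) := (Nice.GB (d := d) c₀ a₁ C₀ a₂).comp (fun s : {s : ℝ // 0 ≤ s} => ⟨ρ s.1, hF.nice s.1 s.2⟩)
    have h1' : PB (fun (_ : {s : ℝ // 0 ≤ s}) => pd i φ) := h1.comp (fun _ : {s : ℝ // 0 ≤ s} => ())
    have h2' : PB (fun (_ : {s : ℝ // 0 ≤ s}) => pd i (pd i φ)) := h2.comp (fun _ : {s : ℝ // 0 ≤ s} => ())
    have h5 : PB (fun (s : {s : ℝ // 0 ≤ s}) x => (-(pd i φ x * pd i (G' (mu (ρ s.1))) x) + τ * pd i (pd i φ) x)) := (h1'.mul h3).neg.add (h2'.const_mul τ)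
    have h6 := h5.mul_GB h4
    obtain ⟨C, hC, h7⟩ := h6.abs_integral_le
    exact ⟨C, hC, h7⟩
  choose C hC0 hC using key
  refine ⟨∑ i, C i, fun s hs => ?_⟩
  rw [Ag_eq hF hφ hc hs]
  exact (Finset.abs_sum_le_sum_abs _ _).trans (Finset.sum_le_sum fun i _ => hC i ⟨s, hs⟩)

lemma Ag_add (hF : Flow G' τ c₀ a₁ C₀ a₂ α L ρ) {φ ψ : Ed d → ℝ} (hφ : ContDiff ℝ ∞ φ) (hc : HasCompactSupport φ) 
    (hψ : ContDiff ℝ ∞ ψ) (hcψ : HasCompactSupport ψ) {s : ℝ} (hs : 0 ≤ s) :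
    Ag G' τ ρ (φ + ψ) s = Ag G' τ ρ φ s + Ag G' τ ρ ψ s := by
  have hs' : ContDiff ℝ ∞ (φ + ψ) := hφ.add hψ
  have hc' : HasCompactSupport (φ + ψ) := hc.add hcψ
  rw [Ag_eq hF hφ hc hs, Ag_eq hF hψ hcψ hs, Ag_eq hF (φ := φ + ψ) hs' hc' hs, ← Finset.sum_add_distrib]
  refine Finset.sum_congr rfl fun i _ => ?_
  rw [← integral_add (gen_integ (hF.nice s hs) (hF.pot s hs) hφ hc i) (gen_integ (hF.nice s hs) (hF.pot s hs) hψ hcψ i)]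
  congr 1; ext x
  have e1 : pd i (φ + ψ) = pd i φ + pd i ψ := funext fun x => pd_add' i (hφ.differentiable (by simp) x) (hψ.differentiable (by simp) x)
  have e2 := pd_add' (x := x) i ((contDiff_pd hφ i).differentiable (by simp) x) ((contDiff_pd hψ i).differentiable (by simp) x)
  rw [e1, e2]; simp only [Pi.add_apply]; ring

lemma mu_eq_of_not (hF : Flow G' τ c₀ a₁ C₀ a₂ α L ρ) {φ0 : Ed d → ℝ} (hφ : ContDiff ℝ ∞ φ0) (hc : HasCompactSupport φ0) {s t : ℝ}
    (hs : 0 ≤ s) (hst : s ≤ t) (hn : ¬ IntervalIntegrable (Ag G' τ ρ φ0) volume s t) : mu (ρ s) = mu (ρ t) := by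
  have h0 : ∀ φ : Ed d → ℝ, ContDiff ℝ ∞ φ → HasCompactSupport φ → ¬ IntervalIntegrable (Ag G' τ ρ φ) volume s t → 
      ∫ x, φ x * ρ t x = ∫ x, φ x * ρ s x := fun φ h1 h2 h3 => by
    have := hF.pde φ h1 h2 s t hs hst
    rw [intervalIntegral.integral_undef h3] at this
    linarith
  have ns := hF.nice s hs
  have nt := hF.nice t (hs.trans hst)
  have all : ∀ φ : Ed d → ℝ, ContDiff ℝ ∞ φ → HasCompactSupport φ → ∫ x, φ x * ρ t x = ∫ x, φ x * ρ s x := fun φ h1 h2 => by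
    by_cases h3 : IntervalIntegrable (Ag G' τ ρ φ) volume s t
    · have h4 : ¬ IntervalIntegrable (Ag G' τ ρ (φ + φ0)) volume s t := fun h5 => hn <| by
        refine (h5.sub h3).congr ?_
        intro r hr
        rw [uIoc_of_le hst] at hr
        have := Ag_add hF h1 h2 hφ hc (s := r) (hs.trans hr.1.le)
        linarith
      have e1 := h0 (φ + φ0) (h1.add hφ) (h2.add hc) h4
      have e2 := h0 _ hφ hc hn
      have i : ∀ (r : ℝ), Nice c₀ a₁ C₀ a₂ (ρ r) → ∫ x, (φ + φ0) x * ρ r x = (∫ x, φ x * ρ r x) + ∫ x, φ0 x * ρ r x := fun r hr => by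
        rw [← integral_add (bρ_integ hr (PB_of_compact h1.continuous h2) h1.continuous.measurable) (bρ_integ hr (PB_of_compact hφ.continuous hc) hφ.continuous.measurable)]
        congr 1; ext x; simp only [Pi.add_apply]; ring
      rw [i t nt, i s ns] at e1
      linarith
    · exact h0 φ h1 h2 h3
  have := ae_eq_of_integral_contDiff_smul_eq ns.dens.integ.locallyIntegrable nt.dens.integ.locallyIntegrable
    (fun g hg hcg => by simpa only [smul_eq_mul] using (all g hg hcg).symm)
  exact withDensity_congr_ae (this.mono fun x hx => by simp only [hx])

theorem Ag_integrable (hF : Flow G' τ c₀ a₁ C₀ a₂ α L ρ) {φ : Ed d → ℝ} (hφ : ContDiff ℝ ∞ φ) (hc : HasCompactSupport φ) {a b : ℝ}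
    (ha : 0 ≤ a) (hab : a ≤ b) : IntervalIntegrable (Ag G' τ ρ φ) volume a b := by
  obtain ⟨C, hC⟩ := Ag_bdd hF hφ hc
  let S := {t : ℝ | t ∈ Icc a b ∧ IntervalIntegrable (Ag G' τ ρ φ) volume a t}
  have aS : a ∈ S := ⟨⟨le_rfl, hab⟩, IntervalIntegrable.refl⟩
  have bS : BddAbove S := ⟨b, fun t ht => ht.1.2⟩
  set c := sSup S with hcd
  have hac : a ≤ c := le_csSup bS aS
  have hcb : c ≤ b := csSup_le ⟨a, aS⟩ fun t ht => ht.1.2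
  have cI : IntervalIntegrable (Ag G' τ ρ φ) volume a c := by
    obtain ⟨u, -, hu2, hu3⟩ := exists_seq_tendsto_sSup ⟨a, aS⟩ bS
    rw [intervalIntegrable_iff_integrableOn_Ioo_of_le hac]
    have m1 : AEStronglyMeasurable (Ag G' τ ρ φ) (volume.restrict (⋃ n, Ioc a (u n))) := by
      rw [aestronglyMeasurable_iUnion_iff]
      intro n
      have := (hu3 n).2
      rw [intervalIntegrable_iff_integrableOn_Ioc_of_le (hu3 n).1.1] at this
      exact this.aestronglyMeasurable
    have sub : Ioo a c ⊆ ⋃ n, Ioc a (u n) := fun x hx => by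
      obtain ⟨n, hn⟩ := (hu2.eventually (lt_mem_nhds hx.2)).exists
      exact mem_iUnion.2 ⟨n, hx.1, hn.le⟩
    refine Integrable.of_bound (m1.mono_set sub) C ?_
    refine (ae_restrict_iff' measurableSet_Ioo).2 (ae_of_all _ fun x hx => ?_)
    exact hC x (ha.trans hx.1.le)
  rcases hcb.eq_or_lt with h | h
  · rwa [h] at cI
  exfalso
  have hnot : ∀ t ∈ Ioc c b, ¬ IntervalIntegrable (Ag G' τ ρ φ) volume c t := fun t ht hI => by
    have : t ∈ S := ⟨⟨hac.trans ht.1.le, ht.2⟩, cI.trans hI⟩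
    exact absurd (le_csSup bS this) (not_le.2 ht.1)
  refine hnot b ⟨h, le_rfl⟩ ?_
  refine (intervalIntegrable_const (c := Ag G' τ ρ φ c)).congr ?_
  intro r hr
  rw [uIoc_of_le hcb] at hr
  have := mu_eq_of_not hF hφ hc (ha.trans hac) hr.1.le (hnot r hr)
  simp only [Ag, this]

lemma R_Ag (hF : Flow G' τ c₀ a₁ C₀ a₂ α L ρ) (n : ℕ) (x : Ed d) {s : ℝ} (hs : 0 ≤ s) :
    Ag G' τ ρ (fun y => eta d n (x - y)) s = zeta τ (ρ s) (G' (mu (ρ s))) n x := by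
  have h := hF.nice s hs
  have hU := hF.pot s hs
  rw [Ag_eq hF ((eta_ker d n).shift_smooth x) ((eta_ker d n).shift_compact x) hs, zeta]
  refine Finset.sum_congr rfl fun i _ => ?_
  rw [pd_Phi h hU, mol, mol, ← integral_const_mul]
  rw [← integral_add (shift_integ ((eta_ker d n).pd i) (bρ_loc h hU i) x) ((shift_integ (((eta_ker d n).pd i).pd i) h.dens.integ.locallyIntegrable x).const_mul τ)]
  congr 1; ext y
  have e : pd i (fun y => eta d n (x - y)) = fun y => - pd i (eta d n) (x - y) := funext fun y => pd_shift (eta_ker d n) i x y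
  have e2 : pd i (fun y => - pd i (eta d n) (x - y)) y = pd i (pd i (eta d n)) (x - y) := by
    have h1 := pd_shift ((eta_ker d n).pd i) i x y
    have h2 : pd i (fun y => - pd i (eta d n) (x - y)) y = - pd i (fun y => pd i (eta d n) (x - y)) y := by
      simp only [pd]; rw [fderiv_fun_neg]; rfl
    rw [h2, h1, neg_neg]
  rw [e, e2]; ring

theorem R_diff (hF : Flow G' τ c₀ a₁ C₀ a₂ α L ρ) (n : ℕ) (x : Ed d) {s t : ℝ} (hs : 0 ≤ s) (hst : s ≤ t) :
    IntervalIntegrable (fun r => zeta τ (ρ r) (G' (mu (ρ r))) n x) volume s t ∧ 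
    mol (eta d n) (ρ t) x - mol (eta d n) (ρ s) x = ∫ r in s..t, zeta τ (ρ r) (G' (mu (ρ r))) n x := by
  have h1 := (eta_ker d n).shift_smooth x
  have h2 := (eta_ker d n).shift_compact x
  have e : ∀ r ∈ uIoc s t, Ag G' τ ρ (fun y => eta d n (x - y)) r = zeta τ (ρ r) (G' (mu (ρ r))) n x := fun r hr => by
    rw [uIoc_of_le hst] at hr
    exact R_Ag hF n x (hs.trans hr.1.le)
  refine ⟨(Ag_integrable hF h1 h2 hs hst).congr e, ?_⟩
  rw [← intervalIntegral.integral_congr_ae (ae_of_all _ e)]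
  exact hF.pde _ h1 h2 s t hs hst

end

section

open scoped ContDiff
variable {d : ℕ} {c₀ a₁ C₀ a₂ α L τ : ℝ} {G : Measure (Ed d) → ℝ} {G' : Measure (Ed d) → Ed d → ℝ} {ρ : ℝ → Ed d → ℝ}

/-- nonnegative times -/
abbrev NT := {s : ℝ // 0 ≤ s}

/-- time derivative of the mollified density -/
def Zt (G' : Measure (Ed d) → Ed d → ℝ) (τ : ℝ) (ρ : ℝ → Ed d → ℝ) (n : ℕ) (s : ℝ) (x : Ed d) : ℝ :=
  zeta τ (ρ s) (G' (mu (ρ s))) n x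

/-- mollified density -/
def Rt (ρ : ℝ → Ed d → ℝ) (n : ℕ) (s : ℝ) (x : Ed d) : ℝ := mol (eta d n) (ρ s) x

lemma mol_lip {χ : Ed d → ℝ} (h : Ker χ) : ∃ K, 0 ≤ K ∧ ∀ g : Ed d → ℝ, Integrable g → ∀ x y,
    |mol χ g x - mol χ g y| ≤ K * (∫ z, |g z|) * ‖x - y‖ := by
  obtain ⟨K, hK⟩ := h.smooth.lipschitzWith_of_hasCompactSupport h.compact (by simp)
  refine ⟨K, K.2, fun g hg x y => ?_⟩
  have hl := hg.locallyIntegrable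
  rw [mol, mol, ← integral_sub (shift_integ h hl x) (shift_integ h hl y)]
  refine abs_integral_le_integral_abs.trans ?_
  have e : K * (∫ z, |g z|) * ‖x - y‖ = ∫ z, (K * ‖x - y‖) * |g z| := by rw [integral_const_mul]; ring
  rw [e]
  refine integral_mono_of_nonneg (ae_of_all _ fun z => abs_nonneg _) (hg.abs.const_mul _) (ae_of_all _ fun z => ?_)
  have := hK.dist_le_mul (x - z) (y - z)
  rw [dist_sub_right, dist_eq_norm, dist_eq_norm, norm_eq_abs] at this
  change |χ (x - z) * g z - χ (y - z) * g z| ≤ _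
  rw [← sub_mul, abs_mul]
  exact mul_le_mul_of_nonneg_right this (abs_nonneg _)

lemma flow_ρ (hF : Flow G' τ c₀ a₁ C₀ a₂ α L ρ) : GB (fun (s : NT) => ρ s.1) :=
  (Nice.GB (d := d) c₀ a₁ C₀ a₂).comp (fun s : NT => ⟨ρ s.1, hF.nice s.1 s.2⟩)

lemma flow_bρ (hF : Flow G' τ c₀ a₁ C₀ a₂ α L ρ) (i : Fin d) : GB (fun (s : NT) x => pd i (G' (mu (ρ s.1))) x * ρ s.1 x) := by
  have h3 : PB (fun (s : NT) => pd i (G' (mu (ρ s.1)))) := (Pot.PBpd (d := d) α L i).comp (fun s : NT => ⟨G' (mu (ρ s.1)), hF.pot s.1 s.2⟩)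
  exact h3.mul_GB (flow_ρ hF)

lemma Zt_eq (hF : Flow G' τ c₀ a₁ C₀ a₂ α L ρ) (n : ℕ) (s : NT) (x : Ed d) : Zt G' τ ρ n s.1 x =
    ∑ i, (mol (pd i (eta d n)) (fun y => pd i (G' (mu (ρ s.1))) y * ρ s.1 y) x + τ * mol (pd i (pd i (eta d n))) (ρ s.1) x) := by
  rw [Zt, zeta]
  exact Finset.sum_congr rfl fun i _ => pd_Phi (hF.nice s.1 s.2) (hF.pot s.1 s.2) n i x

lemma Zt_GB (hF : Flow G' τ c₀ a₁ C₀ a₂ α L ρ) (n : ℕ) : GB (fun (s : NT) => Zt G' τ ρ n s.1) := by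
  have h : ∀ i ∈ (Finset.univ : Finset (Fin d)), GB (fun (s : NT) x => mol (pd i (eta d n)) (fun y => pd i (G' (mu (ρ s.1))) y * ρ s.1 y) x + τ * mol (pd i (pd i (eta d n))) (ρ s.1) x) := fun i _ => by
    have h1 := mol_GB1 (flow_bρ hF i) ((eta_ker d n).pd i)
    have h2 := (mol_GB1 (flow_ρ hF) (((eta_ker d n).pd i).pd i)).const_mul τ
    exact h1.add h2
  obtain ⟨K, a, hK, ha, hb⟩ := GB.sum _ h
  exact ⟨K, a, hK, ha, fun s x => by
    have := Zt_eq hF n s x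
    change |Zt G' τ ρ n s.1 x| ≤ _
    rw [this]; exact hb s x⟩

lemma Zt_lip (hF : Flow G' τ c₀ a₁ C₀ a₂ α L ρ) (n : ℕ) : ∃ K, 0 ≤ K ∧ ∀ s : ℝ, 0 ≤ s → ∀ x y, 
    |Zt G' τ ρ n s x - Zt G' τ ρ n s y| ≤ K * ‖x - y‖ := by
  have key : ∀ i : Fin d, ∃ K, 0 ≤ K ∧ ∀ s : NT, ∀ x y, 
      |(mol (pd i (eta d n)) (fun y => pd i (G' (mu (ρ s.1))) y * ρ s.1 y) x + τ * mol (pd i (pd i (eta d n))) (ρ s.1) x)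
       - (mol (pd i (eta d n)) (fun y => pd i (G' (mu (ρ s.1))) y * ρ s.1 y) y + τ * mol (pd i (pd i (eta d n))) (ρ s.1) y)| ≤ K * ‖x - y‖ := by
    intro i
    obtain ⟨K1, hK1, h1⟩ := mol_lip ((eta_ker d n).pd i)
    obtain ⟨K2, hK2, h2⟩ := mol_lip (((eta_ker d n).pd i).pd i)
    obtain ⟨C1, hC1, b1⟩ := (flow_bρ hF i).integral_le
    obtain ⟨C2, hC2, b2⟩ := (flow_ρ hF).integral_le
    refine ⟨K1 * C1 + |τ| * (K2 * C2), by positivity, fun s x y => ?_⟩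
    have hn := hF.nice s.1 s.2
    have e1 := h1 _ (bρ_integ hn ((hF.pot s.1 s.2).PBpd1 i) ((hF.pot s.1 s.2).cont_pd i).measurable) x y
    have e2 := h2 _ hn.dens.integ x y
    have f1 : K1 * (∫ z, |pd i (G' (mu (ρ s.1))) z * ρ s.1 z|) * ‖x - y‖ ≤ K1 * C1 * ‖x - y‖ := by gcongr; exact b1 s
    have f2 : K2 * (∫ z, |ρ s.1 z|) * ‖x - y‖ ≤ K2 * C2 * ‖x - y‖ := by gcongr; exact b2 s
    rw [show ∀ p q r t : ℝ, (p + τ * q) - (r + τ * t) = (p - r) + τ * (q - t) from fun _ _ _ _ => by ring]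
    refine (abs_add_le _ _).trans ?_
    rw [abs_mul, add_mul]
    have := mul_le_mul_of_nonneg_left (e2.trans f2) (abs_nonneg τ)
    refine (add_le_add (e1.trans f1) this).trans (le_of_eq (by ring))
  choose K hK0 hK using key
  refine ⟨∑ i, K i, Finset.sum_nonneg fun i _ => hK0 i, fun s hs x y => ?_⟩
  rw [Zt_eq hF n ⟨s, hs⟩ x, Zt_eq hF n ⟨s, hs⟩ y, ← Finset.sum_sub_distrib, Finset.sum_mul]
  exact (Finset.abs_sum_le_sum_abs _ _).trans (Finset.sum_le_sum fun i _ => hK i ⟨s, hs⟩ x y)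

lemma Rt_diff (hF : Flow G' τ c₀ a₁ C₀ a₂ α L ρ) (n : ℕ) (x : Ed d) {s t : ℝ} (hs : 0 ≤ s) (hst : s ≤ t) :
    IntervalIntegrable (fun r => Zt G' τ ρ n r x) volume s t ∧ 
    Rt ρ n t x - Rt ρ n s x = ∫ r in s..t, Zt G' τ ρ n r x := R_diff hF n x hs hst

lemma Rt_GB (hF : Flow G' τ c₀ a₁ C₀ a₂ α L ρ) (n : ℕ) : ∃ K a : ℝ, 0 ≤ K ∧ 0 < a ∧ ∀ s t, 0 ≤ s → 0 ≤ t → ∀ x, 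
    |Rt ρ n t x - Rt ρ n s x| ≤ (K * exp (-a * ‖x‖^2)) * |t - s| := by
  obtain ⟨K, a, hK, ha, hb⟩ := Zt_GB hF n
  have key : ∀ s t, 0 ≤ s → s ≤ t → ∀ x, |Rt ρ n t x - Rt ρ n s x| ≤ (K * exp (-a * ‖x‖^2)) * |t - s| := fun s t hs hst x => by
    rw [(Rt_diff hF n x hs hst).2]
    rw [← norm_eq_abs]
    refine intervalIntegral.norm_integral_le_of_norm_le_const fun r hr => ?_
    rw [uIoc_of_le hst] at hr
    exact hb ⟨r, hs.trans hr.1.le⟩ x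
  refine ⟨K, a, hK, ha, fun s t hs ht x => ?_⟩
  rcases le_total s t with h | h
  · exact key s t hs h x
  · rw [abs_sub_comm, abs_sub_comm t s]; exact key t s ht h x

lemma Rt_lip (hF : Flow G' τ c₀ a₁ C₀ a₂ α L ρ) (n : ℕ) : ∃ K : ℝ, 0 ≤ K ∧ ∀ s t, 0 ≤ s → 0 ≤ t → ∀ x y, 
    |(Rt ρ n t x - Rt ρ n s x) - (Rt ρ n t y - Rt ρ n s y)| ≤ K * ‖x - y‖ * |t - s| := by
  obtain ⟨K, hK, hb⟩ := Zt_lip hF n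
  have key : ∀ s t, 0 ≤ s → s ≤ t → ∀ x y, |(Rt ρ n t x - Rt ρ n s x) - (Rt ρ n t y - Rt ρ n s y)| ≤ K * ‖x - y‖ * |t - s| := fun s t hs hst x y => by
    have hx := Rt_diff hF n x hs hst
    have hy := Rt_diff hF n y hs hst
    rw [hx.2, hy.2, ← intervalIntegral.integral_sub hx.1 hy.1]
    rw [← norm_eq_abs]
    refine intervalIntegral.norm_integral_le_of_norm_le_const fun r hr => ?_
    rw [uIoc_of_le hst] at hr
    exact hb r (hs.trans hr.1.le) x y
  refine ⟨K, hK, fun s t hs ht x y => ?_⟩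
  rcases le_total s t with h | h
  · exact key s t hs h x y
  · have := key t s ht h x y
    rw [abs_sub_comm t s]
    rwa [show (Rt ρ n t x - Rt ρ n s x) - (Rt ρ n t y - Rt ρ n s y) = -((Rt ρ n s x - Rt ρ n t x) - (Rt ρ n s y - Rt ρ n t y)) by ring, abs_neg]

lemma Rt_deriv1 (hF : Flow G' τ c₀ a₁ C₀ a₂ α L ρ) (n : ℕ) (x : Ed d) : ∀ᵐ t : ℝ, 0 < t → HasDerivAt (fun t => Rt ρ n t x) (Zt G' τ ρ n t x) t := by
  have h : ∀ᵐ t : ℝ, ∀ N : ℕ, t ∈ uIcc (0:ℝ) N → ∀ c ∈ uIcc (0:ℝ) N, HasDerivAt (fun u => ∫ r in c..u, Zt G' τ ρ n r x) (Zt G' τ ρ n t x) t :=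
    ae_all_iff.2 fun N => (Rt_diff hF n x le_rfl (Nat.cast_nonneg N)).1.ae_hasDerivAt_integral
  filter_upwards [h] with t ht ht0
  obtain ⟨N, hN⟩ := exists_nat_ge t
  have := ht N (by rw [uIcc_of_le (Nat.cast_nonneg N)]; exact ⟨ht0.le, hN⟩) 0 (by simp)
  refine (this.const_add (Rt ρ n 0 x)).congr_of_eventuallyEq ?_
  filter_upwards [lt_mem_nhds ht0] with u hu
  have := (Rt_diff hF n x le_rfl hu.le).2
  linarith

lemma Rt_deriv (hF : Flow G' τ c₀ a₁ C₀ a₂ α L ρ) (n : ℕ) : ∀ᵐ t : ℝ, 0 < t → ∀ x, HasDerivAt (fun t => Rt ρ n t x) (Zt G' τ ρ n t x) t := by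
  have h : ∀ᵐ t : ℝ, ∀ k : ℕ, 0 < t → HasDerivAt (fun t => Rt ρ n t (TopologicalSpace.denseSeq (Ed d) k)) (Zt G' τ ρ n t (TopologicalSpace.denseSeq (Ed d) k)) t :=
    ae_all_iff.2 fun k => Rt_deriv1 hF n _
  obtain ⟨K1, hK1, h1⟩ := Zt_lip hF n
  obtain ⟨K2, hK2, h2⟩ := Rt_lip hF n
  filter_upwards [h] with t ht ht0 x
  rw [hasDerivAt_iff_isLittleO, Asymptotics.isLittleO_iff]
  intro c hc
  obtain ⟨k, hk⟩ := (TopologicalSpace.denseRange_denseSeq (Ed d)).exists_dist_lt x (ε := c / (2 * (K1 + K2 + 1))) (by positivity)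
  set y := TopologicalSpace.denseSeq (Ed d) k
  have hy := ht k ht0
  rw [hasDerivAt_iff_isLittleO, Asymptotics.isLittleO_iff] at hy
  filter_upwards [hy (half_pos hc), lt_mem_nhds ht0] with u hu hu0
  simp only [norm_eq_abs, smul_eq_mul] at hu ⊢
  have e1 := h2 t u ht0.le hu0.le x y
  have e2 := h1 t ht0.le x y
  rw [dist_eq_norm, lt_div_iff₀ (by positivity)] at hk
  have e : Rt ρ n u x - Rt ρ n t x - (u - t) * Zt G' τ ρ n t x = (Rt ρ n u y - Rt ρ n t y - (u - t) * Zt G' τ ρ n t y) + 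
    ((Rt ρ n u x - Rt ρ n t x) - (Rt ρ n u y - Rt ρ n t y)) - (u - t) * (Zt G' τ ρ n t x - Zt G' τ ρ n t y) := by ring
  rw [e]
  refine (abs_sub _ _).trans ?_
  have e3 := abs_add_le (Rt ρ n u y - Rt ρ n t y - (u - t) * Zt G' τ ρ n t y) ((Rt ρ n u x - Rt ρ n t x) - (Rt ρ n u y - Rt ρ n t y))
  rw [abs_mul]
  have e4 := mul_le_mul_of_nonneg_left e2 (abs_nonneg (u - t))
  have e5 : (K1 + K2) * ‖x - y‖ ≤ c / 2 := by nlinarith [norm_nonneg (x - y)]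
  have e6 := mul_le_mul_of_nonneg_right e5 (abs_nonneg (u - t))
  nlinarith

end

section

open scoped ContDiff
variable {d : ℕ} {c₀ a₁ C₀ a₂ α L τ : ℝ} {G : Measure (Ed d) → ℝ} {G' : Measure (Ed d) → Ed d → ℝ} {ρ : ℝ → Ed d → ℝ}

/-- energy of the mollified density -/
def En (G : Measure (Ed d) → ℝ) (τ : ℝ) (ρ : ℝ → Ed d → ℝ) (n : ℕ) (t : ℝ) : ℝ := Fr G τ (Rt ρ n t)

/-- its first variation -/
def ft (G' : Measure (Ed d) → Ed d → ℝ) (τ : ℝ) (ρ : ℝ → Ed d → ℝ) (n : ℕ) (t : ℝ) (x : Ed d) : ℝ :=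
  G' (mu (Rt ρ n t)) x + τ * log (Rt ρ n t x)

lemma Rt_nice (hF : Flow G' τ c₀ a₁ C₀ a₂ α L ρ) (n : ℕ) {t : ℝ} (ht : 0 ≤ t) :
    Nice (c₀ * exp (-a₁)) a₁ (C₀ * exp a₂) (a₂/2) (Rt ρ n t) := nice_mol (hF.nice t ht) n

lemma Rt_pot (hS : Setup G G' α L) (hF : Flow G' τ c₀ a₁ C₀ a₂ α L ρ) (n : ℕ) {t : ℝ} (ht : 0 ≤ t) :
    Pot α L (G' (mu (Rt ρ n t))) := (hS _ (Rt_nice hF n ht).dens.isP2).2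

lemma ft_PB (hS : Setup G G' α L) (hF : Flow G' τ c₀ a₁ C₀ a₂ α L ρ) (n : ℕ) : PB (fun (s : NT) => ft G' τ ρ n s.1) := by
  have h1 : PB (fun (s : NT) => G' (mu (Rt ρ n s.1))) := (Pot.PB (d := d) α L).comp (fun s : NT => ⟨G' (mu (Rt ρ n s.1)), Rt_pot hS hF n s.2⟩)
  have h2 : PB (fun (s : NT) x => log (Rt ρ n s.1 x)) := (Nice.PBlog (d := d) (c₀ * exp (-a₁)) a₁ (C₀ * exp a₂) (a₂/2)).comp (fun s : NT => ⟨Rt ρ n s.1, Rt_nice hF n s.2⟩)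
  exact h1.add (h2.const_mul τ)

lemma ft_meas (hS : Setup G G' α L) (hF : Flow G' τ c₀ a₁ C₀ a₂ α L ρ) (n : ℕ) {t : ℝ} (ht : 0 ≤ t) : Measurable (ft G' τ ρ n t) :=
  (Rt_pot hS hF n ht).meas.add ((Rt_nice hF n ht).meas.log.const_mul τ)

lemma En_ineq (hS : Setup G G' α L) (hτ : 0 < τ) (hc : ConvexFun (obj G τ)) (hF : Flow G' τ c₀ a₁ C₀ a₂ α L ρ) (n : ℕ) {s t : ℝ} (hs : 0 ≤ s) (ht : 0 ≤ t) :
    En G τ ρ n t + (∫ x, ft G' τ ρ n t x * (Rt ρ n s x - Rt ρ n t x)) ≤ En G τ ρ n s :=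
  weak_ineq hS hτ hc (Rt_nice hF n ht) (Rt_nice hF n hs).dens

lemma En_lip (hS : Setup G G' α L) (hτ : 0 < τ) (hc : ConvexFun (obj G τ)) (hF : Flow G' τ c₀ a₁ C₀ a₂ α L ρ) (n : ℕ) : 
    ∃ C, 0 ≤ C ∧ ∀ s t, 0 ≤ s → 0 ≤ t → |En G τ ρ n t - En G τ ρ n s| ≤ C * |t - s| := by
  obtain ⟨K, a, hK, ha, hb⟩ := Rt_GB hF n
  have g1 : GB (fun (_ : NT) (x : Ed d) => K * exp (-a * ‖x‖ ^ 2)) := (GB.gauss ha).const_mul K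
  have g2 := (ft_PB (τ := τ) hS hF n).mul_GB g1
  obtain ⟨C, hC, h⟩ := g2.integral_le
  have key : ∀ s t, 0 ≤ s → 0 ≤ t → |∫ x, ft G' τ ρ n t x * (Rt ρ n s x - Rt ρ n t x)| ≤ C * |t - s| := fun s t hs ht => by
    have e := mul_le_mul_of_nonneg_right (h ⟨t, ht⟩) (abs_nonneg (t - s))
    refine le_trans ?_ e
    refine abs_integral_le_integral_abs.trans ?_
    rw [← integral_mul_const]
    have i0 : Integrable (fun x => ft G' τ ρ n t x * (K * exp (-a * ‖x‖ ^ 2))) :=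
      g2.integrable ⟨t, ht⟩ ((ft_meas hS hF n ht).mul (by fun_prop)).aestronglyMeasurable
    refine integral_mono_of_nonneg (ae_of_all _ fun _ => abs_nonneg _) (i0.abs.mul_const _) (ae_of_all _ fun x => ?_)
    have := hb t s ht hs x
    change |ft G' τ ρ n t x * (Rt ρ n s x - Rt ρ n t x)| ≤ |ft G' τ ρ n t x * (K * exp (-a * ‖x‖ ^ 2))| * |t - s|
    rw [abs_mul, abs_mul, mul_assoc, abs_of_nonneg (show 0 ≤ K * exp (-a * ‖x‖ ^ 2) by positivity), abs_sub_comm t s]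
    exact mul_le_mul_of_nonneg_left this (abs_nonneg _)
  refine ⟨C, hC, fun s t hs ht => ?_⟩
  have h1 := En_ineq hS hτ hc hF n hs ht
  have h2 := En_ineq hS hτ hc hF n ht hs
  have k1 := abs_le.1 (key s t hs ht)
  have k2 := abs_le.1 (key t s ht hs)
  rw [abs_sub_comm s t] at k2
  rw [abs_le]
  constructor <;> linarith [k1.1, k2.1]

lemma En_deriv (hS : Setup G G' α L) (hτ : 0 < τ) (hc : ConvexFun (obj G τ)) (hF : Flow G' τ c₀ a₁ C₀ a₂ α L ρ) (n : ℕ) {t e : ℝ} (ht : 0 < t)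
    (hR : ∀ x, HasDerivAt (fun t => Rt ρ n t x) (Zt G' τ ρ n t x) t) (hE : HasDerivAt (En G τ ρ n) e t) : 
    e ≤ - ∑ i, Qi τ (ρ t) (G' (mu (ρ t))) (G' (mu (mol (eta d n) (ρ t)))) n i := by
  have hbp := by_parts (τ := τ) (hF.nice t ht.le) (hF.pot t ht.le) (Rt_pot hS hF n ht.le) n
  change ∫ x, ft G' τ ρ n t x * Zt G' τ ρ n t x = _ at hbp
  refine le_of_le_of_eq ?_ hbp
  obtain ⟨K, a, hK, ha, hb⟩ := Rt_GB hF n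
  let s : ℕ → ℝ := fun k => t - t / (k + 2)
  have hs1 : ∀ k, s k - t < 0 := fun k => by simp only [s]; have : 0 < t / ((k:ℝ) + 2) := by positivity
                                             linarith
  have hs0 : ∀ k, 0 ≤ s k := fun k => by
    simp only [s]
    have : t / ((k:ℝ) + 2) ≤ t := div_le_self ht.le (by linarith [(Nat.cast_nonneg k : (0:ℝ) ≤ k)])
    linarith
  have hst : Tendsto s atTop (𝓝[≠] t) := by
    rw [tendsto_nhdsWithin_iff]
    refine ⟨?_, Eventually.of_forall fun k => by have := hs1 k; simp only [mem_compl_iff, mem_singleton_iff]; intro h; rw [h] at this; simp at this⟩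
    have h0 : Tendsto (fun k : ℕ => t / ((k:ℝ) + 2)) atTop (𝓝 0) :=
      Tendsto.div_atTop tendsto_const_nhds (tendsto_natCast_atTop_atTop.atTop_add tendsto_const_nhds)
    simpa only [s, sub_zero] using tendsto_const_nhds.sub h0
  have l1 : Tendsto (fun k => slope (En G τ ρ n) t (s k)) atTop (𝓝 e) := (hasDerivAt_iff_tendsto_slope.1 hE).comp hst
  have gb : GB (fun (k : ℕ) x => ft G' τ ρ n t x * ((s k - t)⁻¹ * (Rt ρ n (s k) x - Rt ρ n t x))) := by
    have p1 : PB (fun (k : ℕ) => ft G' τ ρ n t) := (ft_PB (τ := τ) hS hF n).comp (fun _ : ℕ => (⟨t, ht.le⟩ : NT))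
    have g1 : GB (fun (k : ℕ) x => ((s k - t)⁻¹ * (Rt ρ n (s k) x - Rt ρ n t x))) := ⟨K, a, hK, ha, fun k x => by
      have := hb t (s k) ht.le (hs0 k) x
      simp only [abs_mul, abs_inv]
      rw [inv_mul_le_iff₀ (abs_pos.2 (hs1 k).ne)]
      linarith⟩
    exact p1.mul_GB g1
  have l2 : Tendsto (fun k => ∫ x, ft G' τ ρ n t x * ((s k - t)⁻¹ * (Rt ρ n (s k) x - Rt ρ n t x))) atTop (𝓝 (∫ x, ft G' τ ρ n t x * Zt G' τ ρ n t x)) := by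
    refine gb.tendsto (Eventually.of_forall fun k => ?_) (ae_of_all _ fun x => ?_)
    · exact ((ft_meas hS hF n ht.le).mul (((Rt_nice hF n (hs0 k)).meas.sub (Rt_nice hF n ht.le).meas).const_mul _)).aestronglyMeasurable
    · exact ((hasDerivAt_iff_tendsto_slope.1 (hR x)).comp hst).const_mul _
  refine le_of_tendsto_of_tendsto' l1 l2 fun k => ?_
  have := En_ineq hS hτ hc hF n (hs0 k) ht.le
  rw [slope_def_field, div_eq_inv_mul]
  have e2 : ∫ x, ft G' τ ρ n t x * ((s k - t)⁻¹ * (Rt ρ n (s k) x - Rt ρ n t x)) = (s k - t)⁻¹ * ∫ x, ft G' τ ρ n t x * (Rt ρ n (s k) x - Rt ρ n t x) := by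
    rw [← integral_const_mul]; congr 1; ext x; ring
  rw [e2]
  exact mul_le_mul_of_nonpos_left (by linarith) (inv_nonpos.2 (hs1 k).le)

theorem edi (hS : Setup G G' α L) (hτ : 0 < τ) (hc : ConvexFun (obj G τ)) (hF : Flow G' τ c₀ a₁ C₀ a₂ α L ρ) {s t l : ℝ} (hs : 0 ≤ s) (hst : s ≤ t)
    (hl : ∀ r ∈ Ioo s t, 2 * Cp d a₁ * l < c₀ * exp (-a₁) * var a₁ (fun x => G' (mu (ρ r)) x + τ * log (ρ r x))) :
    Fr G τ (ρ t) ≤ Fr G τ (ρ s) - l * (t - s) := by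
  have ac : ∀ n, AbsolutelyContinuousOnInterval (En G τ ρ n) s t := fun n => by
    obtain ⟨C, hC, h⟩ := En_lip hS hτ hc hF n
    refine LipschitzOnWith.absolutelyContinuousOnInterval (K := ⟨C, hC⟩) (LipschitzOnWith.of_dist_le_mul fun x hx y hy => ?_)
    rw [uIcc_of_le hst] at hx hy
    exact h y x (hs.trans hy.1) (hs.trans hx.1)
  choose C' hC' hQ using fun i => Qi_ge (d := d) c₀ a₁ C₀ a₂ α L τ i
  have hn : ∀ᵐ r : ℝ, r ∈ Ioc s t → ∀ n, deriv (En G τ ρ n) r ≤ - ∑ i, Qi τ (ρ r) (G' (mu (ρ r))) (G' (mu (mol (eta d n) (ρ r)))) n i := by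
    have h1 := ae_all_iff.2 fun n => (ac n).ae_differentiableAt
    have h2 := ae_all_iff.2 fun n => Rt_deriv hF n
    filter_upwards [h1, h2] with r h1 h2 hr n
    have hr0 := hs.trans_lt hr.1
    exact En_deriv hS hτ hc hF n hr0 (h2 n hr0) (h1 n (by rw [uIcc_of_le hst]; exact Ioc_subset_Icc_self hr)).hasDerivAt
  have lim : Tendsto (fun n => ∫ r in s..t, max (deriv (En G τ ρ n) r) (-l)) atTop (𝓝 (∫ r in s..t, (-l))) := by
    refine intervalIntegral.tendsto_integral_filter_of_dominated_convergence (fun _ => ∑ i, C' i + |l|) (Eventually.of_forall fun n => ?_) 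
      (Eventually.of_forall fun n => ?_) intervalIntegrable_const ?_
    · exact ((measurable_deriv _).max measurable_const).aestronglyMeasurable
    · filter_upwards [hn] with r hr hr1
      rw [uIoc_of_le hst] at hr1
      have h0 : 0 ≤ r := hs.trans hr1.1.le
      have h1 := hr hr1 n
      have h2 : -∑ i, C' i ≤ ∑ i, Qi τ (ρ r) (G' (mu (ρ r))) (G' (mu (mol (eta d n) (ρ r)))) n i := by
        rw [← Finset.sum_neg_distrib]
        refine Finset.sum_le_sum fun i _ => ?_
        have h4 := hQ i (ρ r) _ _ (hF.nice r h0) (hF.pot r h0) (Rt_pot hS hF n h0) n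
        have h5 := Fi_nonneg (τ := τ) (hF.nice r h0) n i
        have e : Rt ρ n r = mol (eta d n) (ρ r) := rfl
        rw [e] at h4
        linarith
      have h3 : 0 ≤ ∑ i, C' i := Finset.sum_nonneg fun i _ => hC' i
      rw [norm_eq_abs, abs_le]
      constructor
      · exact le_trans (by linarith [le_abs_self l]) (le_max_right _ _)
      · exact max_le (by linarith [abs_nonneg l]) (by linarith [neg_le_abs l])
    · have hne : ∀ᵐ r : ℝ, r ≠ t := by simp [ae_iff, measure_singleton]
      filter_upwards [hn, hne] with r hr hne hr1
      rw [uIoc_of_le hst] at hr1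
      have h0 : 0 ≤ r := hs.trans hr1.1.le
      have hv := hl r ⟨hr1.1, lt_of_le_of_ne hr1.2 hne⟩
      have ev : ∀ᶠ n in atTop, l < ∑ i, Qi τ (ρ r) (G' (mu (ρ r))) (G' (mu (mol (eta d n) (ρ r)))) n i := by
        by_contra hcon
        rw [not_eventually] at hcon
        exact absurd hv (not_lt.2 (diss_lower hS hτ hc (hF.nice r h0) (hcon.mono fun n hn => not_lt.1 hn)))
      refine tendsto_const_nhds.congr' ?_
      filter_upwards [ev] with n hn1
      rw [max_eq_right]
      linarith [hr hr1 n]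
  have le : ∀ n, En G τ ρ n t - En G τ ρ n s ≤ ∫ r in s..t, max (deriv (En G τ ρ n) r) (-l) := fun n => by
    rw [← (ac n).integral_deriv_eq_sub]
    have i1 := (ac n).intervalIntegrable_deriv
    refine intervalIntegral.integral_mono_on hst i1 ?_ fun r _ => le_max_left _ _
    rw [intervalIntegrable_iff_integrableOn_Ioc_of_le hst] at i1 ⊢
    exact i1.sup (integrable_const _)
  have l1 := Fr_tendsto hS hτ hc (hF.nice t (hs.trans hst))
  have l2 := Fr_tendsto hS hτ hc (hF.nice s hs)
  have := le_of_tendsto_of_tendsto' (l1.sub l2) lim le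
  rw [intervalIntegral.integral_const, smul_eq_mul] at this
  linarith

end

section

variable {d : ℕ}

/-- quadratically bounded measurable functions -/
structure QB (K : ℝ) (f : Ed d → ℝ) : Prop where
  meas : Measurable f
  bd : ∀ x, |f x| ≤ K * (1 + ‖x‖ ^ 2)

/-- weighted mean -/
def cen (a : ℝ) (f : Ed d → ℝ) : ℝ := (∫ x, f x * wg d a x) / ∫ x, wg d a x

variable {K a : ℝ} {f g : Ed d → ℝ}

lemma QB.K0 (h : QB K f) : 0 ≤ K := by
  have := (abs_nonneg _).trans (h.bd 0)
  simpa using this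

lemma QB.PB (h : QB K f) : PB (fun (_ : Unit) => f) := ⟨K, 1, h.K0, fun _ x => by simpa using h.bd x⟩

lemma PB.wg_integ {f : Ed d → ℝ} (h : WGF.PB (fun (_ : Unit) => f)) (hm : Measurable f) (ha : 0 < a) : Integrable (fun x => f x * wg d a x) := by
  have g1 : GB (fun (_ : Unit) (x : Ed d) => wg d a x) := GB.gauss ha
  exact (h.mul_GB g1).integrable () (hm.mul (wg_cont a).measurable).aestronglyMeasurable

lemma QB.integ1 (h : QB K f) (ha : 0 < a) : Integrable (fun x => f x * wg d a x) := h.PB.wg_integ h.meas ha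

lemma QB.integ2 (h : QB K f) (ha : 0 < a) : Integrable (fun x => f x ^ 2 * wg d a x) := h.PB.sq.wg_integ (h.meas.pow_const 2) ha

lemma QB.sub (h : QB K f) {K' : ℝ} (h' : QB K' g) : QB (K + K') (fun x => f x - g x) where
  meas := h.meas.sub h'.meas
  bd x := (abs_sub _ _).trans ((add_le_add (h.bd x) (h'.bd x)).trans (by rw [add_mul]))

lemma QB.add (h : QB K f) {K' : ℝ} (h' : QB K' g) : QB (K + K') (fun x => f x + g x) where
  meas := h.meas.add h'.meas
  bd x := (abs_add_le _ _).trans ((add_le_add (h.bd x) (h'.bd x)).trans (by rw [add_mul]))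

lemma QB.mono (h : QB K f) {K' : ℝ} (h' : K ≤ K') : QB K' f where
  meas := h.meas
  bd x := (h.bd x).trans (by gcongr)

lemma QB.const (c : ℝ) : QB |c| (fun _ : Ed d => c) where
  meas := measurable_const
  bd x := by nlinarith [abs_nonneg c, sq_nonneg ‖x‖]

lemma QB.normsq : QB 1 (fun x : Ed d => ‖x‖ ^ 2) where
  meas := by fun_prop
  bd x := by rw [abs_of_nonneg (by positivity)]; linarith

lemma QB.one : QB 1 (fun x : Ed d => 1 + ‖x‖ ^ 2) where
  meas := by fun_prop
  bd x := by rw [abs_of_nonneg (by positivity)]; linarith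

lemma QB.cen_le (h : QB K f) (ha : 0 < a) : |cen a f| ≤ K * cen (d := d) a (fun x => 1 + ‖x‖^2) := by
  rw [cen, cen, abs_div, abs_of_pos (wg_int_pos (d := d) ha), ← mul_div_assoc]
  refine div_le_div_of_nonneg_right ?_ (wg_int_pos (d := d) ha).le
  refine abs_integral_le_integral_abs.trans ?_
  rw [← integral_const_mul]
  refine integral_mono (h.integ1 ha).abs ((QB.one.integ1 ha).const_mul K) fun x => ?_
  simp only [abs_mul, abs_of_pos (wg_pos (d := d) a x), ← mul_assoc]
  exact mul_le_mul_of_nonneg_right (h.bd x) (wg_pos (d := d) a x).le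

lemma QB.sub_cen (h : QB K f) (ha : 0 < a) : QB (K * (1 + cen (d := d) a (fun x => 1 + ‖x‖^2))) (fun x => f x - cen a f) :=
  (h.sub (QB.const (cen a f))).mono (by rw [mul_add, mul_one]; gcongr; exact h.cen_le ha)

lemma QB.cen_lin (h : QB K f) (ha : 0 < a) {K' : ℝ} (h' : QB K' g) : cen a (fun x => f x - g x) = cen a f - cen a g := by
  rw [cen, cen, cen, ← sub_div, ← integral_sub (h.integ1 ha) (h'.integ1 ha)]
  simp only [sub_mul]

lemma QB.var_eq (h : QB K f) (ha : 0 < a) : ∫ x, (f x - cen a f)^2 * wg d a x = var a f / ∫ x, wg d a x := by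
  have i1 := h.integ1 ha
  have i2 := h.integ2 ha
  have i3 := wg_integ (d := d) ha
  have hW := wg_int_pos (d := d) ha
  have e : ∫ x, (f x - cen a f)^2 * wg d a x = (∫ x, f x ^ 2 * wg d a x) - 2 * cen a f * (∫ x, f x * wg d a x) + (cen a f)^2 * ∫ x, wg d a x := by
    have i4 : Integrable (fun x => f x^2*wg d a x - 2*cen a f*(f x*wg d a x)) := i2.sub (i1.const_mul _)
    rw [← integral_const_mul, ← integral_const_mul, ← integral_sub i2 (i1.const_mul _), ← integral_add i4 (i3.const_mul _)]
    congr 1; ext x; ring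
  rw [e, var, cen]
  field_simp
  ring

lemma QB.var_nonneg (h : QB K f) (ha : 0 < a) : 0 ≤ var a f := by
  have h1 : 0 ≤ ∫ x, (f x - cen a f)^2 * wg d a x := integral_nonneg fun x => mul_nonneg (sq_nonneg _) (wg_pos a x).le
  rw [h.var_eq ha] at h1
  have hW := wg_int_pos (d := d) ha
  by_contra hc
  exact absurd h1 (not_le.2 (div_neg_of_neg_of_pos (not_le.1 hc) hW))

lemma QB.var_le (h : QB K f) (ha : 0 < a) : var a f ≤ (∫ x, wg d a x) * (K^2 * ∫ x : Ed d, (1 + ‖x‖^2)^2 * wg d a x) := by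
  have hW := wg_int_pos (d := d) ha
  rw [var]
  have : ∫ x, f x ^ 2 * wg d a x ≤ K^2 * ∫ x : Ed d, (1 + ‖x‖^2)^2 * wg d a x := by
    rw [← integral_const_mul]
    refine integral_mono (h.integ2 ha) ((QB.one.integ2 ha).const_mul _) fun x => ?_
    simp only [← mul_assoc]
    refine mul_le_mul_of_nonneg_right ?_ (wg_pos (d := d) a x).le
    rw [← mul_pow, ← sq_abs]
    exact pow_le_pow_left₀ (abs_nonneg _) (h.bd x) 2
  nlinarith [sq_nonneg (∫ x, f x * wg d a x)]

lemma QB.var_add (h : QB K f) (ha : 0 < a) {K' : ℝ} (h' : QB K' g) : var a g ≤ 2 * var a f + 2 * var a (fun x => g x - f x) := by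
  have hW := wg_int_pos (d := d) ha
  have e1 := h.var_eq ha
  have e2 := h'.var_eq ha
  have e3 := (h'.sub h).var_eq ha
  have j1 := (h.sub_cen ha).integ2 ha
  have j2 := (h'.sub_cen ha).integ2 ha
  have j3 := ((h'.sub h).sub_cen ha).integ2 ha
  have key : ∫ x, (g x - cen a g)^2 * wg d a x ≤ 2 * (∫ x, (f x - cen a f)^2 * wg d a x) + 2 * ∫ x, (g x - f x - cen a (fun x => g x - f x))^2 * wg d a x := by
    rw [← integral_const_mul, ← integral_const_mul, ← integral_add (j1.const_mul 2) (j3.const_mul 2)]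
    refine integral_mono j2 ((j1.const_mul 2).add (j3.const_mul 2)) fun x => ?_
    simp only [h'.cen_lin ha h, ← mul_assoc, ← add_mul]
    refine mul_le_mul_of_nonneg_right ?_ (wg_pos (d := d) a x).le
    nlinarith [sq_nonneg ((f x - cen a f) - (g x - f x - (cen a g - cen a f)))]
  rw [e1, e2, e3] at key
  have := mul_le_mul_of_nonneg_right key hW.le
  rw [add_mul, mul_assoc, mul_assoc] at this
  simpa only [div_mul_cancel₀ _ hW.ne'] using this

lemma exists_unit (hd : d ≠ 0) : ∃ e : Ed d, ‖e‖ = 1 := 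
  ⟨EuclideanSpace.single ⟨0, Nat.pos_of_ne_zero hd⟩ 1, norm_single_one _⟩

lemma int_pos_aux {f : Ed d → ℝ} (hc : Continuous f) {x : Ed d} (hi : Integrable f) (h0 : ∀ x, 0 ≤ f x) (hx : f x ≠ 0) : 0 < ∫ x, f x :=
  (integral_pos_iff_support_of_nonneg h0 hi).2 (hc.isOpen_support.measure_pos _ ⟨x, hx⟩)

lemma Cp_pos (hd : d ≠ 0) (ha : 0 < a) : 0 < Cp d a := by
  obtain ⟨e, he⟩ := exists_unit hd
  have : 0 < ∫ y : Ed d, ‖y‖^2 * wg d a y := by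
    have hc : Continuous fun y : Ed d => ‖y‖^2 * wg d a y := (by fun_prop : Continuous fun y : Ed d => ‖y‖^2).mul (wg_cont a)
    refine int_pos_aux hc (x := e) (QB.normsq.integ1 ha) (fun y => mul_nonneg (sq_nonneg _) (wg_pos a y).le) ?_
    rw [he, one_pow, one_mul]; exact (wg_pos (d := d) a e).ne'
  exact mul_pos (by positivity) this

lemma var_normsq_pos (hd : d ≠ 0) (ha : 0 < a) : 0 < var a (fun x : Ed d => ‖x‖^2) := by
  obtain ⟨e, he⟩ := exists_unit hd
  have hW := wg_int_pos (d := d) ha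
  have h := (QB.normsq (d := d)).var_eq ha
  set c := cen a (fun x : Ed d => ‖x‖^2)
  have : 0 < ∫ x : Ed d, (‖x‖^2 - c)^2 * wg d a x := by
    have hc : Continuous fun x : Ed d => (‖x‖^2 - c)^2 * wg d a x := (by fun_prop : Continuous fun x : Ed d => (‖x‖^2 - c)^2).mul (wg_cont a)
    by_cases h0 : c = 0
    · refine int_pos_aux hc (x := e) ((QB.normsq.sub_cen ha).integ2 ha) (fun y => mul_nonneg (sq_nonneg _) (wg_pos a y).le) ?_
      rw [he, h0]; have := wg_pos (d := d) a e; norm_num; positivity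
    · refine int_pos_aux hc (x := 0) ((QB.normsq.sub_cen ha).integ2 ha) (fun y => mul_nonneg (sq_nonneg _) (wg_pos a y).le) ?_
      have := wg_pos (d := d) a 0; norm_num; exact ⟨h0, this.ne'⟩
  rw [h] at this
  exact (div_pos_iff_of_pos_right hW).1 this

lemma holder_pt {θ a₁ a₂ : ℝ} (h0 : 0 < θ) (h1 : θ < 1) (h : ℝ) (x : Ed d) : h^2 * wg d a₂ x = (h^2 * wg d a₁ x)^θ * (h^2 * wg d ((a₂ - θ * a₁)/(1-θ)) x)^(1-θ) := by
  rw [mul_rpow (sq_nonneg _) (wg_pos _ _).le, mul_rpow (sq_nonneg _) (wg_pos _ _).le]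
  have e1 : (h^2)^θ * (h^2)^(1-θ) = h^2 := by
    rw [← rpow_add_of_nonneg (sq_nonneg _) h0.le (by linarith)]; simp
  have e2 : (wg d a₁ x)^θ * (wg d ((a₂ - θ * a₁)/(1-θ)) x)^(1-θ) = wg d a₂ x := by
    simp only [wg]
    rw [← exp_mul, ← exp_mul, ← exp_add]
    congr 1
    have : 1 - θ ≠ 0 := by linarith
    field_simp
    ring
  calc h^2 * wg d a₂ x = ((h^2)^θ * (h^2)^(1-θ)) * ((wg d a₁ x)^θ * (wg d ((a₂ - θ * a₁)/(1-θ)) x)^(1-θ)) := by rw [e1, e2]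
    _ = _ := by ring

lemma holder_int {X Y : Ed d → ℝ} (hX : Integrable X) (hY : Integrable Y) (hX0 : ∀ x, 0 ≤ X x) (hY0 : ∀ x, 0 ≤ Y x) {A B θ : ℝ} (hA : 0 < A) (hB : 0 < B)
    (hXA : ∫ x, X x ≤ A) (hYB : ∫ x, Y x ≤ B) (h0 : 0 < θ) (h1 : θ < 1) : ∫ x, X x ^ θ * Y x ^ (1-θ) ≤ A^θ * B^(1-θ) := by
  have pt : ∀ x, X x ^ θ * Y x ^ (1-θ) ≤ (A^θ * B^(1-θ)) * (θ * (A⁻¹ * X x) + (1-θ) * (B⁻¹ * Y x)) := fun x => by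
    have := Real.geom_mean_le_arith_mean2_weighted (w₁ := θ) (w₂ := 1-θ) (p₁ := A⁻¹ * X x) (p₂ := B⁻¹ * Y x) h0.le (by linarith) 
      (mul_nonneg (by positivity) (hX0 x)) (mul_nonneg (by positivity) (hY0 x)) (by ring)
    rw [mul_rpow (by positivity) (hX0 x), mul_rpow (by positivity) (hY0 x), inv_rpow hA.le, inv_rpow hB.le] at this
    have p1 : 0 < A^θ := rpow_pos_of_pos hA _
    have p2 : 0 < B^(1-θ) := rpow_pos_of_pos hB _
    have := mul_le_mul_of_nonneg_left this (mul_pos p1 p2).le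
    refine le_of_eq_of_le ?_ this
    field_simp
  have i : Integrable (fun x => (A^θ * B^(1-θ)) * (θ * (A⁻¹ * X x) + (1-θ) * (B⁻¹ * Y x))) := 
    (((hX.const_mul A⁻¹).const_mul θ).add ((hY.const_mul B⁻¹).const_mul (1-θ))).const_mul _
  refine (integral_mono_of_nonneg (ae_of_all _ fun x => mul_nonneg (rpow_nonneg (hX0 x) _) (rpow_nonneg (hY0 x) _)) i (ae_of_all _ pt)).trans ?_
  rw [integral_const_mul, integral_add ((hX.const_mul A⁻¹).const_mul θ) ((hY.const_mul B⁻¹).const_mul (1-θ)), integral_const_mul, integral_const_mul, integral_const_mul, integral_const_mul]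
  have p1 : 0 ≤ A^θ * B^(1-θ) := by positivity
  refine mul_le_of_le_one_right p1 ?_
  have q1 : A⁻¹ * ∫ x, X x ≤ 1 := by rw [inv_mul_le_iff₀ hA]; linarith
  have q2 : B⁻¹ * ∫ x, Y x ≤ 1 := by rw [inv_mul_le_iff₀ hB]; linarith
  nlinarith

/-- weighted interpolation with uniform constants -/
theorem holder (d : ℕ) (K : ℝ) {a₁ a₂ θ : ℝ} (ha : 0 < a₁) (h0 : 0 < θ) (h1 : θ < 1) (hθ : θ * a₁ < a₂) : ∃ B, 0 < B ∧ ∀ f : Ed d → ℝ, QB K f → 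
    ∀ y, 0 < y → var a₁ f ≤ y → ∫ x, (f x - cen a₁ f)^2 * wg d a₂ x ≤ B * y ^ θ := by
  have hb : 0 < (a₂ - θ * a₁)/(1-θ) := div_pos (by linarith) (by linarith)
  have hW := wg_int_pos (d := d) ha
  set K' := K * (1 + cen (d := d) a₁ (fun x => 1 + ‖x‖^2)) with hK'
  set I := ∫ x : Ed d, (1 + ‖x‖^2)^2 * wg d ((a₂ - θ * a₁)/(1-θ)) x with hI
  have hI0 : 0 ≤ I := integral_nonneg fun x => mul_nonneg (sq_nonneg _) (wg_pos _ x).le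
  have hBp : 0 < K'^2 * I + 1 := by positivity
  refine ⟨((∫ x, wg d a₁ x)⁻¹)^θ * (K'^2 * I + 1)^(1-θ), by positivity, fun f hf y hy hv => ?_⟩
  have hq := hf.sub_cen ha
  have eq : ∀ x, (f x - cen a₁ f)^2 * wg d a₂ x = _ := fun x => holder_pt (a₁ := a₁) (a₂ := a₂) h0 h1 (f x - cen a₁ f) x
  simp only [eq]
  have hA : 0 < (∫ x, wg d a₁ x)⁻¹ * y := by positivity
  refine (holder_int (hq.integ2 ha) (hq.integ2 hb) (fun x => mul_nonneg (sq_nonneg _) (wg_pos _ x).le) (fun x => mul_nonneg (sq_nonneg _) (wg_pos _ x).le) hA hBp ?_ ?_ h0 h1).trans (le_of_eq ?_)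
  · rw [hf.var_eq ha, div_eq_inv_mul]; gcongr
  · refine le_trans ?_ (le_add_of_nonneg_right zero_le_one)
    rw [hI, ← integral_const_mul]
    refine integral_mono (hq.integ2 hb) ((QB.one.integ2 hb).const_mul _) fun x => ?_
    simp only [← mul_assoc]
    refine mul_le_mul_of_nonneg_right ?_ (wg_pos (d := d) _ x).le
    rw [← mul_pow, ← sq_abs]
    exact pow_le_pow_left₀ (abs_nonneg _) (hq.bd x) 2
  · rw [mul_rpow (by positivity) hy.le]; ring

end

section

open scoped ContDiff
variable {d : ℕ} {c₀ a₁ C₀ a₂ α L τ : ℝ} {G : Measure (Ed d) → ℝ} {G' : Measure (Ed d) → Ed d → ℝ} {ρ : ℝ → Ed d → ℝ}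

/-- first variation of the free energy along the flow -/
def fv (G' : Measure (Ed d) → Ed d → ℝ) (τ : ℝ) (ρ : ℝ → Ed d → ℝ) (t : ℝ) (x : Ed d) : ℝ :=
  G' (mu (ρ t)) x + τ * log (ρ t x)

/-- log-growth constant -/
def LG (c₀ a₁ C₀ a₂ : ℝ) : ℝ := |log c₀| + |log C₀| + a₁ + a₂

lemma QB.const_mul {K : ℝ} {f : Ed d → ℝ} (h : QB K f) (c : ℝ) : QB (|c| * K) (fun x => c * f x) where
  meas := h.meas.const_mul c
  bd x := by rw [abs_mul, mul_assoc]; exact mul_le_mul_of_nonneg_left (h.bd x) (abs_nonneg c)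

lemma Nice.QBlog {ρ : Ed d → ℝ} (h : Nice c₀ a₁ C₀ a₂ ρ) : QB (LG c₀ a₁ C₀ a₂) (fun x => log (ρ x)) where
  meas := h.meas.log
  bd x := h.log_le x

lemma fv_QB (hF : Flow G' τ c₀ a₁ C₀ a₂ α L ρ) {t : ℝ} (ht : 0 ≤ t) :
    QB (|α| + |L| + |τ| * LG c₀ a₁ C₀ a₂) (fv G' τ ρ t) :=
  QB.add ⟨(hF.pot t ht).meas, (hF.pot t ht).le⟩ ((hF.nice t ht).QBlog.const_mul τ)

lemma E_anti (hd : d ≠ 0) (hS : Setup G G' α L) (hτ : 0 < τ) (hc : ConvexFun (obj G τ)) (hF : Flow G' τ c₀ a₁ C₀ a₂ α L ρ)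
    {s t : ℝ} (hs : 0 ≤ s) (hst : s ≤ t) : Fr G τ (ρ t) ≤ Fr G τ (ρ s) := by
  have hN := hF.nice 0 le_rfl
  have hCp := Cp_pos hd hN.a₁pos
  refine le_of_forall_pos_le_add fun ε hε => ?_
  have h1 : 0 < t - s + 1 := by linarith
  have := edi (l := -(ε / (t - s + 1))) hS hτ hc hF hs hst fun r hr => by
    have hv := (fv_QB hF (hs.trans hr.1.le)).var_nonneg hN.a₁pos
    have : 0 ≤ c₀ * exp (-a₁) * var a₁ (fv G' τ ρ r) := mul_nonneg (mul_pos hN.c₀pos (exp_pos _)).le hv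
    refine lt_of_lt_of_le ?_ this
    have : 0 < ε / (t - s + 1) := by positivity
    nlinarith
  have h2 : ε / (t - s + 1) * (t - s) ≤ ε := by
    rw [div_mul_eq_mul_div, div_le_iff₀ h1]; nlinarith
  linarith

lemma E_lb (hS : Setup G G' α L) (hτ : 0 < τ) (hc : ConvexFun (obj G τ)) (hF : Flow G' τ c₀ a₁ C₀ a₂ α L ρ) :
    ∃ C, ∀ t, 0 ≤ t → C ≤ Fr G τ (ρ t) := by
  have q := (fv_QB hF le_rfl).PB.comp (fun _ : NT => ())
  have g := q.mul_GB ((flow_ρ hF).sub ((flow_ρ hF).comp (fun _ : NT => (⟨0, le_rfl⟩ : NT))))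
  obtain ⟨C, hC0, hC⟩ := g.abs_integral_le
  refine ⟨Fr G τ (ρ 0) - C, fun t ht => ?_⟩
  have h1 := weak_ineq hS hτ hc (hF.nice 0 le_rfl) (hF.nice t ht).dens
  have h2 := (abs_le.1 (hC ⟨t, ht⟩)).1
  simp only [fv] at h2
  linarith

lemma exists_small (hd : d ≠ 0) (hS : Setup G G' α L) (hτ : 0 < τ) (hc : ConvexFun (obj G τ)) (hF : Flow G' τ c₀ a₁ C₀ a₂ α L ρ)
    {ε : ℝ} (hε : 0 < ε) : ∃ r, 0 ≤ r ∧ var a₁ (fv G' τ ρ r) ≤ ε := by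
  by_contra! hcon
  have hN := hF.nice 0 le_rfl
  have hCp := Cp_pos hd hN.a₁pos
  obtain ⟨C, hC⟩ := E_lb hS hτ hc hF
  have hb : 0 < c₀ * exp (-a₁) := mul_pos hN.c₀pos (exp_pos _)
  set l := c₀ * exp (-a₁) * ε / (2 * Cp d a₁) with hl
  have hl0 : 0 < l := by positivity
  have key : ∀ t, 0 ≤ t → Fr G τ (ρ t) ≤ Fr G τ (ρ 0) - l * (t - 0) := fun t ht => 
    edi hS hτ hc hF le_rfl ht fun r hr => by
      have e : 2 * Cp d a₁ * l = c₀ * exp (-a₁) * ε := by rw [hl]; field_simp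
      rw [e]
      exact mul_lt_mul_of_pos_left (hcon r hr.1.le) hb
  have hx := hC 0 le_rfl
  have ht0 : 0 ≤ (Fr G τ (ρ 0) - C + 1) / l := by apply div_nonneg <;> linarith
  have h1 := key _ ht0
  have h2 := hC _ ht0
  rw [sub_zero, mul_div_cancel₀ _ hl0.ne'] at h1
  linarith

lemma var_const_mul (a c : ℝ) (f : Ed d → ℝ) : var a (fun x => c * f x) = c^2 * var a f := by
  simp only [var, mul_pow, mul_assoc]
  rw [integral_const_mul, integral_const_mul]; ring

/-- uniform bound for the confinement constant -/
def Amax (d : ℕ) (c₀ a₁ C₀ a₂ L τ : ℝ) : ℝ := 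
  2 * √((2 + 2 * ((∫ x, wg d a₁ x) * ((|L| + |τ| * LG c₀ a₁ C₀ a₂)^2 * ∫ x : Ed d, (1 + ‖x‖^2)^2 * wg d a₁ x))) / var a₁ (fun x : Ed d => ‖x‖^2))

lemma alpha_le (hd : d ≠ 0) (hS : Setup G G' α L) (hτ : 0 < τ) (hc : ConvexFun (obj G τ)) (hF : Flow G' τ c₀ a₁ C₀ a₂ α L ρ) :
    |α| ≤ Amax d c₀ a₁ C₀ a₂ L τ := by
  have ha := (hF.nice 0 le_rfl).a₁pos
  have hV := var_normsq_pos hd ha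
  obtain ⟨r, hr, hv⟩ := exists_small hd hS hτ hc hF one_pos
  have q1 := fv_QB hF hr
  have q2 : QB (|α/2| * 1) (fun x : Ed d => α/2 * ‖x‖^2) := QB.normsq.const_mul (α/2)
  have hP := hF.pot r hr
  have q3 : QB (|L|) (fun x : Ed d => α/2 * ‖x‖^2 - G' (mu (ρ r)) x) := ⟨by have := hP.meas; fun_prop, fun x => by
    rw [abs_sub_comm]
    refine (hP.bd x).trans ?_
    have : ‖x‖ ≤ 1 + ‖x‖^2 := by nlinarith [sq_nonneg (‖x‖ - 1)]
    exact (mul_le_mul_of_nonneg_right (le_abs_self L) (norm_nonneg x)).trans (mul_le_mul_of_nonneg_left this (abs_nonneg L))⟩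
  have q4 : QB (|L| + |τ| * LG c₀ a₁ C₀ a₂) (fun x : Ed d => α/2 * ‖x‖^2 - fv G' τ ρ r x) := by
    have := q3.sub ((hF.nice r hr).QBlog.const_mul τ)
    simp only [sub_sub] at this
    exact this
  have h1 := q1.var_add ha q2
  have h2 := q4.var_le ha
  rw [var_const_mul] at h1
  have h3 : (α/2)^2 ≤ (2 + 2 * ((∫ x, wg d a₁ x) * ((|L| + |τ| * LG c₀ a₁ C₀ a₂)^2 * ∫ x : Ed d, (1 + ‖x‖^2)^2 * wg d a₁ x))) / var a₁ (fun x : Ed d => ‖x‖^2) := by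
    rw [le_div_iff₀ hV]; linarith
  have h4 := abs_le_sqrt h3
  rw [abs_div, abs_two] at h4
  rw [Amax]; linarith

lemma fv_QB' (hd : d ≠ 0) (hS : Setup G G' α L) (hτ : 0 < τ) (hc : ConvexFun (obj G τ)) (hF : Flow G' τ c₀ a₁ C₀ a₂ α L ρ) {t : ℝ} (ht : 0 ≤ t) :
    QB (Amax d c₀ a₁ C₀ a₂ L τ + |L| + |τ| * LG c₀ a₁ C₀ a₂) (fv G' τ ρ t) :=
  (fv_QB hF ht).mono (by have := alpha_le hd hS hτ hc hF; linarith)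

lemma center_int {K c : ℝ} {f k ρ : Ed d → ℝ} (hf : QB K f) (hk : Dens k) (hρ : Dens ρ) :
    ∫ x, f x * (k x - ρ x) = (∫ x, (f x - c) * k x) - ∫ x, (f x - c) * ρ x := by
  have i1 : Integrable (fun x => (f x - c) * k x) := hk.integrable_mul (hf.sub (QB.const c)).meas (hf.sub (QB.const c)).bd
  have i2 : Integrable (fun x => (f x - c) * ρ x) := hρ.integrable_mul (hf.sub (QB.const c)).meas (hf.sub (QB.const c)).bd
  have i3 : Integrable (fun x => (f x - c) * k x - (f x - c) * ρ x) := i1.sub i2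
  have i4 : Integrable (fun x => c * k x - c * ρ x) := (hk.integ.const_mul c).sub (hρ.integ.const_mul c)
  have e : ∀ x, f x * (k x - ρ x) = ((f x - c) * k x - (f x - c) * ρ x) + (c * k x - c * ρ x) := fun x => by ring
  simp only [e]
  rw [integral_add i3 i4, integral_sub i1 i2, integral_sub (hk.integ.const_mul c) (hρ.integ.const_mul c), integral_const_mul, integral_const_mul, hk.int1, hρ.int1]
  ring

lemma f_ineq (hS : Setup G G' α L) (hτ : 0 < τ) (hc : ConvexFun (obj G τ)) (hδ : tauC G < τ) (hF : Flow G' τ c₀ a₁ C₀ a₂ α L ρ) {t T : ℝ} (ht : 0 ≤ t) (hT : 0 ≤ T) :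
    Fr G τ (ρ t) - Fr G τ (ρ T) ≤ C₀ / (τ - tauC G) * ∫ x, (fv G' τ ρ t x - cen a₁ (fv G' τ ρ t))^2 * wg d a₂ x := by
  have hN := hF.nice t ht
  have hM := hF.nice T hT
  have q := fv_QB hF ht
  have hs := strong_ineq hS hτ hc hN hM.dens
  have hδ' : 0 < τ - tauC G := by linarith
  set δ := τ - tauC G
  set c := cen a₁ (fv G' τ ρ t)
  have hcen : ∫ x, (G' (mu (ρ t)) x + τ * log (ρ t x)) * (ρ T x - ρ t x) = (∫ x, (fv G' τ ρ t x - c) * ρ T x) - ∫ x, (fv G' τ ρ t x - c) * ρ t x := center_int (c := c) q hM.dens hN.dens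
  have qc := q.sub_cen hN.a₁pos
  have i1 : Integrable (fun x => (fv G' τ ρ t x - c) * ρ T x) := hM.dens.integrable_mul qc.meas qc.bd
  have i2 : Integrable (fun x => (fv G' τ ρ t x - c) * ρ t x) := hN.dens.integrable_mul qc.meas qc.bd
  have i3 : Integrable (fun x => (fv G' τ ρ t x - c) * ρ t x - (fv G' τ ρ t x - c) * ρ T x) := i2.sub i1
  have i4 := kl_integrable hN hM.dens
  have i5 : Integrable (fun x => (fv G' τ ρ t x - c) * ρ t x - (fv G' τ ρ t x - c) * ρ T x - δ * kld (ρ T x) (ρ t x)) := i3.sub (i4.const_mul δ)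
  rw [hcen, kl_eq hN hM.dens] at hs
  have h1 : ∫ x, ((fv G' τ ρ t x - c) * ρ t x - (fv G' τ ρ t x - c) * ρ T x - δ * kld (ρ T x) (ρ t x)) ≤ C₀ / δ * ∫ x, (fv G' τ ρ t x - c)^2 * wg d a₂ x := by
    rw [← integral_const_mul]
    refine integral_mono i5 ((qc.integ2 hN.a₂pos).const_mul _) fun x => ?_
    have y := young (h := fv G' τ ρ t x - c) (hN.pos x) (hM.pos x).le hδ'
    have hm : max (ρ T x) (ρ t x) ≤ C₀ * wg d a₂ x := max_le (hM.ub x) (hN.ub x)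
    calc _ = (fv G' τ ρ t x - c) * (ρ t x - ρ T x) - δ * kld (ρ T x) (ρ t x) := by ring
      _ ≤ _ := y
      _ ≤ (fv G' τ ρ t x - c)^2 * (C₀ * wg d a₂ x) / δ := by gcongr
      _ = _ := by ring
  rw [integral_sub i3 (i4.const_mul δ), integral_sub i2 i1, integral_const_mul] at h1
  linarith

lemma ae_zero {X : ℕ → Ed d → ℝ} (hX : ∀ n, Integrable (X n)) (h0 : ∀ n x, 0 ≤ X n x) {c : ℝ} (hc : ∀ n, ∫ x, X n x ≤ c * (1/2)^n) :
    ∀ᵐ x, Tendsto (fun n => X n x) atTop (𝓝 0) := by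
  have hm : ∀ n, AEMeasurable (fun x => ENNReal.ofReal (X n x)) := fun n => (hX n).aemeasurable.ennreal_ofReal
  have h1 : ∫⁻ x, ∑' n, ENNReal.ofReal (X n x) ≠ ⊤ := by
    rw [lintegral_tsum hm]
    have hs : Summable (fun n : ℕ => c * (1/2 : ℝ)^n) := (summable_geometric_two).mul_left c
    refine ne_top_of_le_ne_top (hs.tsum_ofReal_ne_top) (ENNReal.tsum_le_tsum fun n => ?_)
    rw [← ofReal_integral_eq_lintegral_ofReal (hX n) (ae_of_all _ (h0 n))]
    exact ENNReal.ofReal_le_ofReal (hc n)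
  have h2 := ae_lt_top' (AEMeasurable.tsum hm) h1
  filter_upwards [h2] with x hx
  have h3 := ENNReal.tendsto_atTop_zero_of_tsum_ne_top hx.ne
  have h4 := (ENNReal.tendsto_toReal ENNReal.zero_ne_top).comp h3
  simpa [Function.comp_def, ENNReal.toReal_ofReal (h0 _ x)] using h4

/-- the infimum along the flow is the global infimum -/
lemma inf_flow (hd : d ≠ 0) (hS : Setup G G' α L) (hτ : 0 < τ) (hc : ConvexFun (obj G τ)) (hF : Flow G' τ c₀ a₁ C₀ a₂ α L ρ)
    {m : ℝ} (hm : ∀ t, 0 ≤ t → m ≤ Fr G τ (ρ t)) {ν : Ed d → ℝ} (hν : Dens ν) : m ≤ Fr G τ ν := by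
  have hN := hF.nice 0 le_rfl
  have ha := hN.a₁pos
  have hW := wg_int_pos (d := d) ha
  have : ∀ n : ℕ, ∃ r, 0 ≤ r ∧ var a₁ (fv G' τ ρ r) ≤ (1/2)^n := fun n => exists_small hd hS hτ hc hF (by positivity)
  choose r hr hv using this
  set h : ℕ → Ed d → ℝ := fun n x => fv G' τ ρ (r n) x - cen a₁ (fv G' τ ρ (r n)) with hh
  obtain ⟨K, q⟩ : ∃ K, ∀ n, QB K (h n) := ⟨_, fun n => (fv_QB hF (hr n)).sub_cen ha⟩
  have hae : ∀ᵐ x, Tendsto (fun n => h n x) atTop (𝓝 0) := by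
    have := ae_zero (X := fun n x => h n x^2 * wg d a₁ x) (c := (∫ x, wg d a₁ x)⁻¹) (fun n => (q n).integ2 ha) (fun n x => mul_nonneg (sq_nonneg _) (wg_pos _ _).le) fun n => by
      rw [(fv_QB hF (hr n)).var_eq ha, div_eq_inv_mul]
      exact mul_le_mul_of_nonneg_left (hv n) (by positivity)
    filter_upwards [this] with x hx
    have h1 := (hx.mul_const (wg d a₁ x)⁻¹).sqrt
    simp only [mul_assoc, mul_inv_cancel₀ (wg_pos (d := d) a₁ x).ne', mul_one, zero_mul, sqrt_zero, sqrt_sq_eq_abs] at h1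
    exact (tendsto_zero_iff_abs_tendsto_zero _).2 h1
  have t1 : Tendsto (fun n => ∫ x, h n x * ν x) atTop (𝓝 0) := by
    have := tendsto_integral_of_dominated_convergence (μ := (volume : Measure (Ed d))) (F := fun n x => h n x * ν x) (f := fun _ => 0) (fun x => K * (1 + ‖x‖^2) * ν x) 
      (fun n => ((q n).meas.mul hν.meas).aestronglyMeasurable) ?_ (fun n => ae_of_all _ fun x => ?_) ?_
    · simpa using this
    · exact hν.integrable_mul (by fun_prop) (K := K) fun x => by
        rw [abs_of_nonneg]; exact mul_nonneg (q 0).K0 (by positivity)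
    · rw [norm_mul, norm_eq_abs, norm_eq_abs, abs_of_nonneg (hν.nonneg x)]
      exact mul_le_mul_of_nonneg_right ((q n).bd x) (hν.nonneg x)
    · filter_upwards [hae] with x hx
      simpa using hx.mul_const (ν x)
  have t2 : Tendsto (fun n => ∫ x, h n x * ρ (r n) x) atTop (𝓝 0) := by
    have hP : PB h := ⟨K, 1, (q 0).K0, fun n x => by simpa using (q n).bd x⟩
    have hG := hP.mul_GB ((flow_ρ hF).comp (fun n : ℕ => (⟨r n, hr n⟩ : NT)))
    have := hG.tendsto (l := atTop) (f := fun _ => 0) (Eventually.of_forall fun n => ((q n).meas.mul (hF.nice _ (hr n)).meas).aestronglyMeasurable) ?_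
    · simpa using this
    · filter_upwards [hae] with x hx
      have hb : ∀ n, |h n x * ρ (r n) x| ≤ |h n x| * (C₀ * exp (-a₂ * ‖x‖^2)) := fun n => by
        have hn := hF.nice _ (hr n)
        rw [abs_mul, abs_of_pos (hn.pos x)]
        exact mul_le_mul_of_nonneg_left (hn.ub x) (abs_nonneg _)
      refine squeeze_zero_norm hb ?_
      have hx2 := hx.abs.mul_const (C₀ * exp (-a₂ * ‖x‖^2))
      rwa [abs_zero, zero_mul] at hx2
  have t3 : Tendsto (fun n => m + ((∫ x, h n x * ν x) - ∫ x, h n x * ρ (r n) x)) atTop (𝓝 (m + (0 - 0))) := (t1.sub t2).const_add m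
  rw [sub_zero, add_zero] at t3
  refine le_of_tendsto t3 (Eventually.of_forall fun n => ?_)
  have w := weak_ineq hS hτ hc (hF.nice _ (hr n)) hν
  have hcen : ∫ x, (G' (mu (ρ (r n))) x + τ * log (ρ (r n) x)) * (ν x - ρ (r n) x) = (∫ x, h n x * ν x) - ∫ x, h n x * ρ (r n) x := center_int (c := cen a₁ (fv G' τ ρ (r n))) (fv_QB hF (hr n)) hν (hF.nice _ (hr n)).dens
  rw [hcen] at w
  have := hm _ (hr n)
  linarith

end

section

/-- elementary discrete step -/
lemma one_step {q x : ℝ} (hq : 0 < q) (hx : 0 ≤ x) (hx1 : x ≤ 1) : (1 + x)^(-q) ≤ 1 - q/(2+q) * x := by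
  have h1 : x / 2 ≤ log (1 + x) := by
    have := one_sub_inv_le_log_of_pos (show 0 < 1 + x by linarith)
    refine le_trans ?_ this
    have : (1 + x)⁻¹ * (1 + x) = 1 := inv_mul_cancel₀ (by linarith)
    have h2 : 0 < (1+x)⁻¹ := by positivity
    nlinarith
  have h2 : (1 + x)^(-q) ≤ (1 + q * x / 2)⁻¹ := by
    rw [rpow_neg (by linarith)]
    refine inv_anti₀ (by positivity) ?_
    rw [rpow_def_of_pos (by linarith)]
    have := add_one_le_exp (log (1+x) * q)
    nlinarith
  refine h2.trans ?_
  rw [inv_le_iff_one_le_mul₀ (by positivity)]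
  have e : (1 - q/(2+q) * x) * (1 + q * x/2) = 1 + q^2/(2*(2+q)) * (x * (1 - x)) := by field_simp; ring
  rw [e]
  have : 0 ≤ q^2/(2*(2+q)) * (x * (1 - x)) := mul_nonneg (by positivity) (mul_nonneg hx (by linarith))
  linarith

lemma ode {g : ℝ → ℝ} {κ c : ℝ} (hκ : 0 < κ) (hc : 0 < c) (h0 : ∀ t, 0 ≤ t → 0 ≤ g t) (hanti : ∀ s t, 0 ≤ s → s ≤ t → g t ≤ g s)
    (hg : ∀ s t, 0 ≤ s → s ≤ t → 0 < g t → g t ≤ g s - c * g t ^ (1 + 1/κ) * (t - s)) {t : ℝ} (ht : 0 ≤ t) :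
    g t ≤ (g 0 ^ (-(1/κ)) + c * ((1/κ)/(2 + 1/κ)) * t)^(-κ) := by
  rcases (h0 t ht).eq_or_lt with hz | hpos
  · rw [← hz]
    have : 0 ≤ g 0 := h0 0 le_rfl
    positivity
  set q := 1/κ with hq
  have hq0 : 0 < q := by positivity
  have gp : ∀ s, 0 ≤ s → s ≤ t → 0 < g s := fun s hs hst => hpos.trans_le (hanti s t hs hst)
  have step : ∀ s r, 0 ≤ s → s ≤ r → r ≤ t → c * (r - s) ≤ g 0 ^ (-q) → g s ^ (-q) + c * (q/(2+q)) * (r - s) ≤ g r ^ (-q) := by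
    intro s r hs hsr hrt hsm
    have pr := gp r (hs.trans hsr) hrt
    have ps := gp s hs (hsr.trans hrt)
    have p0 := gp 0 le_rfl ht
    have hu0 : g 0 ^ (-q) ≤ g r ^ (-q) := rpow_le_rpow_of_nonpos pr (hanti 0 r le_rfl (hs.trans hsr)) (by linarith)
    have hu : 0 < g r ^ (-q) := by positivity
    set x := c * (r - s) * g r ^ q with hx
    have hux : g r ^ (-q) * g r ^ q = 1 := by rw [← rpow_add pr]; simp
    have hx0 : 0 ≤ x := by have : 0 ≤ r - s := by linarith
                           positivity
    have hx1 : x ≤ 1 := by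
      rw [← hux]; exact mul_le_mul_of_nonneg_right (hsm.trans hu0) (by positivity)
    have h1 : g r * (1 + x) ≤ g s := by
      have := hg s r hs hsr pr
      rw [rpow_add pr, rpow_one] at this
      rw [hx]; nlinarith
    have h2 : g s ^ (-q) ≤ g r ^ (-q) * (1 + x)^(-q) := by
      rw [← mul_rpow pr.le (by linarith)]
      exact rpow_le_rpow_of_nonpos (by positivity) h1 (by linarith)
    have h3 := one_step hq0 hx0 hx1
    have h4 : g r ^ (-q) * (1 + x)^(-q) ≤ g r ^ (-q) * (1 - q/(2+q) * x) := mul_le_mul_of_nonneg_left h3 hu.le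
    have h5 : g r ^ (-q) * (1 - q/(2+q) * x) = g r ^ (-q) - c * (q/(2+q)) * (r - s) := by
      rw [hx]; linear_combination (-(q/(2+q)) * c * (r - s)) * hux
    linarith
  have p0 := gp 0 le_rfl ht
  have hu0 : 0 < g 0 ^ (-q) := by positivity
  obtain ⟨N, hN⟩ := exists_nat_gt (c * t / g 0 ^ (-q))
  have hN0 : (0:ℝ) < N := lt_of_le_of_lt (by positivity) hN
  have hstep : c * (t / N) ≤ g 0 ^ (-q) := by
    rw [div_lt_iff₀ hu0] at hN
    rw [← mul_div_assoc, div_le_iff₀ hN0]; linarith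
  have ind : ∀ n : ℕ, n ≤ N → g 0 ^ (-q) + c * (q/(2+q)) * (n * (t/N)) ≤ g (n * (t/N)) ^ (-q) := by
    intro n
    induction n with
    | zero => intro _; simp
    | succ n ih =>
      intro hn
      have h1 := ih (by omega)
      have hn' : ((n:ℝ) + 1) ≤ N := by exact_mod_cast hn
      have htN : 0 ≤ t / N := by positivity
      have hlast : ((n:ℝ) + 1) * (t/N) ≤ t := by
        calc ((n:ℝ) + 1) * (t/N) ≤ N * (t/N) := by gcongr
          _ = t := by field_simp
      have h2 := step (n * (t/N)) ((n+1) * (t/N)) (by positivity) (by nlinarith) hlast (by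
        have : ((n:ℝ)+1) * (t/N) - n * (t/N) = t/N := by ring
        rwa [this])
      push_cast
      linarith
  have fin := ind N le_rfl
  rw [mul_div_cancel₀ _ hN0.ne'] at fin
  have hb : 0 < g 0 ^ (-q) + c * (q/(2+q)) * t := by positivity
  have := rpow_le_rpow_of_nonpos hb fin (show -κ ≤ 0 by linarith)
  rw [← rpow_mul hpos.le] at this
  have e : -q * -κ = 1 := by rw [hq]; field_simp
  rw [e, rpow_one] at this
  exact this

end

section

variable {d : ℕ}

theorem flow_rate (hd : d ≠ 0) {c₀ a₁ C₀ a₂ L τ κ : ℝ} (hτ : 0 < τ) (hc₀ : 0 < c₀) (ha₁ : 0 < a₁) (hC₀ : 0 < C₀) (hκ : 0 < κ)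
    (hκ1 : κ / (1 + κ) * a₁ < a₂) : ∃ C, 0 < C ∧ ∀ (α : ℝ) (G : Measure (Ed d) → ℝ) (G' : Measure (Ed d) → Ed d → ℝ) (ρ : ℝ → Ed d → ℝ),
      Setup G G' α L → ConvexFun (obj G τ) → tauC G < τ → Flow G' τ c₀ a₁ C₀ a₂ α L ρ → 
      ∃ m, (∀ t, 0 ≤ t → m ≤ Fr G τ (ρ t)) ∧ (∀ ν : Ed d → ℝ, Dens ν → m ≤ Fr G τ ν) ∧ (∀ b, (∀ t, 0 ≤ t → b ≤ Fr G τ (ρ t)) → b ≤ m) ∧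
        ∀ t, 0 ≤ t → Fr G τ (ρ t) - m ≤ ((Fr G τ (ρ 0) - m)^(-(1/κ)) + C * (τ - tauC G)^(1 + 1/κ) * t)^(-κ) := by
  have hθ0 : 0 < κ / (1 + κ) := by positivity
  have hθ1 : κ / (1 + κ) < 1 := by rw [div_lt_one (by positivity)]; linarith
  obtain ⟨B, hB, hol⟩ := holder d (Amax d c₀ a₁ C₀ a₂ L τ + |L| + |τ| * LG c₀ a₁ C₀ a₂) ha₁ hθ0 hθ1 hκ1
  have hCp := Cp_pos hd ha₁
  have he : 0 < c₀ * exp (-a₁) := mul_pos hc₀ (exp_pos _)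
  set p := 1 + 1/κ with hp
  set A := c₀ * exp (-a₁) / (2 * Cp d a₁) * (1 / (2 * C₀ * B))^p with hA
  have hA0 : 0 < A := by positivity
  refine ⟨A * ((1/κ)/(2 + 1/κ)), by positivity, fun α G G' ρ hS hc hδ hF => ?_⟩
  obtain ⟨C, hC⟩ := E_lb hS hτ hc hF
  set S : Set ℝ := (fun t => Fr G τ (ρ t)) '' Ici 0 with hSd
  have hne : S.Nonempty := ⟨_, 0, self_mem_Ici, rfl⟩
  have hbd : BddBelow S := ⟨C, by rintro _ ⟨t, ht, rfl⟩; exact hC t ht⟩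
  set m := sInf S with hm
  have h1 : ∀ t, 0 ≤ t → m ≤ Fr G τ (ρ t) := fun t ht => csInf_le hbd ⟨t, ht, rfl⟩
  have h3 : ∀ b, (∀ t, 0 ≤ t → b ≤ Fr G τ (ρ t)) → b ≤ m := fun b hb => le_csInf hne (by rintro _ ⟨t, ht, rfl⟩; exact hb t ht)
  refine ⟨m, h1, fun ν hν => inf_flow hd hS hτ hc hF h1 hν, h3, fun t ht => ?_⟩
  have hδ' : 0 < τ - tauC G := by linarith
  set δ := τ - tauC G with hδd
  have key := ode (g := fun t => Fr G τ (ρ t) - m) (c := A * δ^p) hκ (by positivity) (fun t ht => sub_nonneg.2 (h1 t ht)) 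
    (fun s t hs hst => sub_le_sub_right (E_anti hd hS hτ hc hF hs hst) m) (fun s t hs hst hg => ?_) ht
  · refine key.trans (le_of_eq ?_)
    ring_nf
  · set g := Fr G τ (ρ t) - m with hgd
    set y := (δ * g / (2 * C₀ * B))^p with hy
    have hy0 : 0 < y := by positivity
    have e1 : y ^ (κ / (1 + κ)) = δ * g / (2 * C₀ * B) := by
      rw [hy, ← rpow_mul (by positivity)]
      have : p * (κ / (1 + κ)) = 1 := by rw [hp]; field_simp; ring
      rw [this, rpow_one]
    have e2 : c₀ * exp (-a₁) / (2 * Cp d a₁) * y = A * δ^p * g^p := by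
      have : δ * g / (2 * C₀ * B) = (1 / (2 * C₀ * B)) * δ * g := by ring
      rw [hy, hA, this, mul_rpow (by positivity) (by positivity), mul_rpow (by positivity) (by positivity)]
      ring
    have ed := edi (l := c₀ * exp (-a₁) / (2 * Cp d a₁) * y) hS hτ hc hF hs hst fun r hr => by
      have e3 : 2 * Cp d a₁ * (c₀ * exp (-a₁) / (2 * Cp d a₁) * y) = c₀ * exp (-a₁) * y := by field_simp
      rw [e3]
      refine mul_lt_mul_of_pos_left ?_ he
      by_contra hcon
      have hr0 : 0 ≤ r := hs.trans hr.1.le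
      have hv : var a₁ (fv G' τ ρ r) ≤ y := not_lt.1 hcon
      have hh := hol _ (fv_QB' hd hS hτ hc hF hr0) y hy0 hv
      rw [e1] at hh
      have h5 : Fr G τ (ρ r) - g/2 ≤ m := h3 _ fun T hT => by
        have h6 := f_ineq hS hτ hc hδ hF hr0 hT
        have h7 : C₀ / δ * ∫ x, (fv G' τ ρ r x - cen a₁ (fv G' τ ρ r))^2 * wg d a₂ x ≤ C₀ / δ * (B * (δ * g / (2 * C₀ * B))) := 
          mul_le_mul_of_nonneg_left hh (by positivity)
        have h8 : C₀ / δ * (B * (δ * g / (2 * C₀ * B))) = g / 2 := by field_simp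
        linarith
      have h9 := E_anti hd hS hτ hc hF hr0 hr.2.le
      linarith
    rw [e2] at ed
    linarith

end

section

open scoped ContDiff
variable {d : ℕ}

lemma exists_rep {μ : Measure (Ed d)} [IsProbabilityMeasure μ] {ρ lo up : Ed d → ℝ} (h : μ = volume.withDensity (fun x => ENNReal.ofReal (ρ x)))
    (hlo : ∀ x, lo x ≤ ρ x) (hup : ∀ x, ρ x ≤ up x) (hlo0 : ∀ x, 0 < lo x) (hm : Measurable lo) :
    ∃ k : Ed d → ℝ, Measurable k ∧ μ = mu k ∧ ∀ x, lo x ≤ k x ∧ k x ≤ up x := by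
  obtain ⟨g, gm, gle, gd⟩ := exists_measurable_le_withDensity_eq (μ := (volume : Measure (Ed d))) (fun x => ENNReal.ofReal (ρ x))
  have hge : (fun x => ENNReal.ofReal (lo x)) ≤ᵐ[volume] g := by
    refine ae_le_of_forall_setLIntegral_le_of_sigmaFinite hm.ennreal_ofReal fun s hs _ => ?_
    rw [← withDensity_apply _ hs, ← withDensity_apply _ hs, gd]
    rw [withDensity_apply _ hs, withDensity_apply _ hs]
    exact lintegral_mono fun x => ENNReal.ofReal_le_ofReal (hlo x)
  have gtop : ∀ x, g x ≠ ⊤ := fun x => ne_top_of_le_ne_top ENNReal.ofReal_ne_top (gle x)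
  refine ⟨fun x => max (g x).toReal (lo x), gm.ennreal_toReal.max hm, ?_, fun x => ⟨le_max_right _ _, max_le ?_ ((hlo x).trans (hup x))⟩⟩
  · rw [h, ← gd, mu]
    refine withDensity_congr_ae ?_
    filter_upwards [hge] with x hx
    have : lo x ≤ (g x).toReal := (ENNReal.ofReal_le_iff_le_toReal (gtop x)).1 hx
    rw [max_eq_left this, ENNReal.ofReal_toReal (gtop x)]
  · refine le_trans ?_ (hup x)
    have := ENNReal.toReal_mono ENNReal.ofReal_ne_top (gle x)
    rwa [ENNReal.toReal_ofReal ((hlo0 x).le.trans (hlo x))] at this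

lemma inner_grad (f g : Ed d → ℝ) (x : Ed d) : ⟪gradient f x, gradient g x⟫ = ∑ i, pd i f x * pd i g x := by
  have e : ∀ (h : Ed d → ℝ) i, gradient h x i = pd i h x := fun h i => by
    have h1 : inner ℝ (gradient h x) (EuclideanSpace.single i (1:ℝ)) = fderiv ℝ h x (EuclideanSpace.single i 1) := by
      rw [gradient]; exact InnerProductSpace.toDual_symm_apply
    rw [EuclideanSpace.inner_single_right] at h1
    simpa [pd] using h1
  rw [PiLp.inner_apply]
  simp only [e]
  refine Finset.sum_congr rfl fun i _ => ?_
  simp [mul_comm]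

lemma lap_eq {φ : Ed d → ℝ} (hφ : ContDiff ℝ ∞ φ) (x : Ed d) : lap φ x = ∑ i, pd i (pd i φ) x := by
  rw [lap]
  refine Finset.sum_congr rfl fun i _ => ?_
  rw [iteratedFDeriv_two_apply]
  have hd : DifferentiableAt ℝ (fderiv ℝ φ) x := ((hφ.fderiv_right (m := ((⊤ : ℕ∞) : WithTop ℕ∞)) (by simp)).differentiable (by simp)) x
  have : pd i (pd i φ) x = fderiv ℝ (fun y => fderiv ℝ φ y (EuclideanSpace.single i 1)) x (EuclideanSpace.single i 1) := rfl
  rw [this, fderiv_clm_apply hd (differentiableAt_const _)]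
  simp

lemma pd_sub_const (f : Ed d → ℝ) (c : ℝ) (i : Fin d) (x : Ed d) : pd i (fun y => f y - c) x = pd i f x := by
  rw [pd, pd, fderiv_sub_const]

lemma nice_rep {k : Ed d → ℝ} {c₀ a₁ C₀ a₂ : ℝ} (h1 : 0 < c₀) (h2 : 0 < a₁) (h3 : 0 < C₀) (h4 : 0 < a₂) (hm : Measurable k)
    [IsProbabilityMeasure (mu k)] (hb : ∀ x, c₀ * exp (-a₁ * ‖x‖^2) ≤ k x ∧ k x ≤ C₀ * exp (-a₂ * ‖x‖^2)) : Nice c₀ a₁ C₀ a₂ k where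
  c₀pos := h1
  a₁pos := h2
  C₀pos := h3
  a₂pos := h4
  meas := hm
  int1 := by
    have := integral_mu hm (fun x => (mul_pos h1 (exp_pos _)).le.trans (hb x).1) (fun _ => 1)
    simpa using this.symm
  lb x := (hb x).1
  ub x := (hb x).2

lemma flow_of_wgf {G : Measure (Ed d) → ℝ} {G' : Measure (Ed d) → Ed d → ℝ} {τ α L c₀ a₁ C₀ a₂ : ℝ} {μ : ℝ → Measure (Ed d)} {ρ : ℝ → Ed d → ℝ}
    (h1 : 0 < c₀) (h2 : 0 < a₁) (h3 : 0 < C₀) (h4 : 0 < a₂) (hA : AssumptionAii G G' α L) (hW : IsWGF G G' τ μ ρ)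
    (h0 : μ 0 = volume.withDensity (fun x => ENNReal.ofReal (ρ 0 x)))
    (hb : ∀ t : ℝ, 0 ≤ t → ∀ x, c₀ * exp (-a₁ * ‖x‖^2) ≤ ρ t x ∧ ρ t x ≤ C₀ * exp (-a₂ * ‖x‖^2)) :
    ∃ k : ℝ → Ed d → ℝ, (∀ t, 0 ≤ t → μ t = mu (k t)) ∧ Flow (fun μ x => G' μ x - G' μ 0) τ c₀ a₁ C₀ a₂ α L k := by
  have hex : ∀ t : ℝ, ∃ k : Ed d → ℝ, 0 ≤ t → Measurable k ∧ μ t = mu k ∧ ∀ x, c₀ * exp (-a₁ * ‖x‖^2) ≤ k x ∧ k x ≤ C₀ * exp (-a₂ * ‖x‖^2) := by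
    intro t
    by_cases ht : 0 ≤ t
    · have := (hW.isP2 t ht).1
      have hd : μ t = volume.withDensity (fun x => ENNReal.ofReal (ρ t x)) := by
        rcases ht.eq_or_lt with rfl | ht'
        · exact h0
        · exact hW.density_eq t ht'
      obtain ⟨k, hk⟩ := exists_rep hd (fun x => (hb t ht x).1) (fun x => (hb t ht x).2) (fun x => mul_pos h1 (exp_pos _)) (by fun_prop)
      exact ⟨k, fun _ => hk⟩
    · exact ⟨0, fun h => absurd h ht⟩
  choose k hk using hex
  have hN : ∀ t, 0 ≤ t → Nice c₀ a₁ C₀ a₂ (k t) := fun t ht => by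
    have : IsProbabilityMeasure (mu (k t)) := by rw [← (hk t ht).2.1]; exact (hW.isP2 t ht).1
    exact nice_rep h1 h2 h3 h4 (hk t ht).1 (hk t ht).2.2
  refine ⟨k, fun t ht => (hk t ht).2.1, ⟨hN, fun t ht => (setup_of_aii hA _ (hN t ht).dens.isP2).2, fun φ hφ hcs s t hs hst => ?_⟩⟩
  have hp := hW.pde φ hφ hcs s t hs hst
  have ht := hs.trans hst
  rw [(hk s hs).2.1, (hk t ht).2.1, integral_mu (hN s hs).meas (fun x => ((hN s hs).pos x).le), integral_mu (hN t ht).meas (fun x => ((hN t ht).pos x).le)] at hp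
  rw [hp]
  refine intervalIntegral.integral_congr fun r hr => ?_
  rw [uIcc_of_le hst] at hr
  have hr0 : 0 ≤ r := hs.trans hr.1
  simp only [Ag]
  rw [(hk r hr0).2.1]
  congr 1
  ext x
  rw [inner_grad, lap_eq hφ, Finset.mul_sum, ← Finset.sum_neg_distrib, ← Finset.sum_add_distrib]
  simp only [pd_sub_const]

lemma infObj_eq {G : Measure (Ed d) → ℝ} {τ m : ℝ} (hτ : 0 < τ) {k : ℝ → Ed d → ℝ} (hk : ∀ t, 0 ≤ t → Dens (k t)) 
    (hν : ∀ ν : Ed d → ℝ, Dens ν → m ≤ Fr G τ ν) (hm : ∀ b, (∀ t, 0 ≤ t → b ≤ Fr G τ (k t)) → b ≤ m) : infObj G τ = (m : EReal) := by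
  refine le_antisymm ?_ ?_
  · have hle : ∀ t, 0 ≤ t → infObj G τ ≤ (Fr G τ (k t) : EReal) := fun t ht => by
      rw [← obj_mu (hk t ht)]
      exact iInf_le (fun ν : {ν : Measure (Ed d) // IsP2 ν} => obj G τ ν.1) ⟨mu (k t), (hk t ht).isP2⟩
    induction h : infObj G τ with
    | bot => exact bot_le
    | top => have := hle 0 le_rfl; rw [h] at this; simp at this
    | coe b =>
      rw [EReal.coe_le_coe_iff]
      refine hm b fun t ht => ?_
      have := hle t ht
      rw [h] at this
      exact EReal.coe_le_coe_iff.1 this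
  · refine le_iInf fun ν => ?_
    by_cases hn : negEnt ν.1 = ⊤
    · rw [obj, hn, EReal.coe_mul_top_of_pos hτ, EReal.coe_add_top]; exact le_top
    · obtain ⟨f, hf, e⟩ := exists_dens ν.2 hn
      rw [e, obj_mu hf, EReal.coe_le_coe_iff]
      exact hν f hf

lemma gap_zero_dim {G : Measure (Ed 0) → ℝ} {G' : Measure (Ed 0) → Ed 0 → ℝ} {τ : ℝ} {μ : ℝ → Measure (Ed 0)} {ρ : ℝ → Ed 0 → ℝ}
    (hW : IsWGF G G' τ μ ρ) {t : ℝ} (ht : 0 ≤ t) : gap G τ μ t = 0 := by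
  have huniq : ∀ ν₁ ν₂ : Measure (Ed 0), IsP2 ν₁ → IsP2 ν₂ → ν₁ = ν₂ := fun ν₁ ν₂ h1 h2 => by
    have := h1.1
    have := h2.1
    ext s _
    rcases Subsingleton.eq_empty_or_singleton (Set.subsingleton_of_subsingleton (s := s)) with rfl | ⟨x, rfl⟩
    · simp
    · have : ({x} : Set (Ed 0)) = univ := by ext y; simp [Subsingleton.elim y x]
      rw [this]; simp
  have hi : infObj G τ = obj G τ (μ t) := by
    have : ∀ ν : {ν : Measure (Ed 0) // IsP2 ν}, obj G τ ν.1 = obj G τ (μ t) := fun ν => by rw [huniq ν.1 (μ t) ν.2 (hW.isP2 t ht)]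
    have hne : Nonempty {ν : Measure (Ed 0) // IsP2 ν} := ⟨⟨μ t, hW.isP2 t ht⟩⟩
    rw [infObj, iInf_congr this, ciInf_const]
  rw [gap, hi, EReal.sub_self (hW.finite t ht).1 (hW.finite t ht).2]
  simp

lemma gauss_eq (d : ℕ) (m σ : ℝ) (x : Ed d) : m * gaussDen d σ x = (m * (2 * π * σ^2)^(-(d:ℝ)/2)) * exp (-(1/(2*σ^2)) * ‖x‖^2) := by
  rw [gaussDen, ← mul_assoc]
  congr 2
  ring

theorem main (d : ℕ) (τ σ₁ σ₂ m M κ L : ℝ)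
    (hτ : 0 < τ) (hσ₁ : 0 < σ₁) (hσ : σ₁ < σ₂) (hm : 0 < m) (hM : 0 < M)
    (hκ0 : 0 < κ) (hκ : κ < σ₁ ^ 2 / (σ₂ ^ 2 - σ₁ ^ 2)) :
    ∃ C : ℝ, 0 < C ∧
      ∀ (α : ℝ), 0 < α →
      ∀ (G : Measure (Ed d) → ℝ) (G' : Measure (Ed d) → Ed d → ℝ)
        (μ : ℝ → Measure (Ed d)) (ρ : ℝ → Ed d → ℝ),
        AssumptionAii G G' α L →
        ConvexFun (obj G τ) →
        tauC G < τ →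
        IsWGF G G' τ μ ρ →
        μ 0 = volume.withDensity (fun x => ENNReal.ofReal (ρ 0 x)) →
        (∀ t : ℝ, 0 ≤ t → ∀ x : Ed d,
          m * gaussDen d σ₁ x ≤ ρ t x ∧ ρ t x ≤ M * gaussDen d σ₂ x) →
        ∀ t : ℝ, 0 ≤ t →
          gap G τ μ t ≤
            ((gap G τ μ 0) ^ (-(1 / κ)) + C * (τ - tauC G) ^ (1 + 1 / κ) * t) ^ (-κ) := by
  have hσ₂ : 0 < σ₂ := hσ₁.trans hσ
  by_cases hd : d = 0
  · subst hd
    refine ⟨1, one_pos, fun α hα G G' μ ρ hA hc hδ hW h0 hb t ht => ?_⟩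
    rw [gap_zero_dim hW ht, gap_zero_dim hW le_rfl]
    have : 0 < τ - tauC G := by linarith
    exact rpow_nonneg (add_nonneg (rpow_nonneg le_rfl _) (by positivity)) _
  · have hc0 : 0 < m * (2 * π * σ₁^2)^(-(d:ℝ)/2) := by positivity
    have hC0 : 0 < M * (2 * π * σ₂^2)^(-(d:ℝ)/2) := by positivity
    have ha1 : 0 < 1/(2*σ₁^2) := by positivity
    have ha2 : 0 < 1/(2*σ₂^2) := by positivity
    have hk : κ / (1 + κ) * (1/(2*σ₁^2)) < 1/(2*σ₂^2) := by
      have h1 : 0 < σ₂^2 - σ₁^2 := by nlinarith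
      rw [lt_div_iff₀ h1] at hκ
      rw [div_mul_div_comm, div_lt_div_iff₀ (by positivity) (by positivity)]
      nlinarith
    obtain ⟨C, hC, H⟩ := flow_rate (L := L) hd hτ hc0 ha1 hC0 hκ0 hk
    refine ⟨C, hC, fun α hα G G' μ ρ hA hc hδ hW h0 hb t ht => ?_⟩
    obtain ⟨k, hμ, hF⟩ := flow_of_wgf hc0 ha1 hC0 ha2 hA hW h0 fun t ht x => by
      have := hb t ht x
      rwa [gauss_eq, gauss_eq] at this
    obtain ⟨b, h1, h2, h3, h4⟩ := H α G _ k (setup_of_aii hA) hc hδ hF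
    have hinf := infObj_eq hτ (fun t ht => (hF.nice t ht).dens) h2 h3
    have hgap : ∀ t, 0 ≤ t → gap G τ μ t = Fr G τ (k t) - b := fun t ht => by
      rw [gap, hμ t ht, hinf, obj_mu (hF.nice t ht).dens, ← EReal.coe_sub, EReal.toReal_coe]
    rw [hgap t ht, hgap 0 le_rfl]
    exact h4 t ht

end

end WGF

/-- **Lemma 3.1**: in the strongly convex case `τ > τ_c` on `ℝ^d`, two-sided Gaussian bounds on
the densities of the flow imply a polynomial convergence rate of any order
`0 < κ < σ₁²/(σ₂² - σ₁²)`. -/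
theorem wgf_strongly_convex_principle_Rd (d : ℕ) (τ σ₁ σ₂ m M κ L : ℝ)
    (hτ : 0 < τ) (hσ₁ : 0 < σ₁) (hσ : σ₁ < σ₂) (hm : 0 < m) (hM : 0 < M) (hL : 0 < L)
    (hκ0 : 0 < κ) (hκ : κ < σ₁ ^ 2 / (σ₂ ^ 2 - σ₁ ^ 2)) :
    ∃ C : ℝ, 0 < C ∧
      ∀ (α : ℝ), 0 < α →
      ∀ (G : Measure (Ed d) → ℝ) (G' : Measure (Ed d) → Ed d → ℝ)
        (μ : ℝ → Measure (Ed d)) (ρ : ℝ → Ed d → ℝ),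
        AssumptionAii G G' α L →
        ConvexFun (obj G τ) →
        tauC G < τ →
        IsWGF G G' τ μ ρ →
        μ 0 = volume.withDensity (fun x => ENNReal.ofReal (ρ 0 x)) →
        (∀ t : ℝ, 0 ≤ t → ∀ x : Ed d,
          m * gaussDen d σ₁ x ≤ ρ t x ∧ ρ t x ≤ M * gaussDen d σ₂ x) →
        ∀ t : ℝ, 0 ≤ t →
          gap G τ μ t ≤
            ((gap G τ μ 0) ^ (-(1 / κ)) + C * (τ - tauC G) ^ (1 + 1 / κ) * t) ^ (-κ) := by
  exact WGF.main d τ σ₁ σ₂ m M κ L hτ hσ₁ hσ hm hM hκ0 hκ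

end
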